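/- arXiv:2408.04061 — 11 statements merged into one kernel-verified Lean document; each statement's English description precedes it below -/
import Mathlib

section
/- Let p be an odd prime, F a finite field of characteristic p, and 𝕎F the ring of p-typical Witt vectors over F (the ring of integers of the unramified extension of ℤ_p with residue field F), with Frobenius ring endomorphism σ = WittVector.frobenius. Let M be an m×m matrix over 𝕎F and let i be a positive integer whose p-adic valuation j = v_p(i) satisfies j ≥ 1. Then trace(M^i) − σ(trace(M^{i/p})) lies in the ideal of 𝕎F generated by p^j, i.e. trace(M^i) ≡ σ(trace(M^{i/p})) (mod p^j). -/
open Matrix PowerSeries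

namespace Derivation

variable {R A : Type*} [CommRing R] [CommRing A] [Algebra R A]

theorem leibniz_finset_prod {ι : Type*} [DecidableEq ι] (D : Derivation R A A) (s : Finset ι)
    (f : ι → A) : D (∏ i ∈ s, f i) = ∑ i ∈ s, (∏ k ∈ s.erase i, f k) * D (f i) := by
  induction s using Finset.induction_on with
  | empty => simp
  | insert a s ha ih =>
    rw [Finset.prod_insert ha, D.leibniz, ih, Finset.sum_insert ha, Finset.erase_insert ha,
      smul_eq_mul, smul_eq_mul, Finset.mul_sum, add_comm]
    congr 1
    refine Finset.sum_congr rfl fun i hi => ?_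
    rw [Finset.erase_insert_of_ne (by rintro rfl; exact ha hi),
      Finset.prod_insert (fun h => ha (Finset.mem_of_mem_erase h)), mul_assoc]

/-- Jacobi's formula for the derivative of a determinant. -/
theorem map_det {n : Type*} [DecidableEq n] [Fintype n] (D : Derivation R A A)
    (M : Matrix n n A) : D M.det = trace (M.adjugate * M.map D) := by
  have h : ∀ i, (M.adjugate * M.map D) i i = (M.updateCol i fun k => D (M k i)).det := by
    intro i
    rw [← cramer_apply, cramer_eq_adjugate_mulVec, mul_apply, mulVec, dotProduct]
    rfl
  simp only [trace, diag_apply, h, det_apply]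
  rw [map_sum, Finset.sum_comm]
  refine Finset.sum_congr rfl fun τ _ => ?_
  rw [Units.smul_def, map_zsmul, leibniz_finset_prod, Finset.smul_sum]
  refine Finset.sum_congr rfl fun i _ => ?_
  rw [Units.smul_def, ← Finset.prod_erase_mul _ _ (Finset.mem_univ i)]
  congr 2
  · refine Finset.prod_congr rfl fun k hk => ?_
    rw [updateCol_ne (Finset.ne_of_mem_erase hk)]
  · rw [updateCol_self]

end Derivation

namespace Matrix

variable {R S : Type*} [CommRing R] [CommRing S] {n : Type*} [DecidableEq n] [Fintype n]

theorem charpolyRev_map (M : Matrix n n R) (f : R →+* S) :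
    (M.map f).charpolyRev = M.charpolyRev.map f := by
  rw [charpolyRev, charpolyRev, ← Polynomial.coe_mapRingHom, RingHom.map_det]
  congr 1
  ext1 i j
  by_cases h : i = j <;> simp [h]

theorem coe_charpolyRev (M : Matrix n n R) :
    (M.charpolyRev : R⟦X⟧) = det (1 - (X : R⟦X⟧) • M.map (C (R := R))) := by
  rw [charpolyRev, ← Polynomial.coeToPowerSeries.ringHom_apply, RingHom.map_det]
  congr 1
  ext1 i j
  by_cases h : i = j <;> simp [h, (commute_X _).eq]

theorem derivative_coe_charpolyRev (M : Matrix n n R) :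
    derivative R (M.charpolyRev : R⟦X⟧) =
      -((M.charpolyRev : R⟦X⟧) * PowerSeries.mk fun k => trace (M ^ (k + 1))) := by
  set T : Matrix n n R⟦X⟧ := 1 - (X : R⟦X⟧) • M.map (C (R := R)) with hT
  let N : Matrix n n R⟦X⟧ := of fun a b => PowerSeries.mk fun k => (M ^ k) a b
  have hMN : M.map (C (R := R)) * N =
      of fun a b => PowerSeries.mk fun k => (M ^ (k + 1)) a b := by
    ext a b k
    simp [N, mul_apply, pow_succ']
  have hTN : T * N = 1 := by
    rw [hT, sub_mul, one_mul, smul_mul, hMN]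
    ext a b k
    rcases eq_or_ne a b with rfl | h
    · cases k <;> simp [N, coeff_succ_X_mul, coeff_one]
    · cases k <;> simp [N, h, coeff_succ_X_mul]
  have hadj : T.adjugate = T.det • N := by
    rw [← mul_one T.adjugate, ← hTN, ← mul_assoc, adjugate_mul, smul_mul, one_mul]
  have hD : T.map (derivative R) = -M.map (C (R := R)) := by
    ext1 a b
    by_cases h : a = b <;> simp [hT, h]
  rw [coe_charpolyRev, ← hT, Derivation.map_det, hadj, hD, smul_mul, trace_smul, smul_eq_mul,
    mul_neg, trace_neg, trace_mul_comm, hMN, mul_neg]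
  congr 2
  ext k
  simp [trace]

theorem expand_charpolyRev_pow_char (p : ℕ) [Fact p.Prime] [CharP R p] (M : Matrix n n R) :
    Polynomial.expand R p (M ^ p).charpolyRev = M.charpolyRev ^ p := by
  cases isEmpty_or_nonempty n
  · simp [charpolyRev]
  have h : (Polynomial.expand R p : Polynomial R →ₐ[R] Polynomial R).mapMatrix
      (1 - (Polynomial.X : Polynomial R) • (M ^ p).map Polynomial.C) =
      (1 - (Polynomial.X : Polynomial R) • M.map Polynomial.C) ^ p := by
    rw [sub_pow_char_of_commute p (Commute.one_left _), one_pow, smul_pow]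
    have : M.map Polynomial.C ^ p = (M ^ p).map Polynomial.C :=
      (map_pow (Polynomial.C (R := R)).mapMatrix M p).symm
    rw [this]
    ext1 i j
    by_cases h : i = j <;> simp [h]
  rw [charpolyRev, AlgHom.map_det, h, det_pow, charpolyRev]

theorem charpolyRev_pow_char (p : ℕ) [Fact p.Prime] [CharP R p] (M : Matrix n n R) :
    (M ^ p).charpolyRev = (M.map (frobenius R p)).charpolyRev := by
  apply Polynomial.expand_injective (Fact.out : p.Prime).pos
  rw [expand_charpolyRev_pow_char, charpolyRev_map, ← Polynomial.map_frobenius_expand,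
    Polynomial.map_expand]

end Matrix

section Congruence

variable {R : Type*} [CommRing R] (p : ℕ) [Fact p.Prime]

theorem pow_dvd_pow_mul_of_succ_mul_eq {k b : ℕ} {c d : R}
    (h : ((k + 1 : ℕ) : R) * c = (p : R) ^ b * d) :
    (p : R) ^ (b + 1) ∣ (p : R) ^ (k + 1) * c := by
  have hp : p.Prime := Fact.out
  obtain ⟨a, u, hu, hk⟩ := Nat.exists_eq_pow_mul_and_not_dvd k.succ_ne_zero p hp.ne_one
  have ha : a ≤ k := by
    have h1 : a < p ^ a := Nat.lt_pow_self hp.one_lt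
    have h2 : p ^ a ≤ k + 1 := Nat.le_of_dvd k.succ_pos ⟨u, hk⟩
    omega
  have hcop : IsCoprime ((p : R) ^ b) (u : R) := by
    have : IsCoprime ((p : ℤ)) (u : ℤ) :=
      Nat.isCoprime_iff_coprime.2 ((Nat.Prime.coprime_iff_not_dvd hp).2 hu)
    simpa using (this.pow_left (m := b)).map (Int.castRingHom R)
  have hdvd : (p : R) ^ b ∣ (p : R) ^ a * c := by
    refine hcop.dvd_of_dvd_mul_left ⟨d, ?_⟩
    rw [← h, ← Nat.succ_eq_add_one, hk]
    push_cast
    ring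
  obtain ⟨e, rfl⟩ := Nat.exists_eq_add_of_le ha
  have := mul_dvd_mul (Dvd.intro (p ^ e : R) (pow_succ' (p : R) e).symm) hdvd
  convert this using 1 <;> ring

theorem PowerSeries.pow_dvd_coeff_pow_mul_derivative (U : R⟦X⟧) {b m : ℕ} (hb : p ^ b ∣ m + 1)
    (k : ℕ) : (p : R) ^ (b + 1) ∣ (p : R) ^ (k + 1) * coeff m (U ^ k * derivative R U) := by
  obtain ⟨w, hw⟩ := hb
  refine pow_dvd_pow_mul_of_succ_mul_eq p (d := w * coeff (m + 1) (U ^ (k + 1))) ?_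
  have hw' : (m : R) + 1 = (p : R) ^ b * w := mod_cast congrArg (Nat.cast (R := R)) hw
  have h := congrArg (coeff m) (derivative_pow U (k + 1))
  rw [coeff_derivative, Nat.add_sub_cancel, mul_assoc, hw'] at h
  have h' : ((k + 1 : ℕ) : R⟦X⟧) = C ((k + 1 : ℕ) : R) := (map_natCast C _).symm
  rw [h', coeff_C_mul] at h
  rw [← h]
  ring

theorem PowerSeries.pow_dvd_coeff_of_one_add_mul_eq_derivative {U D : R⟦X⟧}
    (h : (1 + C (p : R) * U) * D = C (p : R) * derivative R U) {b m : ℕ} (hb : p ^ b ∣ m + 1) :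
    (p : R) ^ (b + 1) ∣ coeff m D := by
  have key : ∀ K : ℕ, D = ∑ k ∈ Finset.range K,
      (C ((-1) ^ k * (p : R) ^ (k + 1)) * (U ^ k * derivative R U)) +
        C ((-p : R) ^ K) * (U ^ K * D) := by
    intro K
    induction K with
    | zero => simp
    | succ K ih =>
      rw [Finset.sum_range_succ, add_assoc]
      convert ih using 2
      simp only [map_mul, map_pow, map_neg, map_one, neg_pow (C (p : R))]
      linear_combination (-1) ^ K * C (p : R) ^ K * U ^ K * (-h)
  rw [key (b + 1), map_add, map_sum]
  refine dvd_add (Finset.dvd_sum fun k _ => ?_) ?_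
  · rw [coeff_C_mul, mul_assoc]
    exact (pow_dvd_coeff_pow_mul_derivative p U hb k).mul_left _
  · rw [coeff_C_mul, neg_pow, mul_comm ((-1 : R) ^ (b + 1)), mul_assoc]
    exact dvd_mul_right _ _

theorem Matrix.pow_dvd_trace_pow_sub_trace_pow {n : Type*} [DecidableEq n] [Fintype n]
    {A B : Matrix n n R} (h : ∀ k, (p : R) ∣ (A.charpolyRev - B.charpolyRev).coeff k)
    {b k : ℕ} (hk : k ≠ 0) (hb : p ^ b ∣ k) :
    (p : R) ^ (b + 1) ∣ trace (A ^ k) - trace (B ^ k) := by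
  obtain ⟨m, rfl⟩ := Nat.exists_eq_succ_of_ne_zero hk
  choose f hf using h
  have hunit : IsUnit (B.charpolyRev : R⟦X⟧) := by
    rw [PowerSeries.isUnit_iff_constantCoeff, Polynomial.constantCoeff_coe,
      Polynomial.coeff_zero_eq_eval_zero, eval_charpolyRev]
    exact isUnit_one
  obtain ⟨I, hI⟩ := hunit.exists_right_inv
  set U : R⟦X⟧ := PowerSeries.mk f * I with hU
  have hAB : (A.charpolyRev : R⟦X⟧) = (1 + C (p : R) * U) * (B.charpolyRev : R⟦X⟧) := by
    have : (A.charpolyRev : R⟦X⟧) - B.charpolyRev = C (p : R) * PowerSeries.mk f := by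
      ext k
      rw [coeff_C_mul, coeff_mk, ← hf]
      simp
    linear_combination this - C (p : R) * PowerSeries.mk f * hI
  have hA := derivative_coe_charpolyRev A
  have hB := derivative_coe_charpolyRev B
  set LA : R⟦X⟧ := PowerSeries.mk fun k => trace (A ^ (k + 1)) with hLA
  set LB : R⟦X⟧ := PowerSeries.mk fun k => trace (B ^ (k + 1)) with hLB
  have hD : (1 + C (p : R) * U) * (LB - LA) = C (p : R) * derivative R U := by
    refine hunit.mul_left_cancel ?_
    rw [hAB, Derivation.leibniz, hB, map_add, Derivation.leibniz, derivative_C] at hA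
    simp only [Derivation.map_one_eq_zero, smul_eq_mul] at hA
    linear_combination -hA
  have := pow_dvd_coeff_of_one_add_mul_eq_derivative p hD hb
  rw [map_sub, hLA, hLB, coeff_mk, coeff_mk] at this
  rwa [dvd_sub_comm]

end Congruence

theorem WittVector.dvd_coeff_charpolyRev_pow_sub_charpolyRev_map_frobenius {p : ℕ}
    [Fact p.Prime] {F : Type*} [CommRing F] [CharP F p] [PerfectRing F p] {n : Type*}
    [DecidableEq n] [Fintype n] (M : Matrix n n (WittVector p F)) (k : ℕ) :
    (p : WittVector p F) ∣
      ((M ^ p).charpolyRev - (M.map WittVector.frobenius).charpolyRev).coeff k := by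
  rw [← Ideal.mem_span_singleton, ← WittVector.ker_constantCoeff, RingHom.mem_ker,
    ← Polynomial.coeff_map, Polynomial.map_sub, ← charpolyRev_map, ← charpolyRev_map]
  have h1 : (M ^ p).map (WittVector.constantCoeff (p := p) (R := F)) =
      M.map (WittVector.constantCoeff (p := p) (R := F)) ^ p :=
    map_pow (WittVector.constantCoeff (p := p) (R := F)).mapMatrix M p
  have h2 : (M.map WittVector.frobenius).map (WittVector.constantCoeff (p := p) (R := F)) =
      (M.map (WittVector.constantCoeff (p := p) (R := F))).map (_root_.frobenius F p) := by
    ext1 i j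
    exact WittVector.coeff_frobenius_charP p (M i j) 0
  rw [h1, h2, charpolyRev_pow_char, sub_self, Polynomial.coeff_zero]

/-- Traces of powers of a matrix over the Witt vectors of a finite field of odd
characteristic `p` satisfy `tr(M^i) ≡ σ(tr(M^{i/p})) (mod p^j)` where `j = v_p(i) ≥ 1`
and `σ` is the Witt vector Frobenius. -/
theorem stmt_0 (p : ℕ) [Fact p.Prime] (hodd : Odd p)
    (F : Type*) [Field F] [Fintype F] [CharP F p]
    (m : ℕ) (M : Matrix (Fin m) (Fin m) (WittVector p F))
    (i : ℕ) (hi : 0 < i) (j : ℕ) (hj : j = padicValNat p i) (hj1 : 1 ≤ j) :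
    Matrix.trace (M ^ i) - WittVector.frobenius (Matrix.trace (M ^ (i / p))) ∈
      Ideal.span {(p : WittVector p F) ^ j} := by
  have hp : p.Prime := Fact.out
  have hdvd : p ^ j ∣ i := hj ▸ pow_padicValNat_dvd
  obtain ⟨b, rfl⟩ := Nat.exists_eq_add_of_le' hj1
  obtain ⟨k, rfl⟩ : p ∣ i := (dvd_pow_self p b.succ_ne_zero).trans hdvd
  have hk : k ≠ 0 := by
    rintro rfl
    simp at hi
  have hb : p ^ b ∣ k := by
    rw [pow_succ'] at hdvd
    exact Nat.dvd_of_mul_dvd_mul_left hp.pos hdvd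
  have htr : WittVector.frobenius (Matrix.trace (M ^ k)) =
      Matrix.trace (M.map WittVector.frobenius ^ k) := by
    rw [AddMonoidHom.map_trace]
    exact congrArg _ (map_pow (WittVector.frobenius (p := p) (R := F)).mapMatrix M k)
  rw [Nat.mul_div_cancel_left _ hp.pos, htr, pow_mul, Ideal.mem_span_singleton]
  exact Matrix.pow_dvd_trace_pow_sub_trace_pow p
    (WittVector.dvd_coeff_charpolyRev_pow_sub_charpolyRev_map_frobenius M) hk hb
end

section
/- Let R be a commutative ring and ε ∈ R with ε² = 0, and let A₀, A₁ be n×n matrices over R. Then: (i) charpoly(A₀ + ε • (A₀·A₁)) = charpoly(A₀) − C(ε) · trace(adj(charmatrix A₀) · map C (A₀·A₁)) in R[X]; (ii) for arbitrary A₀, A₁ (no nilpotency needed), trace(adj(charmatrix A₀) · map C (A₀·A₁)) = X · trace(adj(charmatrix A₀) · map C A₁) − charpoly(A₀) · C(trace A₁); in particular if trace(A₁) = 0 then charpoly(A₀ + ε • (A₀·A₁)) = charpoly(A₀) − C(ε) · X · trace(adj(charmatrix A₀) · map C A₁). -/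
open Polynomial Matrix

namespace Matrix

variable {m S : Type*} [Fintype m] [DecidableEq m] [CommRing S]

/-- First-order expansion of the determinant at an invertible matrix. -/
lemma det_add_smul_of_isUnit_det {M : Matrix m m S} (hM : IsUnit M.det) {e : S} (he : e ^ 2 = 0)
    (N : Matrix m m S) : (M + e • N).det = M.det + e * (M.adjugate * N).trace := by
  obtain ⟨u, hu⟩ := hM.exists_right_inv
  have hN : M * (u • (M.adjugate * N)) = N := by
    rw [mul_smul_comm, ← Matrix.mul_assoc, mul_adjugate, smul_mul, Matrix.one_mul, smul_smul,
      mul_comm u, hu, one_smul]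
  have hfac : M + e • N = M * (1 + e • (u • (M.adjugate * N))) := by
    rw [Matrix.mul_add, Matrix.mul_one, mul_smul_comm, hN]
  rw [hfac, det_mul, det_one_add_smul, he, trace_smul, smul_eq_mul]
  linear_combination (e * (M.adjugate * N).trace) * hu

/-- First-order expansion of the determinant at a matrix whose determinant is not a zero
divisor. -/
lemma det_add_smul_of_det_mem_nonZeroDivisors {M : Matrix m m S}
    (hM : M.det ∈ nonZeroDivisors S) {e : S} (he : e ^ 2 = 0) (N : Matrix m m S) :
    (M + e • N).det = M.det + e * (M.adjugate * N).trace := by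
  let f := algebraMap S (Localization (nonZeroDivisors S))
  have hf : Function.Injective f := IsLocalization.injective _ le_rfl
  apply hf
  have hu : IsUnit (f.mapMatrix M).det := by
    rw [← RingHom.map_det]
    exact IsLocalization.map_units _ (⟨M.det, hM⟩ : nonZeroDivisors S)
  have hfe : f e ^ 2 = 0 := by rw [← map_pow, he, map_zero]
  have hsmul : f.mapMatrix (e • N) = f e • f.mapMatrix N := by
    ext i j
    simp
  have htrace : f (M.adjugate * N).trace = (f.mapMatrix (M.adjugate * N)).trace :=
    AddMonoidHom.map_trace f.toAddMonoidHom _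
  rw [RingHom.map_det, map_add, hsmul, det_add_smul_of_isUnit_det hu hfe, map_add, map_mul,
    RingHom.map_det, htrace, map_mul, RingHom.map_adjugate]

lemma charpoly_add_smul_of_sq_eq_zero {e : S} (he : e ^ 2 = 0) (A B : Matrix m m S) :
    (A + e • B).charpoly =
      A.charpoly - C e * ((charmatrix A).adjugate * B.map C).trace := by
  have hM : (charmatrix A).det ∈ nonZeroDivisors S[X] :=
    (charpoly_monic A).mem_nonZeroDivisors
  have hfac : charmatrix (A + e • B) = charmatrix A + C e • (-B.map C) := by
    ext1 i j
    simp [charmatrix_apply]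
    ring
  have hCe : (C e : S[X]) ^ 2 = 0 := by rw [← C_pow, he, C_0]
  rw [charpoly, hfac, det_add_smul_of_det_mem_nonZeroDivisors hM hCe, Matrix.mul_neg, trace_neg,
    charpoly]
  ring

lemma trace_adjugate_charmatrix_mul_map_mul (A B : Matrix m m S) :
    ((charmatrix A).adjugate * (A * B).map C).trace =
      X * ((charmatrix A).adjugate * B.map C).trace - A.charpoly * C B.trace := by
  have hA : A.map C = (X : S[X]) • (1 : Matrix m m S[X]) - charmatrix A := by
    rw [smul_one_eq_diagonal]
    simp [charmatrix]
  have htrace : (B.map C).trace = C B.trace :=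
    (AddMonoidHom.map_trace (C : S →+* S[X]).toAddMonoidHom B).symm
  rw [Matrix.map_mul, hA, Matrix.sub_mul, Matrix.mul_sub, ← Matrix.mul_assoc _ (charmatrix A),
    adjugate_mul, smul_mul, smul_mul, Matrix.one_mul, mul_smul_comm, trace_sub,
    trace_smul, trace_smul, htrace, smul_eq_mul, smul_eq_mul, charpoly]

end Matrix

/-- If `ε² = 0` in a commutative ring `R`, then (i) the characteristic polynomial of the
lift `A₀ + ε•(A₀·A₁)` equals `charpoly A₀ − C ε · tr(adj(charmatrix A₀) · map C (A₀·A₁))`;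
(ii) for arbitrary matrices, `tr(adj(charmatrix B₀) · map C (B₀·B₁)) =
X · tr(adj(charmatrix B₀) · map C B₁) − charpoly B₀ · C (tr B₁)`; in particular if
`tr A₁ = 0` then `charpoly (A₀ + ε•(A₀·A₁)) = charpoly A₀ − C ε · X ·
tr(adj(charmatrix A₀) · map C A₁)`. -/
theorem stmt_4 {R : Type*} [CommRing R] {n : ℕ} (ε : R) (hε : ε ^ 2 = 0)
    (A₀ A₁ : Matrix (Fin n) (Fin n) R) :
    ((A₀ + ε • (A₀ * A₁)).charpoly =
        A₀.charpoly - C ε * Matrix.trace ((charmatrix A₀).adjugate * (A₀ * A₁).map C)) ∧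
    (∀ B₀ B₁ : Matrix (Fin n) (Fin n) R,
        Matrix.trace ((charmatrix B₀).adjugate * (B₀ * B₁).map C) =
          X * Matrix.trace ((charmatrix B₀).adjugate * B₁.map C) -
            B₀.charpoly * C (Matrix.trace B₁)) ∧
    (Matrix.trace A₁ = 0 →
        (A₀ + ε • (A₀ * A₁)).charpoly =
          A₀.charpoly - C ε * (X * Matrix.trace ((charmatrix A₀).adjugate * A₁.map C))) := by
  refine ⟨charpoly_add_smul_of_sq_eq_zero hε _ _, trace_adjugate_charmatrix_mul_map_mul,
    fun h => ?_⟩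
  rw [charpoly_add_smul_of_sq_eq_zero hε, trace_adjugate_charmatrix_mul_map_mul, h, C_0, mul_zero,
    sub_zero]
end

section
/- Let K be a field, α ∈ K, and e ≥ 1. Let J be the e×e Jordan block with eigenvalue α, i.e. J i j = α if i = j, J i j = 1 if j = i + 1, and J i j = 0 otherwise. Then the adjugate of the characteristic matrix of J is upper triangular with entries adj(charmatrix J) i j = (X − C α)^{e − 1 − (j − i)} for i ≤ j, and 0 for i > j. -/
open Polynomial Matrix

/-- The candidate adjugate is a right inverse, up to the factor `t ^ e`, of the bidiagonal matrix
with diagonal entries `t` and superdiagonal entries `-1`. -/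
lemma bidiagonal_mul_powers {R : Type*} [CommRing R] (t : R) (e : ℕ) :
    (Matrix.of fun i j : Fin e =>
        (if i = j then t else 0) - if (j : ℕ) = (i : ℕ) + 1 then 1 else 0) *
      (Matrix.of fun i j : Fin e =>
        if (i : ℕ) ≤ (j : ℕ) then t ^ (e - 1 - ((j : ℕ) - (i : ℕ))) else 0) =
      t ^ e • (1 : Matrix (Fin e) (Fin e) R) := by
  ext i j
  have hi := i.isLt
  have hj := j.isLt
  have key : ∀ f : Fin e → R, ∑ k : Fin e, (if (k : ℕ) = (i : ℕ) + 1 then f k else 0) =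
      if h : (i : ℕ) + 1 < e then f ⟨i + 1, h⟩ else 0 := by
    intro f
    split_ifs with h
    · rw [Finset.sum_eq_single ⟨i + 1, h⟩]
      · simp
      · intro k _ hk
        exact if_neg fun h' => hk (Fin.ext h')
      · simp
    · exact Finset.sum_eq_zero fun k _ => if_neg (by omega)
  simp only [Matrix.mul_apply, Matrix.of_apply, sub_mul, Finset.sum_sub_distrib, ite_mul,
    zero_mul, one_mul, Finset.sum_ite_eq, Finset.mem_univ, if_true, key, Matrix.smul_apply,
    smul_eq_mul, Matrix.one_apply]
  rcases lt_trichotomy (i : ℕ) (j : ℕ) with h | h | h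
  · have hne : i ≠ j := fun h' => h.ne (congrArg Fin.val h')
    rw [if_pos h.le, dif_pos (by omega), if_pos (by omega), if_neg hne, ← pow_succ',
      mul_zero, sub_eq_zero]
    congr 1
    omega
  · obtain rfl := Fin.ext h
    have he : e - 1 + 1 = e := by omega
    simp [← pow_succ', he]
  · have hne : i ≠ j := fun h' => h.ne' (congrArg Fin.val h')
    have h1 : ¬ (i : ℕ) ≤ j := by omega
    have h2 : ¬ (i : ℕ) + 1 ≤ j := by omega
    simp [h1, h2, hne]

/-- For the `e×e` Jordan block `J` with eigenvalue `α` over a field `K`, the adjugate of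
the characteristic matrix of `J` is upper triangular with entries
`(X − C α)^(e − 1 − (j − i))` for `i ≤ j` and `0` below the diagonal. -/
theorem stmt_5 {K : Type*} [Field K] (α : K) (e : ℕ) (he : 1 ≤ e)
    (J : Matrix (Fin e) (Fin e) K)
    (hJ : ∀ i j : Fin e, J i j =
      if i = j then α else if (j : ℕ) = (i : ℕ) + 1 then 1 else 0) :
    ∀ i j : Fin e, (charmatrix J).adjugate i j =
      if (i : ℕ) ≤ (j : ℕ) then (X - C α) ^ (e - 1 - ((j : ℕ) - (i : ℕ))) else 0 := by
  have hM : charmatrix J = Matrix.of fun i j : Fin e =>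
      (if i = j then X - C α else 0) - if (j : ℕ) = (i : ℕ) + 1 then 1 else 0 := by
    ext1 i j
    by_cases h : i = j
    · subst h
      simp [charmatrix_apply_eq, hJ]
    · rw [charmatrix_apply_ne _ _ _ h, hJ]
      by_cases h' : (j : ℕ) = (i : ℕ) + 1 <;> simp [h, h']
  have hdet : (charmatrix J).det = (X - C α) ^ e := by
    rw [Matrix.det_of_isUpperTriangular]
    · simp [charmatrix_apply_eq, hJ]
    · intro i j hij
      have hlt : (j : ℕ) < i := hij
      have hne : i ≠ j := fun h' => hlt.ne' (congrArg Fin.val h')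
      have h' : ¬ (j : ℕ) = (i : ℕ) + 1 := by omega
      simp [hJ, hne, h']
  have hmul := bidiagonal_mul_powers (X - C α) e
  rw [← hM] at hmul
  have h := congrArg (fun A => (charmatrix J).adjugate * A) hmul
  simp only [← Matrix.mul_assoc, Matrix.adjugate_mul, hdet, Matrix.smul_mul, Matrix.one_mul,
    Matrix.mul_smul, Matrix.mul_one] at h
  intro i j
  have hij := congrFun (congrFun h i) j
  simp only [Matrix.smul_apply, smul_eq_mul, Matrix.of_apply] at hij
  exact (mul_left_cancel₀ (pow_ne_zero e (X_sub_C_ne_zero α)) hij).symm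
end

section
/- Let F be a finite field of odd characteristic and A an invertible n×n matrix over F. Then the range of the F-linear map sending an arbitrary n×n matrix B over F to trace(adj(charmatrix A) · map C B) ∈ F[X] is exactly the set { (charpoly A /ₘ minpoly F A) · a : a ∈ F[X], deg a < deg(minpoly F A) }. -/
open Polynomial Matrix

namespace Matrix

variable {n R : Type*} [Fintype n] [DecidableEq n] [CommRing R]

/-- `charmatrix A` divides `p(X) - p(A)` on the right. -/
theorem exists_smul_one_eq_mul_charmatrix_add (A : Matrix n n R) (p : R[X]) :
    ∃ Q : Matrix n n R[X], p • 1 = Q * charmatrix A + (aeval A p).map C := by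
  have hX : charmatrix A = (X : R[X]) • 1 - A.map C := by
    rw [charmatrix, scalar_apply, smul_one_eq_diagonal]; rfl
  induction p using Polynomial.induction_on' with
  | add p q hp hq =>
    obtain ⟨P, hP⟩ := hp
    obtain ⟨Q, hQ⟩ := hq
    refine ⟨P + Q, ?_⟩
    rw [add_smul, hP, hQ, map_add, Matrix.map_add C (map_add C), add_mul]
    abel
  | monomial k a =>
    induction k with
    | zero =>
      refine ⟨0, ?_⟩
      ext i j : 1
      by_cases h : i = j <;> simp [h, algebraMap_matrix_apply]
    | succ k ih =>
      obtain ⟨Q, hQ⟩ := ih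
      refine ⟨(X : R[X]) • Q + (aeval A (monomial k a)).map C, ?_⟩
      have hA : (aeval A (monomial (k + 1) a)).map C =
          (aeval A (monomial k a)).map C * A.map C := by
        rw [← Matrix.map_mul, ← monomial_mul_X, map_mul, aeval_X]
      rw [hA, ← X_mul_monomial (R := R), mul_smul, hQ, add_mul, hX]
      simp only [mul_sub, smul_add, smul_sub, smul_mul_assoc, mul_smul_comm, mul_one]
      abel

/-- If `Q * charmatrix A` is the scalar matrix `p`, then `p` annihilates `A`. -/
theorem aeval_eq_zero_of_mul_charmatrix_eq_smul_one {A : Matrix n n R} {p : R[X]}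
    {Q : Matrix n n R[X]} (h : Q * charmatrix A = p • 1) : aeval A p = 0 := by
  have h' := congrArg (fun M => (matPolyEquiv M).eval A) h
  simpa [matPolyEquiv_charmatrix, eval_mul_X_sub_C, matPolyEquiv_smul_one, eval_map_algebraMap]
    using h'.symm

/-- Left division by `charmatrix A` with constant remainder. -/
theorem exists_eq_charmatrix_mul_add_map_C (A : Matrix n n R) (M : Matrix n n R[X]) :
    ∃ (N : Matrix n n R[X]) (B : Matrix n n R), M = charmatrix A * N + B.map C := by
  have hdeg : (matPolyEquiv M %ₘ (X - C A)).degree ≤ 0 := by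
    nontriviality Matrix n n R
    have := degree_modByMonic_lt (matPolyEquiv M) (monic_X_sub_C A)
    rw [degree_X_sub_C] at this
    exact Nat.WithBot.lt_one_iff_le_zero.mp this
  refine ⟨matPolyEquiv.symm (matPolyEquiv M /ₘ (X - C A)),
    (matPolyEquiv M %ₘ (X - C A)).coeff 0, matPolyEquiv.injective ?_⟩
  rw [map_add, map_mul, matPolyEquiv_charmatrix, AlgEquiv.apply_symm_apply, matPolyEquiv_map_C,
    ← eq_C_of_degree_le_zero hdeg, add_comm, modByMonic_add_div]

/-- The entries of a left cofactor of `charmatrix A` in the scalar matrix `p` have degree smaller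
than that of `p`. -/
theorem degree_apply_lt_of_mul_charmatrix_eq_smul_one {A : Matrix n n R} {p : R[X]} (hp : p ≠ 0)
    {Q : Matrix n n R[X]} (h : Q * charmatrix A = p • 1) (i j : n) :
    (Q i j).degree < p.degree := by
  have : Nonempty n := ⟨i⟩
  have : Nontrivial R := Polynomial.nontrivial_iff.mp ⟨p, 0, hp⟩
  have h' := congrArg (fun M => (matPolyEquiv M).degree) h
  simp only [map_mul, matPolyEquiv_charmatrix, matPolyEquiv_smul_one,
    (monic_X_sub_C A).degree_mul, degree_X_sub_C] at h'
  have hle : (matPolyEquiv Q).degree + 1 ≤ p.degree := h' ▸ degree_map_le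
  rw [degree_eq_natDegree hp, degree_lt_iff_coeff_zero]
  intro k hk
  rw [← matPolyEquiv_coeff_apply, coeff_eq_zero_of_degree_lt, zero_apply]
  by_cases hQ : matPolyEquiv Q = 0
  · rw [hQ, degree_zero]
    exact WithBot.bot_lt_coe k
  · rw [degree_eq_natDegree hQ, degree_eq_natDegree hp] at hle
    rw [degree_eq_natDegree hQ]
    norm_cast at hle ⊢
    omega

variable {F : Type*} [Field F]

/-- The entries of the left cofactor of `charmatrix A` in its minimal polynomial generate the
unit ideal. -/
theorem exists_trace_mul_eq_of_mul_charmatrix_eq_minpoly [Nonempty n] {A : Matrix n n F}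
    {Q : Matrix n n F[X]} (h : Q * charmatrix A = minpoly F A • 1) (a : F[X]) :
    ∃ M : Matrix n n F[X], trace (Q * M) = a := by
  let φ : Matrix n n F[X] →ₗ[F[X]] F[X] :=
    (traceLinearMap n F[X] F[X]).comp (LinearMap.mulLeft F[X] Q)
  let J : Ideal F[X] := LinearMap.range φ
  obtain ⟨g, hg⟩ := (IsPrincipalIdealRing.principal J).principal
  have hdvd (i j : n) : g ∣ Q i j := by
    rw [← Ideal.mem_span_singleton, Ideal.span, ← hg]
    exact ⟨single j i 1, by simp [φ, trace_mul_single]⟩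
  choose Q' hQ' using hdvd
  have hQ : Q = g • of Q' := by
    ext i j : 1
    exact hQ' i j
  have hm0 : minpoly F A ≠ 0 := minpoly.ne_zero (Matrix.isIntegral A)
  have hgm : g ∣ minpoly F A := by
    let i : n := Classical.arbitrary n
    have := congrFun (congrFun h i) i
    rw [hQ, smul_mul_assoc] at this
    exact ⟨_, by simpa using this.symm⟩
  obtain ⟨r, hr⟩ := hgm
  have hg0 : g ≠ 0 := left_ne_zero_of_mul (hr ▸ hm0)
  have hr0 : r ≠ 0 := right_ne_zero_of_mul (hr ▸ hm0)
  have hQr : of Q' * charmatrix A = r • 1 := by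
    rw [hQ, hr, smul_mul_assoc, mul_smul] at h
    exact smul_right_injective _ hg0 h
  have hmr : g * r ∣ 1 * r := by
    rw [← hr, one_mul]
    exact minpoly.dvd _ _ (aeval_eq_zero_of_mul_charmatrix_eq_smul_one hQr)
  have ha : a ∈ J := by
    rw [hg]
    exact Ideal.mem_span_singleton.mpr (((mul_dvd_mul_iff_right hr0).mp hmr).trans (one_dvd a))
  exact ha

/-- The adjugate of `charmatrix A` is the left cofactor of `charmatrix A` in its minimal
polynomial, scaled by `charpoly A / minpoly F A`. -/
theorem adjugate_charmatrix_eq_smul {A : Matrix n n F}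
    {Q : Matrix n n F[X]} (h : Q * charmatrix A = minpoly F A • 1) :
    (charmatrix A).adjugate = (A.charpoly /ₘ minpoly F A) • Q := by
  have hm := minpoly.monic (Matrix.isIntegral (R := F) A)
  have hq : minpoly F A * (A.charpoly /ₘ minpoly F A) = A.charpoly := by
    have := modByMonic_add_div A.charpoly (minpoly F A)
    rwa [(modByMonic_eq_zero_iff_dvd hm).mpr (minpoly_dvd_charpoly A), zero_add] at this
  refine smul_right_injective _ hm.ne_zero ?_
  change minpoly F A • _ = minpoly F A • _
  have := congrArg (· * (charmatrix A).adjugate) h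
  simp only [mul_assoc, mul_adjugate, smul_mul_assoc, one_mul, mul_smul_comm, mul_one] at this
  rw [← this, ← mul_smul, hq, charpoly]

end Matrix

/-- For an invertible matrix `A` over a finite field of odd characteristic, the range of
the linear map `B ↦ tr(adj(charmatrix A) · map C B)` is exactly the set of multiples
`(charpoly A /ₘ minpoly F A) · a` with `deg a < deg (minpoly F A)`. -/
theorem stmt_6 {F : Type*} [Field F] [Fintype F] (p : ℕ) [Fact p.Prime] (hp : Odd p)
    [CharP F p] {n : ℕ} (A : Matrix (Fin n) (Fin n) F) (hA : IsUnit A.det) :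
    {f : F[X] | ∃ B : Matrix (Fin n) (Fin n) F,
        f = Matrix.trace ((charmatrix A).adjugate * B.map C)} =
      {f : F[X] | ∃ a : F[X], a.degree < (minpoly F A).degree ∧
        f = (A.charpoly /ₘ minpoly F A) * a} := by
  have hm := minpoly.monic (Matrix.isIntegral (R := F) A)
  obtain ⟨Q, hQ⟩ := exists_smul_one_eq_mul_charmatrix_add A (minpoly F A)
  rw [minpoly.aeval, Matrix.map_zero _ C_0, add_zero, eq_comm] at hQ
  have hdeg (B : Matrix (Fin n) (Fin n) F) :
      (trace (Q * B.map C)).degree < (minpoly F A).degree := by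
    have hbot : ⊥ < (minpoly F A).degree := bot_lt_iff_ne_bot.mpr (degree_ne_bot.mpr hm.ne_zero)
    simp only [trace, diag, Matrix.mul_apply, map_apply]
    refine (degree_sum_le _ _).trans_lt ((Finset.sup_lt_iff hbot).mpr fun i _ => ?_)
    refine (degree_sum_le _ _).trans_lt ((Finset.sup_lt_iff hbot).mpr fun j _ => ?_)
    refine lt_of_le_of_lt ?_ (degree_apply_lt_of_mul_charmatrix_eq_smul_one hm.ne_zero hQ i j)
    rw [degree_mul]
    exact (add_le_add le_rfl degree_C_le).trans_eq (add_zero _)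
  ext f
  simp only [Set.mem_ofPred_eq, adjugate_charmatrix_eq_smul hQ, smul_mul_assoc, trace_smul,
    smul_eq_mul]
  constructor
  · rintro ⟨B, rfl⟩
    exact ⟨_, hdeg B, rfl⟩
  · rintro ⟨a, ha, rfl⟩
    suffices ∃ B : Matrix (Fin n) (Fin n) F, a = trace (Q * B.map C) by
      obtain ⟨B, rfl⟩ := this
      exact ⟨B, rfl⟩
    rcases isEmpty_or_nonempty (Fin n) with hn | hn
    · rw [minpoly.subsingleton, degree_one, Nat.WithBot.lt_zero_iff, degree_eq_bot] at ha
      exact ⟨0, by simp [ha]⟩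
    · obtain ⟨M, rfl⟩ := exists_trace_mul_eq_of_mul_charmatrix_eq_minpoly hQ a
      obtain ⟨N, B, rfl⟩ := exists_eq_charmatrix_mul_add_map_C A M
      have hsplit : trace (Q * (charmatrix A * N + B.map C)) - trace (Q * B.map C) =
          minpoly F A * trace N := by
        rw [mul_add, ← mul_assoc, hQ, trace_add, smul_mul_assoc, one_mul, trace_smul, smul_eq_mul,
          add_sub_cancel_right]
      refine ⟨B, sub_eq_zero.mp (eq_zero_of_dvd_of_degree_lt ⟨_, hsplit⟩ ?_)⟩
      exact (degree_sub_le _ _).trans_lt (max_lt ha (hdeg B))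
end

section
/- Let F be a finite field of odd characteristic, A an invertible n×n matrix and B an invertible m×m matrix over F. For a square matrix M over F write L_M for the linear map sending a matrix Y of the same size to trace(adj(charmatrix M) · map C Y) ∈ F[X]. Then the range of L over the block-diagonal matrix A ⊕ B (fromBlocks A 0 0 B) on all (n+m)×(n+m) matrices equals { charpoly(B) · f + charpoly(A) · g : f ∈ range(L_A), g ∈ range(L_B) }. -/
open Polynomial Matrix

namespace Matrix

variable {R l k : Type*} [CommRing R] [Fintype l] [Fintype k]

theorem trace_fromBlocks (P : Matrix l l R) (Q : Matrix l k R) (S : Matrix k l R)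
    (T : Matrix k k R) : trace (fromBlocks P Q S T) = trace P + trace T := by
  simp [trace]

variable [DecidableEq l] [DecidableEq k]

theorem adjugate_eq_of_mul_eq_det_smul_one {M N : Matrix l l R} (hM : IsLeftRegular M.det)
    (h : M * N = M.det • (1 : Matrix l l R)) : M.adjugate = N := by
  have h' : M.det • N = M.det • M.adjugate := by
    calc M.det • N = M.adjugate * M * N := by rw [adjugate_mul, Matrix.smul_mul, Matrix.one_mul]
      _ = M.det • M.adjugate := by rw [Matrix.mul_assoc, h, Matrix.mul_smul, Matrix.mul_one]
  ext i j
  exact hM (congrFun (congrFun h' i) j).symm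

theorem adjugate_charmatrix_fromBlocks_zero (A : Matrix l l R) (B : Matrix k k R) :
    (charmatrix (fromBlocks A 0 0 B)).adjugate =
      fromBlocks (B.charpoly • (charmatrix A).adjugate) 0 0
        (A.charpoly • (charmatrix B).adjugate) := by
  apply adjugate_eq_of_mul_eq_det_smul_one
  · exact (charpoly_monic (fromBlocks A 0 0 B)).isRegular.left
  · rw [← charpoly, charpoly_fromBlocks_zero₁₂, charmatrix_fromBlocks]
    simp only [fromBlocks_multiply, Matrix.mul_smul, mul_adjugate, Matrix.map_zero, map_zero,
      neg_zero, Matrix.mul_zero, Matrix.zero_mul, add_zero, zero_add, smul_smul,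
      ← fromBlocks_one, fromBlocks_smul, smul_zero]
    rw [← charpoly, ← charpoly, mul_comm B.charpoly]

theorem trace_adjugate_charmatrix_fromBlocks_zero_mul (A : Matrix l l R) (B : Matrix k k R)
    (Y : Matrix (l ⊕ k) (l ⊕ k) R) :
    trace ((charmatrix (fromBlocks A 0 0 B)).adjugate * Y.map C) =
      B.charpoly * trace ((charmatrix A).adjugate * Y.toBlocks₁₁.map C) +
        A.charpoly * trace ((charmatrix B).adjugate * Y.toBlocks₂₂.map C) := by
  conv_lhs => rw [← fromBlocks_toBlocks Y]
  rw [adjugate_charmatrix_fromBlocks_zero, fromBlocks_map, fromBlocks_multiply, trace_fromBlocks]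
  simp only [Matrix.zero_mul, add_zero, zero_add, Matrix.smul_mul, trace_smul, smul_eq_mul]

end Matrix

/-- For invertible matrices `A`, `B` over a finite field of odd characteristic, the range
of the map `Y ↦ tr(adj(charmatrix (A ⊕ B)) · map C Y)` over all matrices `Y` of size
`(n+m)×(n+m)` equals `{charpoly B · f + charpoly A · g : f ∈ range L_A, g ∈ range L_B}`. -/
theorem stmt_7 {F : Type*} [Field F] [Fintype F] (p : ℕ) [Fact p.Prime] (hp : Odd p)
    [CharP F p] {n m : ℕ}
    (A : Matrix (Fin n) (Fin n) F) (B : Matrix (Fin m) (Fin m) F)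
    (hA : IsUnit A.det) (hB : IsUnit B.det) :
    {h : F[X] | ∃ Y : Matrix (Fin n ⊕ Fin m) (Fin n ⊕ Fin m) F,
        h = Matrix.trace ((charmatrix (Matrix.fromBlocks A 0 0 B)).adjugate * Y.map C)} =
      {h : F[X] | ∃ f g : F[X],
        (∃ Y : Matrix (Fin n) (Fin n) F,
          f = Matrix.trace ((charmatrix A).adjugate * Y.map C)) ∧
        (∃ Z : Matrix (Fin m) (Fin m) F,
          g = Matrix.trace ((charmatrix B).adjugate * Z.map C)) ∧
        h = B.charpoly * f + A.charpoly * g} := by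
  ext h
  constructor
  · rintro ⟨Y, rfl⟩
    exact ⟨_, _, ⟨Y.toBlocks₁₁, rfl⟩, ⟨Y.toBlocks₂₂, rfl⟩,
      trace_adjugate_charmatrix_fromBlocks_zero_mul A B Y⟩
  · rintro ⟨_, _, ⟨Y, rfl⟩, ⟨Z, rfl⟩, rfl⟩
    refine ⟨fromBlocks Y 0 0 Z, ?_⟩
    rw [trace_adjugate_charmatrix_fromBlocks_zero_mul, toBlocks_fromBlocks₁₁,
      toBlocks_fromBlocks₂₂]
end

section
/- Let F be a finite field of odd characteristic and B an n×n matrix over F with det B = 1. Then the range of the F-linear map sending an n×n matrix A₁ with trace(A₁) = 0 to trace(adj(charmatrix B) · map C (B·A₁)) ∈ F[X] is exactly the set { (charpoly B /ₘ minpoly F B) · b : b ∈ F[X], deg b < deg(minpoly F B), b(0) = 0 }. -/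
open Polynomial Matrix

namespace Polynomial

theorem coeff_divX_iterate {R : Type*} [Semiring R] (f : R[X]) (k i : ℕ) :
    (divX^[k] f).coeff i = f.coeff (i + k) := by
  induction k generalizing i with
  | zero => simp
  | succ k ih => rw [Function.iterate_succ_apply', coeff_divX, ih, add_assoc, add_comm 1 k]

theorem degree_divX_iterate {R : Type*} [Semiring R] {f : R[X]} (hf : f ≠ 0) {k : ℕ}
    (hk : k ≤ f.natDegree) : (divX^[k] f).degree = (f.natDegree - k : ℕ) := by
  refine degree_eq_of_le_of_coeff_ne_zero ?_ ?_
  · rw [degree_le_iff_coeff_zero]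
    intro j hj
    rw [coeff_divX_iterate]
    refine coeff_eq_zero_of_natDegree_lt ?_
    have := Nat.cast_lt.mp hj
    omega
  · rwa [coeff_divX_iterate, Nat.sub_add_cancel hk, coeff_natDegree, leadingCoeff_ne_zero]

/-- The Horner quotients of a nonzero polynomial are linearly independent. -/
theorem linearIndependent_divX_iterate {R : Type*} [Ring R] [IsDomain R] {f : R[X]} (hf : f ≠ 0) :
    LinearIndependent R fun i : Fin f.natDegree => divX^[(i : ℕ) + 1] f := by
  let S : Sequence R :=
    { elems' := fun k => if k < f.natDegree then divX^[f.natDegree - k] f else X ^ k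
      degree_eq' := by
        intro k
        split_ifs with hk
        · rw [degree_divX_iterate hf (Nat.sub_le _ _), Nat.sub_sub_self hk.le]
        · exact degree_X_pow k }
  have hS := S.linearIndependent.comp (fun i : Fin f.natDegree => f.natDegree - 1 - (i : ℕ))
    (fun i j hij => by
      ext
      have := i.2
      have := j.2
      simp only at hij
      omega)
  convert hS using 2 with i
  have hi := i.2
  have hlt : f.natDegree - 1 - (i : ℕ) < f.natDegree := by omega
  have heq : f.natDegree - (f.natDegree - 1 - (i : ℕ)) = i + 1 := by omega
  change _ = if _ then _ else _
  rw [if_pos hlt, heq]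

theorem degree_sum_C_mul_X_pow_lt {R : Type*} [Semiring R] (a : ℕ → R) (d : ℕ) :
    (∑ i ∈ Finset.range d, C (a i) * X ^ i).degree < (d : WithBot ℕ) := by
  rw [degree_lt_iff_coeff_zero]
  intro j hj
  simp [coeff_C_mul, coeff_X_pow, hj]

end Polynomial

namespace minpoly

theorem linearIndependent_aeval_divX_iterate {K A : Type*} [Field K] [Ring A] [Algebra K A]
    {x : A} (hx : IsIntegral K x) :
    LinearIndependent K
      fun i : Fin (minpoly K x).natDegree =>
        Polynomial.aeval x (divX^[(i : ℕ) + 1] (minpoly K x)) := by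
  have hm := minpoly.ne_zero hx
  rw [Fintype.linearIndependent_iff]
  intro g hg
  refine Fintype.linearIndependent_iff.mp (linearIndependent_divX_iterate hm) g ?_
  refine eq_zero_of_dvd_of_degree_lt (minpoly.dvd K x (by simpa using hg)) ?_
  rw [degree_eq_natDegree hm]
  refine (degree_sum_le _ _).trans_lt ((Finset.sup_lt_iff (WithBot.bot_lt_coe _)).mpr ?_)
  intro i _
  refine (degree_smul_le _ _).trans_lt ?_
  rw [degree_divX_iterate hm i.2]
  exact_mod_cast (by have := i.2; omega :
    (minpoly K x).natDegree - ((i : ℕ) + 1) < (minpoly K x).natDegree)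

end minpoly

namespace LinearIndependent

theorem exists_dual_apply_eq {K V ι : Type*} [Field K] [AddCommGroup V] [Module K V]
    {v : ι → V} (hv : LinearIndependent K v) (c : ι → K) :
    ∃ f : Module.Dual K V, ∀ i, f (v i) = c i := by
  obtain ⟨L, hL⟩ := LinearMap.exists_leftInverse_of_injective (Finsupp.linearCombination K v)
    (LinearMap.ker_eq_bot.mpr hv)
  refine ⟨Finsupp.linearCombination K c ∘ₗ L, fun i => ?_⟩
  have := LinearMap.congr_fun hL (Finsupp.single i 1)
  simp only [LinearMap.comp_apply, Finsupp.linearCombination_single, one_smul,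
    LinearMap.id_apply] at this
  simp [this]

end LinearIndependent

namespace Matrix

variable {ι : Type*} [Fintype ι] [DecidableEq ι]

/-- Every linear functional on square matrices is `M ↦ tr (M A)` for some `A`. -/
theorem exists_forall_dual_apply_eq_trace_mul {R : Type*} [CommSemiring R]
    (f : Module.Dual R (Matrix ι ι R)) : ∃ A : Matrix ι ι R, ∀ M, f M = trace (M * A) := by
  refine ⟨Matrix.of fun i j => f (single j i 1), fun M => ?_⟩
  conv_lhs => rw [matrix_eq_sum_single M]
  simp only [map_sum, trace, diag_apply, mul_apply, of_apply]
  refine Finset.sum_congr rfl fun i _ => Finset.sum_congr rfl fun j _ => ?_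
  rw [← mul_one (M i j), ← smul_eq_mul, ← smul_single, map_smul]
  simp

theorem mul_aeval_divX_iterate_succ {R : Type*} [CommRing R] (B : Matrix ι ι R) (f : R[X])
    (k : ℕ) : B * aeval B (divX^[k + 1] f) =
      aeval B (divX^[k] f) - algebraMap R _ (f.coeff k) := by
  have h := congrArg (aeval B) (X_mul_divX_add (divX^[k] f))
  rw [coeff_divX_iterate, zero_add, map_add, map_mul, aeval_X, aeval_C,
    ← Function.iterate_succ_apply' divX] at h
  exact eq_sub_of_add_eq h

/-- If `f` annihilates `B` then `X - B` divides `f` over the matrix polynomials, the coefficients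
of the quotient being the Horner quotients of `f` evaluated at `B`. -/
theorem charmatrix_mul_sum_aeval_divX {R : Type*} [CommRing R] {B : Matrix ι ι R} {f : R[X]}
    (hf : aeval B f = 0) :
    charmatrix B * ∑ i ∈ Finset.range f.natDegree,
      (X ^ i : R[X]) • (aeval B (divX^[i + 1] f)).map C = f • (1 : Matrix ι ι R[X]) := by
  set G : ℕ → Matrix ι ι R[X] := fun k => (aeval B (divX^[k] f)).map C with hG
  have hG0 : G 0 = 0 := by simp [hG, hf]
  have hGd : G f.natDegree = f.leadingCoeff • 1 := by
    have : divX^[f.natDegree] f = C f.leadingCoeff := by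
      ext j
      rw [coeff_divX_iterate, coeff_C]
      split_ifs with hj
      · simp [hj]
      · exact coeff_eq_zero_of_natDegree_lt (by omega)
    simp only [hG, this, aeval_C]
    ext i j
    simp [algebraMap_matrix_apply, one_apply, apply_ite, smul_eq_C_mul]
  have hstep (k : ℕ) : charmatrix B * ((X ^ k : R[X]) • G (k + 1)) =
      (X ^ (k + 1) : R[X]) • G (k + 1) - (X ^ k : R[X]) • G k +
        (C (f.coeff k) * X ^ k : R[X]) • (1 : Matrix ι ι R[X]) := by
    have h : B.map C * G (k + 1) = G k - (C (f.coeff k)) • (1 : Matrix ι ι R[X]) := by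
      rw [hG, ← Matrix.map_mul, mul_aeval_divX_iterate_succ, Matrix.map_sub _ (map_sub C)]
      congr 1
      ext i j
      simp [algebraMap_matrix_apply, one_apply, apply_ite]
    rw [charmatrix, RingHom.mapMatrix_apply, mul_smul_comm, sub_mul, h, scalar_apply,
      ← smul_one_eq_diagonal, smul_mul_assoc, one_mul, smul_sub, smul_sub, smul_smul, smul_smul,
      pow_succ, mul_comm (C _)]
    abel
  rw [Finset.mul_sum, Finset.sum_congr rfl fun k _ => hstep k, Finset.sum_add_distrib,
    Finset.sum_range_sub fun k => (X ^ k : R[X]) • G k, hG0, hGd, smul_zero, sub_zero,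
    ← Finset.sum_smul]
  conv_rhs => rw [f.as_sum_range_C_mul_X_pow, Finset.sum_range_succ, add_smul, add_comm]
  congr 1
  rw [coeff_natDegree, mul_comm, ← smul_smul]
  congr 1
  ext i j
  simp [smul_eq_C_mul]

theorem adjugate_charmatrix_eq_smul_sum {R : Type*} [CommRing R] {B : Matrix ι ι R} {f q : R[X]}
    (hf : aeval B f = 0) (hq : f * q = B.charpoly) :
    (charmatrix B).adjugate = q • ∑ i ∈ Finset.range f.natDegree,
      (X ^ i : R[X]) • (aeval B (divX^[i + 1] f)).map C := by
  set D := ∑ i ∈ Finset.range f.natDegree, (X ^ i : R[X]) • (aeval B (divX^[i + 1] f)).map C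
  have h : B.charpoly • (charmatrix B).adjugate = B.charpoly • (q • D) := by
    calc B.charpoly • (charmatrix B).adjugate
        = (charmatrix B).adjugate * (q • (charmatrix B * D)) := by
          rw [charmatrix_mul_sum_aeval_divX hf, smul_smul, mul_comm q, hq,
            mul_smul_comm, mul_one]
      _ = B.charpoly • (q • D) := by
          rw [mul_smul_comm, ← mul_assoc, adjugate_mul, smul_mul_assoc, one_mul, smul_comm]
          rfl
  ext1 i j
  exact B.charpoly_monic.isRegular.left (congrFun (congrFun h i) j)

theorem trace_adjugate_charmatrix_mul_map_C {R : Type*} [CommRing R] {B : Matrix ι ι R}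
    {f q : R[X]} (hf : aeval B f = 0) (hq : f * q = B.charpoly) (M : Matrix ι ι R) :
    trace ((charmatrix B).adjugate * M.map C) =
      q * ∑ i ∈ Finset.range f.natDegree,
        C (trace (aeval B (divX^[i + 1] f) * M)) * X ^ i := by
  rw [adjugate_charmatrix_eq_smul_sum hf hq, smul_mul_assoc, trace_smul, smul_eq_mul,
    Finset.sum_mul, trace_sum]
  congr 1
  refine Finset.sum_congr rfl fun i _ => ?_
  rw [smul_mul_assoc, trace_smul, smul_eq_mul, ← Matrix.map_mul, mul_comm]
  congr 1
  exact (AddMonoidHom.map_trace (C : R →+* R[X]) _).symm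

theorem trace_aeval_divX_mul_mul {R : Type*} [CommRing R] {B : Matrix ι ι R} {f : R[X]}
    (hf : aeval B f = 0) (A : Matrix ι ι R) :
    trace (aeval B (divX f) * (B * A)) = -(f.coeff 0 * trace A) := by
  have hcomm : aeval B (divX f) * B = B * aeval B (divX f) := by
    simpa using congrArg (aeval B) (mul_comm (divX f) X)
  have h := mul_aeval_divX_iterate_succ B f 0
  simp only [zero_add, Function.iterate_one, Function.iterate_zero, id_eq, hf, zero_sub] at h
  rw [← mul_assoc, hcomm, h, neg_mul, trace_neg, Algebra.algebraMap_eq_smul_one, smul_mul_assoc,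
    one_mul, trace_smul, smul_eq_mul]

end Matrix

/-- For a matrix `B` of determinant `1` over a finite field of odd characteristic, the
range of the map `A₁ ↦ tr(adj(charmatrix B) · map C (B·A₁))` over traceless matrices `A₁`
is `{(charpoly B /ₘ minpoly F B) · b : deg b < deg (minpoly F B), b(0) = 0}`. -/
theorem stmt_8 {F : Type*} [Field F] [Fintype F] (p : ℕ) [Fact p.Prime] (hp : Odd p)
    [CharP F p] {n : ℕ} (B : Matrix (Fin n) (Fin n) F) (hB : B.det = 1) :
    {f : F[X] | ∃ A₁ : Matrix (Fin n) (Fin n) F, Matrix.trace A₁ = 0 ∧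
        f = Matrix.trace ((charmatrix B).adjugate * (B * A₁).map C)} =
      {f : F[X] | ∃ b : F[X], b.degree < (minpoly F B).degree ∧ b.eval 0 = 0 ∧
        f = (B.charpoly /ₘ minpoly F B) * b} := by
  have hint : IsIntegral F B := B.isIntegral
  have hm := minpoly.ne_zero hint
  have hroot := minpoly.aeval F B
  have hq : minpoly F B * (B.charpoly /ₘ minpoly F B) = B.charpoly := by
    obtain ⟨q, hq⟩ := Matrix.minpoly_dvd_charpoly B
    rw [hq, mul_divByMonic_cancel_left q (minpoly.monic hint)]
  have htrace (A : Matrix (Fin n) (Fin n) F) := trace_adjugate_charmatrix_mul_map_C hroot hq (B * A)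
  have hdet : IsUnit B.det := by simp [hB]
  ext f
  constructor
  · rintro ⟨A, hA, rfl⟩
    refine ⟨_, ?_, ?_, htrace A⟩
    · rw [degree_eq_natDegree hm]
      exact degree_sum_C_mul_X_pow_lt _ _
    · rw [eval_finsetSum]
      refine Finset.sum_eq_zero fun i _ => ?_
      obtain rfl | hi := eq_or_ne i 0
      · simp [trace_aeval_divX_mul_mul hroot, hA]
      · simp [hi]
  · rintro ⟨b, hb, hb0, rfl⟩
    rw [degree_eq_natDegree hm] at hb
    obtain ⟨φ, hφ⟩ := (minpoly.linearIndependent_aeval_divX_iterate hint).exists_dual_apply_eq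
      fun i => b.coeff i
    obtain ⟨A, hA⟩ := exists_forall_dual_apply_eq_trace_mul φ
    have hBA : B * (B⁻¹ * A) = A := mul_nonsing_inv_cancel_left B A hdet
    have hcoeff (i : ℕ) (hi : i < (minpoly F B).natDegree) :
        trace (aeval B (divX^[i + 1] (minpoly F B)) * A) = b.coeff i := by
      rw [← hA, ← hφ ⟨i, hi⟩]
    refine ⟨B⁻¹ * A, ?_, ?_⟩
    · obtain hn | hn := isEmpty_or_nonempty (Fin n)
      · exact trace_eq_zero_of_isEmpty _
      have h := trace_aeval_divX_mul_mul hroot (B⁻¹ * A)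
      have h0 := hcoeff 0 (minpoly.natDegree_pos hint)
      rw [zero_add, Function.iterate_one, coeff_zero_eq_eval_zero, hb0] at h0
      rw [hBA, h0, eq_comm, neg_eq_zero, mul_eq_zero] at h
      refine h.resolve_left fun hc => ?_
      have hdivX := mul_aeval_divX_iterate_succ B (minpoly F B) 0
      rw [hc, map_zero, sub_zero, Function.iterate_zero_apply, hroot] at hdivX
      refine (minpoly.linearIndependent_aeval_divX_iterate hint).ne_zero
        ⟨0, minpoly.natDegree_pos hint⟩ ?_
      simpa [mul_assoc, nonsing_inv_mul_cancel_left _ _ hdet] using congrArg (B⁻¹ * ·) hdivX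
    · rw [htrace, hBA]
      congr 1
      rw [Finset.sum_congr rfl fun i hi => by rw [hcoeff i (Finset.mem_range.mp hi)]]
      ext j
      simp only [finsetSum_coeff, coeff_C_mul, coeff_X_pow, mul_ite, mul_one, mul_zero,
        Finset.sum_ite_eq, Finset.mem_range]
      split_ifs with hj
      · rfl
      · exact coeff_eq_zero_of_degree_lt (hb.trans_le (by exact_mod_cast not_lt.mp hj))
end

section
/- Let F be a finite field of odd characteristic, n ≥ 1, and let J be the standard symplectic 2n×2n matrix over F, given in block form by J = [[0, 1ₙ], [−1ₙ, 0]]. Let A₀ be a symplectic matrix (A₀ · J · A₀ᵀ = J) and A₁ a matrix in the symplectic Lie algebra (J·A₁ + A₁ᵀ·J = 0). Then the polynomial f := X · trace(adj(charmatrix A₀) · map C A₁) ∈ F[X] has degree < 2n and is 2n-palindromic, i.e. reflect (2n) f = f. -/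
open Polynomial Matrix

namespace Polynomial

variable {R ι : Type*} [CommRing R]

theorem natDegree_prod_le_card (s : Finset ι) (f : ι → R[X])
    (hf : ∀ i ∈ s, (f i).natDegree ≤ 1) : (∏ i ∈ s, f i).natDegree ≤ s.card :=
  (natDegree_prod_le s f).trans <| by simpa using Finset.sum_le_card_nsmul s _ 1 hf

theorem reflect_sum (N : ℕ) (s : Finset ι) (f : ι → R[X]) :
    reflect N (∑ i ∈ s, f i) = ∑ i ∈ s, reflect N (f i) := by
  ext; simp [coeff_reflect]

theorem reflect_card_prod (s : Finset ι) (f : ι → R[X])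
    (hf : ∀ i ∈ s, (f i).natDegree ≤ 1) :
    reflect s.card (∏ i ∈ s, f i) = ∏ i ∈ s, reflect 1 (f i) := by
  classical
  induction s using Finset.induction_on with
  | empty => simp
  | insert a s ha ih =>
    rw [Finset.forall_mem_insert] at hf
    rw [Finset.prod_insert ha, Finset.prod_insert ha, Finset.card_insert_of_notMem ha, add_comm,
      reflect_mul _ _ hf.1 (natDegree_prod_le_card s f hf.2), ih hf.2]

end Polynomial

namespace Matrix

section Reflect

variable {R n : Type*} [CommRing R] [Fintype n] [DecidableEq n]

theorem natDegree_det_le_card (M : Matrix n n R[X]) (hM : ∀ i j, (M i j).natDegree ≤ 1) :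
    M.det.natDegree ≤ Fintype.card n := by
  rw [det_apply]
  refine natDegree_sum_le_of_forall_le _ _ fun σ _ => (natDegree_smul_le _ _).trans ?_
  exact natDegree_prod_le_card _ _ fun i _ => hM _ _

theorem reflect_det (M : Matrix n n R[X]) (hM : ∀ i j, (M i j).natDegree ≤ 1) :
    reflect (Fintype.card n) M.det = (M.map (reflect 1)).det := by
  rw [det_apply', det_apply', reflect_sum]
  refine Finset.sum_congr rfl fun σ _ => ?_
  rw [← map_intCast (C : R →+* R[X]), reflect_C_mul, ← Finset.card_univ,
    reflect_card_prod _ _ fun i _ => hM _ _]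
  rfl

private theorem natDegree_updateRow_single_le {n : Type*} [DecidableEq n] (M : Matrix n n R[X])
    (hM : ∀ i j, (M i j).natDegree ≤ 1) (i j k l : n) :
    (M.updateRow j (Pi.single i 1) k l).natDegree ≤ 1 := by
  rw [updateRow_apply, Pi.single_apply]
  split_ifs <;> simp [hM]

theorem natDegree_adjugate_le_card (M : Matrix n n R[X]) (hM : ∀ i j, (M i j).natDegree ≤ 1)
    (i j : n) : (M.adjugate i j).natDegree ≤ Fintype.card n := by
  rw [adjugate_apply]
  exact natDegree_det_le_card _ (natDegree_updateRow_single_le M hM i j)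

theorem reflect_adjugate (M : Matrix n n R[X]) (hM : ∀ i j, (M i j).natDegree ≤ 1) (i j : n) :
    reflect (Fintype.card n) (M.adjugate i j) = X * (M.map (reflect 1)).adjugate i j := by
  rw [adjugate_apply, reflect_det _ (natDegree_updateRow_single_le M hM i j), adjugate_apply,
    ← det_updateRow_smul]
  congr 1
  ext1 k l
  by_cases hk : k = j <;> by_cases hl : l = i <;>
    simp [updateRow_apply, hk, hl]

theorem natDegree_trace_adjugate_charmatrix_mul_le (A B : Matrix n n R) :
    ((charmatrix A).adjugate * B.map C).trace.natDegree ≤ Fintype.card n := by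
  refine natDegree_sum_le_of_forall_le _ _ fun i _ => natDegree_sum_le_of_forall_le _ _ fun j _ => ?_
  refine (natDegree_mul_C_le _ _).trans (natDegree_adjugate_le_card _ (fun k l => ?_) i j)
  exact (charmatrix_apply_natDegree_le k l).trans (by split_ifs <;> simp)

theorem reflect_trace_adjugate_charmatrix_mul (A B : Matrix n n R) :
    reflect (Fintype.card n) ((charmatrix A).adjugate * B.map C).trace =
      X * ((1 - (X : R[X]) • A.map C).adjugate * B.map C).trace := by
  have hA : (charmatrix A).map (reflect 1) = 1 - (X : R[X]) • A.map C := by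
    ext1 i j
    by_cases h : i = j
    · subst h
      simp [reflect_sub, reflect_C, X_mul_C]
    · simp [h, reflect_neg, reflect_C, X_mul_C]
  simp only [trace, diag_apply, mul_apply, reflect_sum, Finset.mul_sum, map_apply]
  refine Finset.sum_congr rfl fun i _ => Finset.sum_congr rfl fun j _ => ?_
  rw [mul_comm, reflect_C_mul, reflect_adjugate, hA]
  · ring
  · exact fun k l => (charmatrix_apply_natDegree_le k l).trans (by split_ifs <;> simp)

theorem degree_X_mul_trace_adjugate_charmatrix_mul_lt [Nonempty n] {B : Matrix n n R}
    (A : Matrix n n R) (hB : B.trace = 0) :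
    (X * ((charmatrix A).adjugate * B.map C).trace).degree < (Fintype.card n : WithBot ℕ) := by
  have hcard : 1 ≤ Fintype.card n := Fintype.card_pos
  have hrefl := reflect_trace_adjugate_charmatrix_mul A B
  have htop : ((charmatrix A).adjugate * B.map C).trace.coeff (Fintype.card n) = 0 := by
    simpa [coeff_reflect, revAt_le] using congrArg (coeff · 0) hrefl
  have hnext : ((charmatrix A).adjugate * B.map C).trace.coeff (Fintype.card n - 1) = 0 := by
    have h0 : ((1 - (X : R[X]) • A.map C).adjugate * B.map C).trace.coeff 0 = B.trace := by
      have hA : (1 - (X : R[X]) • A.map C).map (evalRingHom 0) = 1 := by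
        ext i j
        simp [one_apply, apply_ite (eval (0 : R))]
      have hBC : (B.map C).map (evalRingHom 0) = B := by ext; simp
      rw [coeff_zero_eq_eval_zero, ← coe_evalRingHom, AddMonoidHom.map_trace, Matrix.map_mul,
        ← RingHom.mapMatrix_apply, RingHom.map_adjugate, RingHom.mapMatrix_apply, hA, hBC,
        adjugate_one, one_mul]
    have h1 := congrArg (coeff · 1) hrefl
    rwa [coeff_reflect, revAt_le hcard, coeff_X_mul, h0, hB] at h1
  rw [degree_lt_iff_coeff_zero]
  intro m hm
  obtain ⟨k, rfl⟩ : ∃ k, m = k + 1 := ⟨m - 1, by omega⟩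
  rw [coeff_X_mul]
  obtain h | h | h : k = Fintype.card n - 1 ∨ k = Fintype.card n ∨ Fintype.card n < k := by omega
  · rwa [h]
  · rwa [h]
  · exact coeff_eq_zero_of_natDegree_lt
      ((natDegree_trace_adjugate_charmatrix_mul_le A B).trans_lt h)

end Reflect

section Symplectic

variable {R l : Type*} [CommRing R] [Fintype l] [DecidableEq l]

theorem trace_eq_zero_of_J_mul_add_transpose_mul_J {B : Matrix (l ⊕ l) (l ⊕ l) R}
    (hB : J l R * B + Bᵀ * J l R = 0) : B.trace = 0 := by
  rw [← fromBlocks_toBlocks B] at hB ⊢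
  simp only [J, fromBlocks_transpose, fromBlocks_multiply, fromBlocks_add] at hB
  have h := congrArg (fun M => trace M.toBlocks₁₂) hB
  have h0 : (toBlocks₁₂ (0 : Matrix (l ⊕ l) (l ⊕ l) R)).trace = 0 := by simp [trace, toBlocks₁₂]
  simp [h0] at h
  simp only [trace, diag_apply, Fintype.sum_sum_type, fromBlocks_apply₁₁, fromBlocks_apply₂₂] at h ⊢
  linear_combination -h

theorem trace_adjugate_one_sub_smul_mul {A B : Matrix (l ⊕ l) (l ⊕ l) R}
    (hA : A ∈ symplecticGroup l R) (hB : J l R * B + Bᵀ * J l R = 0) (x : R) :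
    ((1 - x • A).adjugate * B).trace = x * ((x • 1 - A).adjugate * B).trace := by
  have hdetJ : (J l R).det = 1 :=
    SymplecticGroup.det_eq_one (SymplecticGroup.J_mem (l := l) (R := R))
  have adj_J : (J l R).adjugate = -J l R := by
    rw [← J_inv, inv_def, hdetJ]; simp
  have adj_neg_J : (-J l R).adjugate = J l R := by
    have h := inv_def (-J l R)
    have : (-J l R)⁻¹ = J l R := inv_eq_right_inv (by simp [J_squared])
    rw [this, det_neg, hdetJ] at h
    simpa using h.symm
  set M := x • 1 - A with hM
  have hJA : J l R * A.adjugate = Aᵀ * J l R := by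
    have h := congrArg (· * A.adjugate) (SymplecticGroup.mem_iff'.mp hA)
    simpa [mul_assoc, mul_adjugate, SymplecticGroup.det_eq_one hA] using h.symm
  have hfactor : (1 - x • A) * J l R = A * -J l R * Mᵀ := by
    have h := SymplecticGroup.mem_iff.mp hA
    simp [hM, sub_mul, mul_sub, h]
    abel
  have hadj : J l R * (1 - x • A).adjugate = -((A * M.adjugate)ᵀ * J l R) := by
    have h := congrArg adjugate hfactor
    simp only [adjugate_mul_distrib, adj_J, adj_neg_J, hJA, ← adjugate_transpose] at h
    rw [transpose_mul, mul_assoc, ← h, neg_mul, neg_neg]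
  have hN : (1 - x • A).adjugate = J l R * (A * M.adjugate)ᵀ * J l R := by
    rw [mul_assoc, ← neg_eq_iff_eq_neg.mpr hadj, mul_neg, ← mul_assoc, J_squared]
    simp
  have hJBJ : J l R * B * J l R = Bᵀ := by
    rw [eq_neg_of_add_eq_zero_left hB, neg_mul, mul_assoc, J_squared]
    simp
  have hAM : A * M.adjugate = x • M.adjugate - M.det • 1 := by
    rw [← mul_adjugate, hM, sub_mul]
    simp
  calc ((1 - x • A).adjugate * B).trace
      = ((A * M.adjugate)ᵀ * (J l R * B * J l R)).trace := by
        rw [hN, mul_assoc, mul_assoc, trace_mul_comm, mul_assoc]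
    _ = (A * M.adjugate * B).trace := by
        rw [hJBJ, ← transpose_mul, trace_transpose, trace_mul_comm]
    _ = x * (M.adjugate * B).trace := by
        simp [hAM, sub_mul, trace_eq_zero_of_J_mul_add_transpose_mul_J hB]

theorem trace_adjugate_charmatrix_mul_reciprocal {A B : Matrix (l ⊕ l) (l ⊕ l) R}
    (hA : A ∈ symplecticGroup l R) (hB : J l R * B + Bᵀ * J l R = 0) :
    ((1 - (X : R[X]) • A.map C).adjugate * B.map C).trace =
      X * ((charmatrix A).adjugate * B.map C).trace := by
  have hBC : J l R[X] * B.map C + (B.map C)ᵀ * J l R[X] = 0 := by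
    have h := congrArg (fun N : Matrix _ _ R => N.map (C : R →+* R[X])) hB
    simpa [Matrix.map_add, Matrix.map_mul, transpose_map] using h
  have h := trace_adjugate_one_sub_smul_mul
    (SymplecticGroup.map_mem hA (C : R →+* R[X])) hBC X
  rwa [smul_one_eq_diagonal] at h

theorem reflect_X_mul_trace_adjugate_charmatrix_mul [Nonempty l]
    {A B : Matrix (l ⊕ l) (l ⊕ l) R}
    (hA : A ∈ symplecticGroup l R) (hB : J l R * B + Bᵀ * J l R = 0) :
    reflect (Fintype.card (l ⊕ l)) (X * ((charmatrix A).adjugate * B.map C).trace) =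
      X * ((charmatrix A).adjugate * B.map C).trace := by
  have hrefl := reflect_trace_adjugate_charmatrix_mul A B
  rw [trace_adjugate_charmatrix_mul_reciprocal hA hB] at hrefl
  have hdeg := natDegree_le_of_degree_le
    (degree_X_mul_trace_adjugate_charmatrix_mul_lt A
      (trace_eq_zero_of_J_mul_add_transpose_mul_J hB)).le
  have h1 := reflect_mul (X : R[X]) _ natDegree_X_le
    (natDegree_trace_adjugate_charmatrix_mul_le A B)
  have h2 := reflect_mul (1 : R[X]) _ (natDegree_one.trans_le zero_le_one) hdeg
  rw [reflect_one_X, one_mul, hrefl] at h1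
  rw [one_mul, reflect_one, pow_one, h1] at h2
  exact (isRegular_X.left h2).symm

end Symplectic

end Matrix

/-- For a symplectic matrix `A₀` and an element `A₁` of the symplectic Lie algebra over a
finite field of odd characteristic, the polynomial
`X · tr(adj(charmatrix A₀) · map C A₁)` has degree `< 2n` and is `2n`-palindromic. -/
theorem stmt_9 {F : Type*} [Field F] [Fintype F] (p : ℕ) [Fact p.Prime] (hp : Odd p)
    [CharP F p] {n : ℕ} (hn : 1 ≤ n)
    (J A₀ A₁ : Matrix (Fin n ⊕ Fin n) (Fin n ⊕ Fin n) F)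
    (hJ : J = Matrix.fromBlocks 0 1 (-1) 0)
    (hA₀ : A₀ * J * A₀ᵀ = J)
    (hA₁ : J * A₁ + A₁ᵀ * J = 0) :
    (X * Matrix.trace ((charmatrix A₀).adjugate * A₁.map C)).degree <
        ((2 * n : ℕ) : WithBot ℕ) ∧
      (X * Matrix.trace ((charmatrix A₀).adjugate * A₁.map C)).reflect (2 * n) =
        X * Matrix.trace ((charmatrix A₀).adjugate * A₁.map C) := by
  have hJ' : J = -Matrix.J (Fin n) F := by simp [hJ, Matrix.J, fromBlocks_neg]
  subst hJ'
  have hA : A₀ ∈ symplecticGroup (Fin n) F := by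
    rw [SymplecticGroup.mem_iff]
    simpa using hA₀
  have hB : Matrix.J (Fin n) F * A₁ + A₁ᵀ * Matrix.J (Fin n) F = 0 := by
    rw [← neg_eq_zero, ← hA₁]
    simp [neg_add_rev, add_comm]
  have : Nonempty (Fin n) := ⟨⟨0, hn⟩⟩
  have hcard : Fintype.card (Fin n ⊕ Fin n) = 2 * n := by simp [two_mul]
  rw [← hcard]
  exact ⟨degree_X_mul_trace_adjugate_charmatrix_mul_lt A₀
    (trace_eq_zero_of_J_mul_add_transpose_mul_J hB),
    reflect_X_mul_trace_adjugate_charmatrix_mul hA hB⟩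
end

section
/- Let F be a finite field of odd characteristic, J_A an n×n matrix over F, P an invertible n×n matrix, and set J_B := Pᵀ·J_A·P. Let A be a matrix with Aᵀ·J_A·A = J_A and set B := P⁻¹·A·P. Then the range of the map sending Y with J_A·Y = −Yᵀ·J_A to X · trace(adj(charmatrix A) · map C Y) equals the range of the map sending Y with J_B·Y = −Yᵀ·J_B to X · trace(adj(charmatrix B) · map C Y). -/
open Polynomial Matrix

namespace Matrix

variable {R ι : Type*} [CommRing R] [Fintype ι] [DecidableEq ι]

theorem adjugate_eq_det_smul_of_mul_eq_one {P Q : Matrix ι ι R} (h : P * Q = 1) :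
    P.adjugate = P.det • Q := by
  calc P.adjugate = P.adjugate * (P * Q) := by rw [h, mul_one]
    _ = P.det • Q := by rw [← mul_assoc, adjugate_mul, smul_mul_assoc, one_mul]

theorem adjugate_conj {P Q : Matrix ι ι R} (h : P * Q = 1) (M : Matrix ι ι R) :
    (Q * M * P).adjugate = Q * M.adjugate * P := by
  have hdet : P.det * Q.det = 1 := by rw [← det_mul, h, det_one]
  rw [adjugate_mul_distrib, adjugate_mul_distrib, adjugate_eq_det_smul_of_mul_eq_one h,
    adjugate_eq_det_smul_of_mul_eq_one (mul_eq_one_comm.mp h), mul_smul_comm, smul_mul_assoc,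
    mul_smul_comm, smul_smul, hdet, one_smul, mul_assoc]

theorem charmatrix_conj {P Q : Matrix ι ι R} (h : P * Q = 1) (A : Matrix ι ι R) :
    charmatrix (Q * A * P) = Q.map C * charmatrix A * P.map C := by
  have hmap : Q.map C * P.map C = (1 : Matrix ι ι R[X]) := by
    rw [← Matrix.map_mul, mul_eq_one_comm.mp h, Matrix.map_one _ C_0 C_1]
  have hX : Q.map C * scalar ι (X : R[X]) * P.map C = scalar ι X := by
    rw [← (scalar_commute X (fun r => Commute.all _ r) (Q.map C)).eq, mul_assoc, hmap, mul_one]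
  simp only [charmatrix, RingHom.mapMatrix_apply, mul_sub, sub_mul, hX, Matrix.map_mul]

/-- The derivative of the characteristic polynomial is invariant under simultaneous
conjugation. -/
theorem trace_adjugate_charmatrix_conj {P Q : Matrix ι ι R} (h : P * Q = 1)
    (A Y : Matrix ι ι R) :
    trace ((charmatrix (Q * A * P)).adjugate * (Q * Y * P).map C) =
      trace ((charmatrix A).adjugate * Y.map C) := by
  have hmap : P.map C * Q.map C = (1 : Matrix ι ι R[X]) := by
    rw [← Matrix.map_mul, h, Matrix.map_one _ C_0 C_1]
  rw [charmatrix_conj h, adjugate_conj hmap, Matrix.map_mul, Matrix.map_mul]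
  calc trace (Q.map C * (charmatrix A).adjugate * P.map C * (Q.map C * Y.map C * P.map C))
      = trace (Q.map C * ((charmatrix A).adjugate * (P.map C * Q.map C) * Y.map C * P.map C)) := by
        simp only [mul_assoc]
    _ = trace ((charmatrix A).adjugate * Y.map C) := by
        rw [trace_mul_comm, hmap, mul_one, mul_assoc, hmap, mul_one]

/-- Conjugation carries matrices skew-adjoint for `J` to matrices skew-adjoint for the congruent
form `Pᵀ * J * P`. -/
theorem skewAdjoint_conj_of_congr {P Q J Y : Matrix ι ι R} (h : P * Q = 1)
    (hY : J * Y = -(Yᵀ * J)) :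
    Pᵀ * J * P * (Q * Y * P) = -((Q * Y * P)ᵀ * (Pᵀ * J * P)) := by
  have ht : Qᵀ * Pᵀ = 1 := by rw [← transpose_mul, h, transpose_one]
  calc Pᵀ * J * P * (Q * Y * P) = Pᵀ * J * (P * Q) * Y * P := by simp only [mul_assoc]
    _ = Pᵀ * (J * Y) * P := by rw [h, mul_one, mul_assoc Pᵀ]
    _ = -(Pᵀ * Yᵀ * (Qᵀ * Pᵀ) * J * P) := by
        rw [hY, ht, mul_one, mul_neg, neg_mul, ← mul_assoc]
    _ = -((Q * Y * P)ᵀ * (Pᵀ * J * P)) := by simp only [transpose_mul, mul_assoc]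

end Matrix

/-- Congruent bilinear forms give the same image of the characteristic-polynomial
derivative map: if `J_B = Pᵀ·J_A·P` with `P` invertible, `A` preserves `J_A` and
`B = P⁻¹·A·P`, then the ranges of `Y ↦ X · tr(adj(charmatrix A) · map C Y)` over
`𝔬(F, J_A)` and of the corresponding map for `B` over `𝔬(F, J_B)` coincide. -/
theorem stmt_12 {F : Type*} [Field F] [Fintype F] (p : ℕ) [Fact p.Prime] (hp : Odd p)
    [CharP F p] {n : ℕ} (JA P : Matrix (Fin n) (Fin n) F) (hP : IsUnit P.det)
    (JB : Matrix (Fin n) (Fin n) F) (hJB : JB = Pᵀ * JA * P)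
    (A : Matrix (Fin n) (Fin n) F) (hA : Aᵀ * JA * A = JA)
    (B : Matrix (Fin n) (Fin n) F) (hB : B = P⁻¹ * A * P) :
    {f : F[X] | ∃ Y : Matrix (Fin n) (Fin n) F, JA * Y = -(Yᵀ * JA) ∧
        f = X * Matrix.trace ((charmatrix A).adjugate * Y.map C)} =
      {f : F[X] | ∃ Y : Matrix (Fin n) (Fin n) F, JB * Y = -(Yᵀ * JB) ∧
        f = X * Matrix.trace ((charmatrix B).adjugate * Y.map C)} := by
  have hPQ : P * P⁻¹ = 1 := mul_nonsing_inv P hP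
  have hQP : P⁻¹ * P = 1 := nonsing_inv_mul P hP
  have cancel (M : Matrix (Fin n) (Fin n) F) : P * (P⁻¹ * M * P) * P⁻¹ = M := by
    rw [mul_assoc, mul_assoc, hPQ, mul_one, ← mul_assoc, hPQ, one_mul]
  have cancelJ : (P⁻¹)ᵀ * (Pᵀ * JA * P) * P⁻¹ = JA := by
    have ht : (P⁻¹)ᵀ * Pᵀ = 1 := by rw [← transpose_mul, hPQ, transpose_one]
    rw [mul_assoc, mul_assoc, hPQ, mul_one, ← mul_assoc, ht, one_mul]
  subst hJB hB
  ext f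
  constructor
  · rintro ⟨Y, hY, rfl⟩
    exact ⟨P⁻¹ * Y * P, skewAdjoint_conj_of_congr hPQ hY,
      by rw [trace_adjugate_charmatrix_conj hPQ]⟩
  · rintro ⟨Y, hY, rfl⟩
    refine ⟨P * Y * P⁻¹, ?_, ?_⟩
    · simpa only [cancelJ] using skewAdjoint_conj_of_congr hQP hY
    · rw [← trace_adjugate_charmatrix_conj hQP (P⁻¹ * A * P) Y, cancel]
end

section
/- Let F be a field and n ≥ 0. Define Ψ : F[X] → F[X] by Ψ(g) = Σ_{i=0}^{n} C(g.coeff i) · (X² + 1)^i · X^{n−i} (so that Ψ(g) = X^n · g(X + 1/X) for g of degree ≤ n). Then: (i) Ψ is injective on the set of monic polynomials of degree n; (ii) the image of the set of monic polynomials of degree n under Ψ is exactly the set of monic polynomials f of degree 2n with reflect (2n) f = f, i.e. the monic 2n-palindromic polynomials of degree 2n. -/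
open Polynomial

section HomogenizedAddInv

variable {R : Type*} [CommRing R]

/-- The polynomial `X ^ n * g (X + 1 / X)`, where only the coefficients of `g` up to degree `n`
are taken into account. -/
noncomputable def homogenizedAddInv (n : ℕ) (g : R[X]) : R[X] :=
  ∑ i ∈ Finset.range (n + 1), C (g.coeff i) * (X ^ 2 + 1) ^ i * X ^ (n - i)

theorem homogenizedAddInv_zero (g : R[X]) : homogenizedAddInv 0 g = C (g.coeff 0) := by
  simp [homogenizedAddInv]

theorem homogenizedAddInv_succ (n : ℕ) (g : R[X]) :
    homogenizedAddInv (n + 1) g =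
      C (g.coeff (n + 1)) * (X ^ 2 + 1) ^ (n + 1) + X * homogenizedAddInv n g := by
  rw [homogenizedAddInv, Finset.sum_range_succ, homogenizedAddInv, Finset.mul_sum, add_comm]
  congr 1
  · simp
  · refine Finset.sum_congr rfl fun i hi => ?_
    rw [Nat.sub_add_comm (Finset.mem_range_succ_iff.mp hi)]
    ring

theorem homogenizedAddInv_congr {n : ℕ} {g h : R[X]} (H : ∀ i ≤ n, g.coeff i = h.coeff i) :
    homogenizedAddInv n g = homogenizedAddInv n h :=
  Finset.sum_congr rfl fun i hi => by rw [H i (Finset.mem_range_succ_iff.mp hi)]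

theorem natDegree_X_sq_add_one_pow_le (n : ℕ) :
    ((X ^ 2 + 1 : R[X]) ^ n).natDegree ≤ 2 * n := by
  rw [mul_comm]
  exact natDegree_pow_le_of_le n (by compute_degree)

theorem coeff_X_sq_add_one_pow (n : ℕ) : ((X ^ 2 + 1 : R[X]) ^ n).coeff (2 * n) = 1 := by
  have h2 : (X ^ 2 + 1 : R[X]).natDegree ≤ 2 := by compute_degree
  rw [mul_comm, coeff_pow_of_natDegree_le h2]
  simp [coeff_one]

theorem reflect_X_sq_add_one_pow (n : ℕ) :
    ((X ^ 2 + 1 : R[X]) ^ n).reflect (2 * n) = (X ^ 2 + 1) ^ n := by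
  induction n with
  | zero => simp
  | succ n ih =>
    rw [pow_succ, mul_add_one,
      reflect_mul _ _ (natDegree_X_sq_add_one_pow_le n) (by compute_degree), ih, reflect_add,
      reflect_monomial, reflect_one, revAt_le le_rfl]
    simp [add_comm]

theorem reflect_X_mul {f : R[X]} {n : ℕ} (hf : f.natDegree ≤ n) :
    (X * f).reflect (n + 2) = X * f.reflect n := by
  have hX : (X : R[X]).reflect 2 = X := by
    simpa [revAt_le] using reflect_monomial (R := R) 2 1
  rw [add_comm, reflect_mul _ _ (natDegree_X_le.trans one_le_two) hf, hX]

theorem natDegree_homogenizedAddInv_le (n : ℕ) (g : R[X]) :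
    (homogenizedAddInv n g).natDegree ≤ 2 * n := by
  induction n with
  | zero => simp [homogenizedAddInv_zero]
  | succ n ih =>
    rw [homogenizedAddInv_succ]
    refine natDegree_add_le_of_degree_le
      ((natDegree_C_mul_le _ _).trans (natDegree_X_sq_add_one_pow_le _)) ?_
    have := natDegree_mul_le_of_le (natDegree_X_le (R := R)) ih
    omega

theorem coeff_homogenizedAddInv (n : ℕ) (g : R[X]) :
    (homogenizedAddInv n g).coeff (2 * n) = g.coeff n := by
  cases n with
  | zero => simp [homogenizedAddInv_zero]
  | succ n =>
    have h := coeff_eq_zero_of_natDegree_lt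
      ((natDegree_homogenizedAddInv_le n g).trans_lt (Nat.lt_succ_self _))
    rw [homogenizedAddInv_succ, coeff_add, coeff_C_mul, coeff_X_sq_add_one_pow, mul_add_one,
      coeff_X_mul, h]
    simp

theorem reflect_homogenizedAddInv (n : ℕ) (g : R[X]) :
    (homogenizedAddInv n g).reflect (2 * n) = homogenizedAddInv n g := by
  induction n with
  | zero => simp [homogenizedAddInv_zero]
  | succ n ih =>
    rw [homogenizedAddInv_succ, reflect_add, reflect_C_mul, reflect_X_sq_add_one_pow, mul_add_one,
      reflect_X_mul (natDegree_homogenizedAddInv_le n g), ih]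

theorem coeff_eq_of_homogenizedAddInv_eq {n : ℕ} {g h : R[X]}
    (H : homogenizedAddInv n g = homogenizedAddInv n h) : ∀ i ≤ n, g.coeff i = h.coeff i := by
  induction n with
  | zero =>
    intro i hi
    obtain rfl := Nat.le_zero.mp hi
    simpa [homogenizedAddInv_zero] using H
  | succ n ih =>
    have top : g.coeff (n + 1) = h.coeff (n + 1) := by
      rw [← coeff_homogenizedAddInv, H, coeff_homogenizedAddInv]
    rw [homogenizedAddInv_succ, homogenizedAddInv_succ, top] at H
    intro i hi
    rcases hi.eq_or_lt with rfl | hi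
    · exact top
    · exact ih (isRegular_X.left (add_left_cancel H)) i (Nat.lt_succ_iff.mp hi)

theorem exists_homogenizedAddInv_eq {n : ℕ} {f : R[X]} (hf : f.natDegree ≤ 2 * n)
    (hr : f.reflect (2 * n) = f) : ∃ g : R[X], g.natDegree ≤ n ∧ homogenizedAddInv n g = f := by
  induction n generalizing f with
  | zero =>
    refine ⟨f, hf, ?_⟩
    rw [homogenizedAddInv_zero]
    exact (eq_C_of_natDegree_le_zero hf).symm
  | succ n ih =>
    set a := f.coeff (2 * (n + 1)) with ha
    set r := f - C a * (X ^ 2 + 1) ^ (n + 1) with hr_def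
    have r_reflect : r.reflect (2 * (n + 1)) = r := by
      rw [hr_def, reflect_sub, hr, reflect_C_mul, reflect_X_sq_add_one_pow]
    have r_natDegree : r.natDegree ≤ 2 * (n + 1) :=
      natDegree_sub_le_of_le hf
        ((natDegree_C_mul_le _ _).trans (natDegree_X_sq_add_one_pow_le _)) |>.trans (by simp)
    have r_top : r.coeff (2 * (n + 1)) = 0 := by
      rw [hr_def, coeff_sub, coeff_C_mul, coeff_X_sq_add_one_pow, mul_one, ← ha, sub_self]
    have r_zero : r.coeff 0 = 0 := by
      rw [← r_reflect, coeff_reflect, revAt_zero, r_top]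
    obtain ⟨s, hs⟩ := X_dvd_iff.mpr r_zero
    have s_natDegree : s.natDegree ≤ 2 * n := by
      refine natDegree_le_iff_coeff_eq_zero.mpr fun k hk => ?_
      rw [← coeff_X_mul, ← hs]
      rcases (show 2 * (n + 1) ≤ k + 1 by omega).eq_or_lt with h | h
      · rw [← h, r_top]
      · exact coeff_eq_zero_of_natDegree_lt (r_natDegree.trans_lt h)
    have s_reflect : s.reflect (2 * n) = s := by
      rw [hs, mul_add_one, reflect_X_mul s_natDegree] at r_reflect
      exact isRegular_X.left r_reflect
    obtain ⟨g, g_natDegree, hg⟩ := ih s_natDegree s_reflect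
    refine ⟨C a * X ^ (n + 1) + g, ?_, ?_⟩
    · exact natDegree_add_le_of_degree_le (natDegree_C_mul_X_pow_le _ _)
        (g_natDegree.trans n.le_succ)
    · have low : homogenizedAddInv n (C a * X ^ (n + 1) + g) = homogenizedAddInv n g :=
        homogenizedAddInv_congr fun i hi => by
          simp [coeff_X_pow, (Nat.lt_succ_of_le hi).ne]
      rw [homogenizedAddInv_succ, low, hg, ← hs, hr_def, coeff_add, coeff_C_mul, coeff_X_pow_self,
        coeff_eq_zero_of_natDegree_lt (Nat.lt_succ_of_le g_natDegree)]
      simp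

end HomogenizedAddInv

/-- The map `Ψ(g) = Σ_{i=0}^{n} C (g.coeff i) · (X² + 1)^i · X^(n−i)` (i.e.
`Ψ(g) = X^n · g(X + 1/X)` for `deg g ≤ n`) is injective on monic polynomials of degree
`n`, and its image on them is exactly the set of monic `2n`-palindromic polynomials of
degree `2n`. -/
theorem stmt_13 {F : Type*} [Field F] (n : ℕ) :
    Set.InjOn (fun g : F[X] => ∑ i ∈ Finset.range (n + 1),
        C (g.coeff i) * (X ^ 2 + 1) ^ i * X ^ (n - i))
      {g : F[X] | g.Monic ∧ g.natDegree = n} ∧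
    (fun g : F[X] => ∑ i ∈ Finset.range (n + 1),
        C (g.coeff i) * (X ^ 2 + 1) ^ i * X ^ (n - i)) ''
        {g : F[X] | g.Monic ∧ g.natDegree = n} =
      {f : F[X] | f.Monic ∧ f.natDegree = 2 * n ∧ f.reflect (2 * n) = f} := by
  change Set.InjOn (homogenizedAddInv n) _ ∧ homogenizedAddInv n '' _ = _
  refine ⟨?_, Set.Subset.antisymm ?_ ?_⟩
  · rintro g ⟨-, hg⟩ h ⟨-, hh⟩ H
    exact (ext_iff_natDegree_le hg.le hh.le).mpr (coeff_eq_of_homogenizedAddInv_eq H)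
  · rintro _ ⟨g, ⟨g_monic, rfl⟩, rfl⟩
    have top : (homogenizedAddInv g.natDegree g).coeff (2 * g.natDegree) = 1 := by
      rw [coeff_homogenizedAddInv, g_monic.coeff_natDegree]
    have hle := natDegree_homogenizedAddInv_le g.natDegree g
    exact ⟨monic_of_natDegree_le_of_coeff_eq_one _ hle top,
      natDegree_eq_of_le_of_coeff_ne_zero hle (top ▸ one_ne_zero),
      reflect_homogenizedAddInv _ _⟩
  · rintro f ⟨f_monic, f_natDegree, f_reflect⟩
    obtain ⟨g, g_natDegree, rfl⟩ := exists_homogenizedAddInv_eq f_natDegree.le f_reflect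
    have top : g.coeff n = 1 := by
      rw [← coeff_homogenizedAddInv, ← f_monic.coeff_natDegree, f_natDegree]
    exact ⟨g, ⟨monic_of_natDegree_le_of_coeff_eq_one _ g_natDegree top,
      natDegree_eq_of_le_of_coeff_ne_zero g_natDegree (top ▸ one_ne_zero)⟩, rfl⟩
end

section
/- Let F be a finite field with q elements and odd characteristic. For every ε > 0 there exists N such that for all n ≥ N, all integers δ with 0 ≤ δ < n, and all monic polynomials h ∈ F[X] of degree n: the number of invertible n×n matrices M over F with deg(minpoly F M) = n − δ and charpoly(M) = h is at most |GL_n(F)| · q^{ε·n − n²/(n−δ)}, where |GL_n(F)| is the number of invertible n×n matrices over F. Equivalently, for M chosen uniformly from GL_n(F), Pr[deg min(M) = n − δ and char(M) = h] < q^{−n²/(n−δ) + o(n)}, with the rate of decay uniform in δ and h. -/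
/-- The proportion of units in a finite monoid. -/
noncomputable def unitDensity (E : Type*) [Monoid E] : ℝ :=
  (Nat.card Eˣ : ℝ) / Nat.card E

theorem unitDensity_nonneg (E : Type*) [Monoid E] : 0 ≤ unitDensity E := by
  unfold unitDensity; positivity

theorem unitDensity_congr {E E' : Type*} [Monoid E] [Monoid E'] (e : E ≃* E') :
    unitDensity E = unitDensity E' := by
  rw [unitDensity, unitDensity, Nat.card_congr e.toEquiv,
    Nat.card_congr (Units.mapEquiv e).toEquiv]

theorem unitDensity_of_subsingleton (E : Type*) [Monoid E] [Subsingleton E] :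
    unitDensity E = 1 := by
  simp [unitDensity]

theorem unitDensity_le_of_surjective {A B : Type*} [Ring A] [Ring B] [Finite A]
    (f : A →+* B) (hf : Function.Surjective f) [IsLocalHom f] :
    unitDensity B ≤ unitDensity A := by
  have : Finite B := Finite.of_surjective f hf
  let K := f.toAddMonoidHom.ker
  have hcard : Nat.card A = Nat.card B * Nat.card K := by
    rw [AddSubgroup.card_eq_card_quotient_mul_card_addSubgroup K,
      Nat.card_congr (QuotientAddGroup.quotientKerEquivOfSurjective f.toAddMonoidHom hf).toEquiv]
  let s := Function.surjInv hf
  have hs : ∀ b, f (s b) = b := Function.surjInv_eq hf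
  have hk : ∀ x : K, f (x : A) = 0 := fun x => x.2
  have hu : ∀ (b : Bˣ) (x : K), IsUnit (s b + x) := fun b x =>
    isUnit_of_map_unit f _ (by simp [hs, hk])
  have hle : Nat.card (Bˣ × K) ≤ Nat.card Aˣ := by
    refine Nat.card_le_card_of_injective (fun y => (hu y.1 y.2).unit) ?_
    rintro ⟨b, x⟩ ⟨b', x'⟩ h
    have h1 : s b + (x : A) = s b' + x' := congrArg Units.val h
    have h2 : b = b' := by
      have := congrArg f h1
      simp only [map_add, hs, hk, add_zero] at this
      exact Units.ext this
    subst h2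
    simpa using h1
  rw [Nat.card_prod] at hle
  have hB : 0 < (Nat.card B : ℝ) := by exact_mod_cast Nat.card_pos
  have hK : 0 < (Nat.card K : ℝ) := by exact_mod_cast Nat.card_pos
  rw [unitDensity, unitDensity, hcard, Nat.cast_mul, ← mul_div_mul_right _ _ hK.ne']
  gcongr
  exact_mod_cast hle

section EndDensity

variable {R : Type*} [CommRing R]

theorem natCard_units_end (A : Type*) [AddCommGroup A] [Module R A] :
    Nat.card (Module.End R A)ˣ = Nat.card (A ≃ₗ[R] A) :=
  Nat.card_congr (LinearMap.GeneralLinearGroup.generalLinearEquiv R A).toEquiv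

instance finite_linearMap (A B : Type*) [AddCommGroup A] [Module R A] [AddCommGroup B]
    [Module R B] [Finite A] [Finite B] : Finite (A →ₗ[R] B) :=
  Finite.of_injective _ DFunLike.coe_injective

instance finite_linearEquiv (A B : Type*) [AddCommGroup A] [Module R A] [AddCommGroup B]
    [Module R B] [Finite A] [Finite B] : Finite (A ≃ₗ[R] B) :=
  Finite.of_injective _ DFunLike.coe_injective

theorem unitDensity_end_prod (A B : Type*) [AddCommGroup A] [Module R A] [AddCommGroup B]
    [Module R B] [Finite A] [Finite B] :
    unitDensity (Module.End R A) * unitDensity (Module.End R B) ≤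
      unitDensity (Module.End R (A × B)) := by
  have hEnd : Nat.card (Module.End R (A × B)) = Nat.card (Module.End R A) *
      Nat.card (Module.End R B) * (Nat.card (B →ₗ[R] A) * Nat.card (A →ₗ[R] B)) := by
    rw [Nat.card_congr ((LinearMap.coprodEquiv R).symm.toEquiv :
      Module.End R (A × B) ≃ (A →ₗ[R] A × B) × (B →ₗ[R] A × B)), Nat.card_prod,
      ← Nat.card_congr (LinearMap.prodEquiv R : ((A →ₗ[R] A) × (A →ₗ[R] B)) ≃ₗ[R] _).toEquiv,
      ← Nat.card_congr (LinearMap.prodEquiv R : ((B →ₗ[R] A) × (B →ₗ[R] B)) ≃ₗ[R] _).toEquiv,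
      Nat.card_prod, Nat.card_prod]
    ring
  have hAut : Nat.card (A ≃ₗ[R] A) * Nat.card (B ≃ₗ[R] B) *
      (Nat.card (B →ₗ[R] A) * Nat.card (A →ₗ[R] B)) ≤ Nat.card ((A × B) ≃ₗ[R] A × B) := by
    rw [← Nat.card_prod, ← Nat.card_prod, ← Nat.card_prod]
    let sw : (A × B) ≃ₗ[R] B × A := LinearEquiv.prodComm R A B
    refine Nat.card_le_card_of_injective
      (fun z => ((sw.trans
        ((LinearEquiv.refl R B).skewProd (LinearEquiv.refl R A) z.2.1)).trans sw.symm).trans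
          (z.1.1.skewProd z.1.2 z.2.2)) ?_
    rintro ⟨⟨a, b⟩, y, x⟩ ⟨⟨a', b'⟩, y', x'⟩ h
    have h1 : ∀ u v, (a (u + y v), b v + x (u + y v)) = (a' (u + y' v), b' v + x' (u + y' v)) :=
      fun u v => LinearEquiv.congr_fun h (u, v)
    have ha : a = a' := by
      ext u; simpa using congrArg Prod.fst (h1 u 0)
    have hx : x = x' := by
      ext u; simpa using congrArg Prod.snd (h1 u 0)
    subst ha hx
    have hy : y = y' := by
      ext v; simpa using congrArg Prod.fst (h1 0 v)
    subst hy
    have hb : b = b' := by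
      ext v; simpa using congrArg Prod.snd (h1 0 v)
    subst hb
    rfl
  have h1 : 0 < (Nat.card (B →ₗ[R] A) : ℝ) := by exact_mod_cast Nat.card_pos
  have h2 : 0 < (Nat.card (A →ₗ[R] B) : ℝ) := by exact_mod_cast Nat.card_pos
  simp only [unitDensity, natCard_units_end]
  rw [hEnd, div_mul_div_comm, ← mul_div_mul_right _ _ (mul_pos h1 h2).ne']
  push_cast
  gcongr
  exact_mod_cast hAut

theorem unitDensity_end_congr {A B : Type*} [AddCommGroup A] [Module R A] [AddCommGroup B]
    [Module R B] (e : A ≃ₗ[R] B) :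
    unitDensity (Module.End R A) = unitDensity (Module.End R B) :=
  unitDensity_congr e.conjRingEquiv.toMulEquiv

theorem prod_unitDensity_end_le {ι : Type*} [Fintype ι] (A : ι → Type*)
    [∀ i, AddCommGroup (A i)] [∀ i, Module R (A i)] [∀ i, Finite (A i)] :
    ∏ i, unitDensity (Module.End R (A i)) ≤ unitDensity (Module.End R (∀ i, A i)) := by
  revert A
  refine Fintype.induction_empty_option (P := fun ι _ => ∀ (A : ι → Type _)
    [∀ i, AddCommGroup (A i)] [∀ i, Module R (A i)] [∀ i, Finite (A i)],
    ∏ i, unitDensity (Module.End R (A i)) ≤ unitDensity (Module.End R (∀ i, A i)))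
    ?_ ?_ ?_ ι
  · intro α β _ e ih A _ _ _
    let _ : Fintype α := Fintype.ofEquiv β e.symm
    have := ih (fun i => A (e i))
    rw [unitDensity_end_congr (LinearEquiv.piCongrLeft R A e)] at this
    rw [← Equiv.prod_comp e]
    convert this
  · intro A _ _ _
    simp [unitDensity_of_subsingleton]
  · intro α _ ih A _ _ _
    rw [Fintype.prod_option, unitDensity_end_congr (LinearEquiv.piOptionEquivProd R (M := A))]
    refine le_trans ?_ (unitDensity_end_prod _ _)
    exact mul_le_mul_of_nonneg_left (ih fun i => A (some i)) (unitDensity_nonneg _)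

end EndDensity

theorem quarter_add_le_prod (q : ℝ) (hq : 2 ≤ q) (k : ℕ) :
    1 / 4 + (1 / 2) ^ (k + 2) ≤ ∏ i ∈ Finset.range (k + 1), (1 - (1 / q) ^ (i + 1)) := by
  have key : ∀ i : ℕ, (1 : ℝ) - (1 / 2) ^ (i + 1) ≤ 1 - (1 / q) ^ (i + 1) := fun i => by gcongr
  have hnn : ∀ i : ℕ, (0 : ℝ) ≤ 1 - (1 / 2) ^ (i + 1) := fun i => by
    have : (1 / 2 : ℝ) ^ (i + 1) ≤ 1 := pow_le_one₀ (by norm_num) (by norm_num)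
    linarith
  induction k with
  | zero => have := key 0; norm_num at this ⊢; linarith
  | succ k ih =>
    rw [Finset.prod_range_succ]
    refine le_trans ?_ (mul_le_mul ih (key _) (hnn _) (le_trans (by positivity) ih))
    have h1 : (1 / 2 : ℝ) ^ (k + 2) ≤ 1 / 4 :=
      (pow_le_pow_of_le_one (by norm_num) (by norm_num) (by omega : 2 ≤ k + 2)).trans
        (by norm_num)
    have h0 : (0 : ℝ) ≤ (1 / 2 : ℝ) ^ (k + 2) := by positivity
    rw [show k + 1 + 2 = (k + 2) + 1 by ring, show k + 1 + 1 = k + 2 by ring, pow_succ]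
    nlinarith

theorem quarter_le_unitDensity_matrix (K : Type*) [Field K] [Finite K] (k : ℕ) :
    1 / 4 ≤ unitDensity (Matrix (Fin k) (Fin k) K) := by
  have := Fintype.ofFinite K
  set q := Fintype.card K with hq
  have hq2 : 2 ≤ q := Fintype.one_lt_card
  have hq0 : (0 : ℝ) < q := by positivity
  have hM : Nat.card (Matrix (Fin k) (Fin k) K) = ∏ _i : Fin k, q ^ k := by
    change Nat.card (Fin k → Fin k → K) = _
    simp [hq]
  have h : unitDensity (Matrix (Fin k) (Fin k) K) =
      ∏ i ∈ Finset.range k, (1 - (1 / (q : ℝ)) ^ (i + 1)) := by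
    have h1 : Nat.card (Matrix (Fin k) (Fin k) K)ˣ = ∏ i : Fin k, (q ^ k - q ^ (i : ℕ)) :=
      Matrix.card_GL_field k
    rw [unitDensity, h1, hM]
    push_cast
    rw [← Finset.prod_div_distrib,
      Fin.prod_univ_eq_prod_range (fun i => ((q ^ k - q ^ i : ℕ) : ℝ) / (q : ℝ) ^ k) k,
      ← Finset.prod_range_reflect]
    refine Finset.prod_congr rfl fun i hi => ?_
    have hi' := Finset.mem_range.1 hi
    rw [Nat.cast_sub (Nat.pow_le_pow_right (by omega) (by omega))]
    push_cast
    rw [sub_div, div_self (by positivity), one_div, inv_pow, sub_right_inj,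
      div_eq_iff (by positivity), eq_inv_mul_iff_mul_eq₀ (by positivity), ← pow_add]
    congr 1
    omega
  rw [h]
  rcases k with _ | k
  · norm_num
  · have := quarter_add_le_prod q (by exact_mod_cast hq2) k
    have h0 : (0 : ℝ) ≤ (1 / 2 : ℝ) ^ (k + 2) := by positivity
    linarith

theorem quarter_le_unitDensity_end {R : Type*} [CommRing R] (I J : Ideal R) (hIJ : I ≤ J)
    [J.IsMaximal] (e : ℕ) (hJ : J ^ e ≤ I) [Finite (R ⧸ I)] (k : ℕ) :
    1 / 4 ≤ unitDensity (Module.End R (Fin k → R ⧸ I)) := by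
  let _ : Field (R ⧸ J) := Ideal.Quotient.field J
  let f : R ⧸ I →+* R ⧸ J := Ideal.Quotient.factor hIJ
  have hf : Function.Surjective f := Ideal.Quotient.factor_surjective hIJ
  have : Finite (R ⧸ J) := Finite.of_surjective f hf
  have hloc : IsLocalHom f := by
    refine ⟨fun a ha => ?_⟩
    obtain ⟨b, hb⟩ := hf (ha.unit⁻¹ : (R ⧸ J)ˣ)
    have h1 : f (1 - a * b) = 0 := by
      rw [map_sub, map_mul, hb, map_one, ha.mul_val_inv, sub_self]
    obtain ⟨x, hx⟩ := Ideal.Quotient.mk_surjective (1 - a * b)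
    have h2 : IsNilpotent (1 - a * b) := by
      refine ⟨e, ?_⟩
      rw [← hx] at h1 ⊢
      rw [← map_pow, Ideal.Quotient.eq_zero_iff_mem]
      exact hJ (Ideal.pow_mem_pow (Ideal.Quotient.eq_zero_iff_mem.1 h1) e)
    have h3 := h2.isUnit_one_sub
    rw [sub_sub_cancel] at h3
    exact isUnit_of_mul_isUnit_left h3
  have hlocM : IsLocalHom (f.mapMatrix (m := Fin k)) := by
    refine ⟨fun a ha => ?_⟩
    rw [Matrix.isUnit_iff_isUnit_det] at ha ⊢
    rw [← RingHom.map_det] at ha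
    exact isUnit_of_map_unit f _ ha
  have hsurj : Function.Surjective (f.mapMatrix (m := Fin k)) := fun M =>
    ⟨M.map (Function.surjInv hf), by ext i j; simp [Function.surjInv_eq hf]⟩
  have h1 := unitDensity_le_of_surjective (f.mapMatrix (m := Fin k)) hsurj
  have e1 : Module.End (R ⧸ I) (Fin k → R ⧸ I) ≃* Matrix (Fin k) (Fin k) (R ⧸ I) :=
    LinearMap.toMatrixAlgEquiv'.toMulEquiv
  have hs : Function.Surjective (algebraMap R (R ⧸ I)) := Ideal.Quotient.mk_surjective
  let e2 : Module.End (R ⧸ I) (Fin k → R ⧸ I) ≃* Module.End R (Fin k → R ⧸ I) :=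
    { toFun := fun φ => φ.restrictScalars R
      invFun := fun φ => LinearMap.extendScalarsOfSurjective hs φ
      left_inv := fun φ => rfl
      right_inv := fun φ => rfl
      map_mul' := fun φ ψ => rfl }
  rw [← unitDensity_congr e2, unitDensity_congr e1]
  exact (quarter_le_unitDensity_matrix _ k).trans h1

section Divisors

open Polynomial UniqueFactorizationMonoid

variable {F : Type*} [Field F]

open Classical in
/-- The pairs `(p, l)` with `p` a monic irreducible and `p ^ (l + 1)` a divisor of `g`. -/
noncomputable def primePowIndex (g : F[X]) : Finset (Σ _ : F[X], ℕ) :=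
  (normalizedFactors g).toFinset.sigma fun p => Finset.range ((normalizedFactors g).count p)

open Classical in
theorem pow_dvd_iff_le_count {g d p : F[X]} (hp : p ∈ normalizedFactors g)
    (hd : d ≠ 0) (l : ℕ) : p ^ l ∣ d ↔ l ≤ (normalizedFactors d).count p := by
  rw [pow_dvd_iff_le_emultiplicity, le_emultiplicity_iff_replicate_le_normalizedFactors
    (irreducible_of_normalized_factor p hp) hd, normalize_normalized_factor p hp,
    Multiset.le_count_iff_replicate_le]

open Classical in
theorem natDegree_eq_sum_normalizedFactors {d : F[X]} (hd : d ≠ 0) :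
    d.natDegree = ((normalizedFactors d).map natDegree).sum := by
  rw [← natDegree_multiset_prod _ (zero_notMem_normalizedFactors d)]
  exact natDegree_eq_of_degree_eq (degree_eq_degree_of_associated (prod_normalizedFactors hd).symm)

open Classical in
theorem natDegree_eq_sum_primePowIndex {g d : F[X]} (hg : g ≠ 0) (hd : d ∣ g) :
    d.natDegree =
      ∑ x ∈ primePowIndex g, x.1.natDegree * if x.1 ^ (x.2 + 1) ∣ d then 1 else 0 := by
  have hd0 : d ≠ 0 := ne_zero_of_dvd_ne_zero hg hd
  have hle := (dvd_iff_normalizedFactors_le_normalizedFactors hd0 hg).1 hd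
  rw [natDegree_eq_sum_normalizedFactors hd0, Finset.sum_multiset_map_count, primePowIndex,
    Finset.sum_sigma]
  rw [Finset.sum_subset (Multiset.toFinset_subset.2 (Multiset.subset_of_le hle))]
  · refine Finset.sum_congr rfl fun p hp => ?_
    dsimp only
    rw [← Finset.mul_sum, smul_eq_mul, mul_comm]
    congr 1
    rw [← Finset.card_filter]
    have hc := Multiset.count_le_of_le p hle
    rw [← Finset.card_range ((normalizedFactors d).count p)]
    congr 1
    ext l
    simp only [Finset.mem_filter, Finset.mem_range,
      pow_dvd_iff_le_count (Multiset.mem_toFinset.1 hp) hd0]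
    omega
  · intro p _ hp
    rw [Multiset.mem_toFinset] at hp
    simp [Multiset.count_eq_zero_of_notMem hp]

theorem mem_primePowIndex {g : F[X]} (hg : g ≠ 0) {x : Σ _ : F[X], ℕ}
    (hx : x ∈ primePowIndex g) :
    Irreducible x.1 ∧ x.1 ^ (x.2 + 1) ∣ g := by
  classical
  obtain ⟨h1, h2⟩ := Finset.mem_sigma.1 hx
  rw [Multiset.mem_toFinset] at h1
  exact ⟨irreducible_of_normalized_factor _ h1,
    (pow_dvd_iff_le_count h1 hg _).2 (Finset.mem_range.1 h2)⟩

theorem natDegree_eq_sum_primePowIndex_self {g : F[X]} (hg : g ≠ 0) :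
    g.natDegree = ∑ x ∈ primePowIndex g, x.1.natDegree := by
  classical
  rw [natDegree_eq_sum_primePowIndex hg dvd_rfl]
  exact Finset.sum_congr rfl fun x hx => by rw [if_pos (mem_primePowIndex hg hx).2, mul_one]

open Classical in
/-- The monic prime powers of positive degree that divide `g`. -/
noncomputable def primePowDivisors (g : F[X]) : Finset F[X] :=
  (primePowIndex g).image fun x => x.1 ^ (x.2 + 1)

theorem mem_primePowDivisors {g d : F[X]} (hg : g ≠ 0) (hd : d ∈ primePowDivisors g) :
    d ∣ g ∧ ∃ p e, Irreducible p ∧ d = p ^ (e + 1) := by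
  classical
  obtain ⟨x, hx, rfl⟩ := Finset.mem_image.1 hd
  obtain ⟨h1, h2⟩ := mem_primePowIndex hg hx
  exact ⟨h2, x.1, x.2, h1, rfl⟩

theorem natDegree_pos_of_mem_primePowDivisors {g d : F[X]} (hg : g ≠ 0)
    (hd : d ∈ primePowDivisors g) : 0 < d.natDegree := by
  obtain ⟨-, p, e, hp, rfl⟩ := mem_primePowDivisors hg hd
  rw [natDegree_pow]
  exact Nat.mul_pos e.succ_pos hp.natDegree_pos

theorem card_primePowDivisors_le {g : F[X]} (hg : g ≠ 0) :
    (primePowDivisors g).card ≤ g.natDegree := by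
  classical
  refine Finset.card_image_le.trans ?_
  rw [natDegree_eq_sum_primePowIndex_self hg, Finset.card_eq_sum_ones]
  exact Finset.sum_le_sum fun x hx => (mem_primePowIndex hg hx).1.natDegree_pos

open Classical in
theorem normalize_pow_mem_primePowDivisors {g p : F[X]} (hg : g ≠ 0) (hp : Irreducible p)
    {e : ℕ} (he : e ≠ 0) (h : p ^ e ∣ g) : normalize p ^ e ∈ primePowDivisors g := by
  obtain ⟨l, rfl⟩ := Nat.exists_eq_succ_of_ne_zero he
  have h' : normalize p ^ (l + 1) ∣ g := ((normalize_associated p).pow_pow.dvd).trans h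
  obtain ⟨r, hr, hpr⟩ := exists_mem_normalizedFactors_of_dvd hg hp ((dvd_pow_self p he).trans h)
  have hr' : normalize p = r := by
    rw [← normalize_normalized_factor r hr]
    exact normalize_eq_normalize_iff.2 ⟨hpr.dvd, hpr.symm.dvd⟩
  subst hr'
  refine Finset.mem_image.2 ⟨⟨normalize p, l⟩, Finset.mem_sigma.2
    ⟨Multiset.mem_toFinset.2 hr, Finset.mem_range.2 ?_⟩, rfl⟩
  exact (pow_dvd_iff_le_count hr hg _).1 h'

open Classical in
theorem sq_sum_natDegree_le {ι : Type*} [Fintype ι] {g : F[X]} (hg : g ≠ 0) (d : ι → F[X])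
    (hd : ∀ i, d i ∣ g) :
    (∑ i, (d i).natDegree) ^ 2 ≤
      g.natDegree * ∑ i, ∑ j, (EuclideanDomain.gcd (d i) (d j)).natDegree := by
  let δ : (Σ _ : F[X], ℕ) → F[X] → ℕ := fun x f => if x.1 ^ (x.2 + 1) ∣ f then 1 else 0
  have hgcd : ∀ x i j, δ x (EuclideanDomain.gcd (d i) (d j)) = δ x (d i) * δ x (d j) := by
    intro x i j
    have : x.1 ^ (x.2 + 1) ∣ EuclideanDomain.gcd (d i) (d j) ↔
        x.1 ^ (x.2 + 1) ∣ d i ∧ x.1 ^ (x.2 + 1) ∣ d j :=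
      ⟨fun h => ⟨h.trans (EuclideanDomain.gcd_dvd_left _ _),
        h.trans (EuclideanDomain.gcd_dvd_right _ _)⟩, fun h => EuclideanDomain.dvd_gcd h.1 h.2⟩
    simp only [δ, this, ite_and]
    split_ifs <;> rfl
  have h1 : ∑ i, (d i).natDegree =
      ∑ x ∈ primePowIndex g, x.1.natDegree * ∑ i, δ x (d i) := by
    simp_rw [Finset.mul_sum]
    rw [Finset.sum_comm]
    exact Finset.sum_congr rfl fun i _ => natDegree_eq_sum_primePowIndex hg (hd i)
  have h3 : ∑ i, ∑ j, (EuclideanDomain.gcd (d i) (d j)).natDegree =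
      ∑ x ∈ primePowIndex g, x.1.natDegree * (∑ i, δ x (d i)) ^ 2 := by
    simp_rw [sq, Finset.sum_mul_sum, Finset.mul_sum]
    rw [Finset.sum_comm (s := primePowIndex g)]
    refine Finset.sum_congr rfl fun i _ => ?_
    rw [Finset.sum_comm (s := primePowIndex g)]
    refine Finset.sum_congr rfl fun j _ => ?_
    rw [natDegree_eq_sum_primePowIndex hg ((EuclideanDomain.gcd_dvd_left _ _).trans (hd i))]
    exact Finset.sum_congr rfl fun x _ => by rw [← hgcd]
  rw [h1, natDegree_eq_sum_primePowIndex_self hg, h3]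
  exact Finset.sum_sq_le_sum_mul_sum_of_sq_le_mul _ (fun _ _ => Nat.zero_le _)
    (fun _ _ => Nat.zero_le _) fun x _ => le_of_eq (by ring)

end Divisors

section EndCard

open Polynomial

variable {F : Type*} [Field F]

theorem natCard_quotient_span {d : F[X]} (hd : d ≠ 0) :
    Nat.card (F[X] ⧸ Ideal.span {d}) = Nat.card F ^ d.natDegree := by
  have : Module.Finite F (F[X] ⧸ Ideal.span {d}) := (AdjoinRoot.powerBasis hd).finite
  rw [Module.natCard_eq_pow_finrank (K := F), finrank_quotient_span_eq_natDegree]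

variable [Finite F]

theorem finite_quotient_span {d : F[X]} (hd : d ≠ 0) : Finite (F[X] ⧸ Ideal.span {d}) := by
  have : Module.Finite F (F[X] ⧸ Ideal.span {d}) := (AdjoinRoot.powerBasis hd).finite
  exact Module.finite_of_finite F

open Classical in
theorem pow_natDegree_gcd_le_natCard_linearMap {a b : F[X]} (ha : a ≠ 0)
    (hb : b ≠ 0) :
    Nat.card F ^ (EuclideanDomain.gcd a b).natDegree ≤
      Nat.card ((F[X] ⧸ Ideal.span {a}) →ₗ[F[X]] (F[X] ⧸ Ideal.span {b})) := by
  have := finite_quotient_span ha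
  have := finite_quotient_span hb
  set c := EuclideanDomain.gcd a b
  have hca : c ∣ a := EuclideanDomain.gcd_dvd_left a b
  obtain ⟨b', hb'⟩ : c ∣ b := EuclideanDomain.gcd_dvd_right a b
  have hc : c ≠ 0 := ne_zero_of_dvd_ne_zero ha hca
  have hb'0 : b' ≠ 0 := by rintro rfl; exact hb (by simpa using hb')
  let m : F[X] →ₗ[F[X]] F[X] ⧸ Ideal.span {b} :=
    LinearMap.toSpanSingleton F[X] _ (Ideal.Quotient.mk _ b')
  have hm : ∀ y, m y = Ideal.Quotient.mk _ (y * b') := fun y => rfl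
  have hmc : ∀ y, m y = 0 ↔ c ∣ y := by
    intro y
    rw [hm, Ideal.Quotient.eq_zero_iff_dvd, hb', mul_dvd_mul_iff_right hb'0]
  have hma : ∀ y, LinearMap.toSpanSingleton F[X] _ (m y) a = 0 := by
    intro y
    rw [LinearMap.toSpanSingleton_apply, ← map_smul, hmc]
    exact hca.mul_right y
  let φ : F[X] → ((F[X] ⧸ Ideal.span {a}) →ₗ[F[X]] (F[X] ⧸ Ideal.span {b})) := fun y =>
    Submodule.liftQSpanSingleton a (LinearMap.toSpanSingleton F[X] _ (m y)) (hma y)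
  have hφ : ∀ y, φ y (Ideal.Quotient.mk _ 1) = m y := fun y => by
    change (1 : F[X]) • m y = m y
    rw [one_smul]
  rw [← natCard_quotient_span hc]
  refine Nat.card_le_card_of_injective
    (fun z => φ (Function.surjInv Ideal.Quotient.mk_surjective z)) ?_
  intro z z' h
  have h1 := congrArg (fun f => f (Ideal.Quotient.mk _ 1)) h
  simp only [hφ] at h1
  rw [← sub_eq_zero, ← map_sub, hmc, ← Ideal.Quotient.eq_zero_iff_dvd, map_sub,
    Function.surjInv_eq Ideal.Quotient.mk_surjective,
    Function.surjInv_eq Ideal.Quotient.mk_surjective, sub_eq_zero] at h1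
  exact h1

theorem prod_natCard_linearMap_le {R ι : Type*} [CommRing R] [Fintype ι] (A : ι → Type*)
    [∀ i, AddCommGroup (A i)] [∀ i, Module R (A i)] [∀ i, Finite (A i)] :
    ∏ i, ∏ j, Nat.card (A i →ₗ[R] A j) ≤ Nat.card (Module.End R (∀ i, A i)) := by
  classical
  simp_rw [← Nat.card_pi]
  refine Nat.card_le_card_of_injective
    (fun f => LinearMap.lsum R A R fun i => LinearMap.pi (f i)) ?_
  intro f f' h
  have h1 := (LinearMap.lsum R A R).injective h
  funext i j
  have h2 := congrFun h1 i
  ext x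
  exact congrFun (LinearMap.congr_fun h2 x) j

theorem pow_le_natCard_end {ι : Type*} [Fintype ι] {g : F[X]} (hg : g ≠ 0) (d : ι → F[X])
    (hd : ∀ i, d i ∣ g) (hdeg : 0 < g.natDegree) :
    (Nat.card F : ℝ) ^ (((∑ i, (d i).natDegree : ℕ) : ℝ) ^ 2 / g.natDegree) ≤
      Nat.card (Module.End F[X] (∀ i, F[X] ⧸ Ideal.span {d i})) := by
  classical
  have hd0 : ∀ i, d i ≠ 0 := fun i => ne_zero_of_dvd_ne_zero hg (hd i)
  have := fun i => finite_quotient_span (hd0 i)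
  have h1 := prod_natCard_linearMap_le (R := F[X]) fun i => F[X] ⧸ Ideal.span {d i}
  have h2 : Nat.card F ^ (∑ i, ∑ j, (EuclideanDomain.gcd (d i) (d j)).natDegree) ≤
      Nat.card (Module.End F[X] (∀ i, F[X] ⧸ Ideal.span {d i})) := by
    refine le_trans ?_ h1
    simp_rw [← Finset.prod_pow_eq_pow_sum]
    exact Finset.prod_le_prod' fun i _ => Finset.prod_le_prod' fun j _ =>
      pow_natDegree_gcd_le_natCard_linearMap (hd0 i) (hd0 j)
  have h3 := sq_sum_natDegree_le hg d hd
  have hq : (1 : ℝ) ≤ Nat.card F := by exact_mod_cast Nat.card_pos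
  refine le_trans (Real.rpow_le_rpow_of_exponent_le hq (z := ((∑ i, ∑ j,
    (EuclideanDomain.gcd (d i) (d j)).natDegree : ℕ) : ℝ)) ?_) ?_
  · rw [div_le_iff₀ (by exact_mod_cast hdeg), mul_comm]
    exact_mod_cast h3
  · rw [Real.rpow_natCast]
    exact_mod_cast h2

end EndCard

section CyclicSum

open Polynomial

variable {F : Type*} [Field F]

/-- The direct sum of `k d` copies of `F[X] ⧸ (d)` for `d ∈ T`. -/
abbrev CyclicSum (T : Finset F[X]) (k : T → ℕ) : Type _ :=
  ∀ x : (Σ d : T, Fin (k d)), F[X] ⧸ Ideal.span {(x.1 : F[X])}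

theorem exists_equiv_cyclicSum {h : F[X]} (hh : h ≠ 0) (V : Type*) [AddCommGroup V]
    [Module F[X] V] [Module.Finite F[X] V] (hV : ∀ v : V, h • v = 0) :
    ∃ k, Nonempty (V ≃ₗ[F[X]] CyclicSum (primePowDivisors h) k) := by
  classical
  obtain ⟨ι, _, p, hp, e, ⟨E⟩⟩ := Module.equiv_directSum_of_isTorsion (R := F[X]) (M := V)
    fun v => ⟨⟨h, mem_nonZeroDivisors_of_ne_zero hh⟩, hV v⟩
  let Q : ι → Type _ := fun i => F[X] ⧸ Ideal.span {p i ^ e i}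
  let E' : V ≃ₗ[F[X]] ∀ i, Q i := E.trans (DirectSum.linearEquivFunOnFintype F[X] ι _)
  have hdvd : ∀ i, p i ^ e i ∣ h := by
    intro i
    have h1 : h • (Pi.single i 1 : ∀ i, Q i) = 0 := by
      rw [← E'.apply_symm_apply (Pi.single i 1), ← map_smul, hV, map_zero]
    have h2 : h • (Ideal.Quotient.mk (Ideal.span {p i ^ e i}) 1) = 0 := by
      simpa using congrFun h1 i
    rw [← Ideal.Quotient.eq_zero_iff_dvd, ← mul_one h, ← smul_eq_mul]
    exact h2
  let ι' := {i // e i ≠ 0}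
  let res : (∀ i, Q i) →ₗ[F[X]] ∀ i : ι', Q i := LinearMap.pi fun i => LinearMap.proj i.1
  have hres : Function.Bijective res := by
    constructor
    · intro v w hvw
      funext i
      by_cases hi : e i = 0
      · have : Subsingleton (Q i) := by
          refine Ideal.Quotient.subsingleton_iff.2 ?_
          rw [hi, pow_zero, Ideal.span_singleton_one]
        exact Subsingleton.elim _ _
      · exact congrFun hvw ⟨i, hi⟩
    · intro w
      refine ⟨fun i => if hi : e i ≠ 0 then w ⟨i, hi⟩ else 0, ?_⟩
      funext i
      exact dif_pos i.2
  let f : ι' → primePowDivisors h := fun i =>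
    ⟨normalize (p i) ^ e i, normalize_pow_mem_primePowDivisors hh (hp i) i.2 (hdvd i)⟩
  let k : primePowDivisors h → ℕ := fun d => Fintype.card {i // f i = d}
  let σ : (Σ d, Fin (k d)) ≃ ι' :=
    (Equiv.sigmaCongrRight fun d => (Fintype.equivFin {i // f i = d}).symm).trans
      (Equiv.sigmaFiberEquiv f)
  have hσ : ∀ x, f (σ x) = x.1 := fun x => ((Fintype.equivFin {i // f i = x.1}).symm x.2).2
  have hspan : ∀ x, Ideal.span {p (σ x) ^ e (σ x)} = Ideal.span {(x.1 : F[X])} := by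
    intro x
    rw [Ideal.span_singleton_eq_span_singleton, ← hσ x]
    exact (normalize_associated _).symm.pow_pow
  exact ⟨k, ⟨E'.trans <| (LinearEquiv.ofBijective res hres).trans <|
    (LinearEquiv.piCongrLeft F[X] (fun i : ι' => Q i) σ).symm.trans <|
      LinearEquiv.piCongrRight fun x => Submodule.quotEquivOfEq _ _ (hspan x)⟩⟩

theorem natCard_cyclicSum {h : F[X]} (hh : h ≠ 0) (k : primePowDivisors h → ℕ) :
    Nat.card (CyclicSum (primePowDivisors h) k) =
      Nat.card F ^ ∑ d, k d * (d : F[X]).natDegree := by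
  have hd0 : ∀ d : primePowDivisors h, (d : F[X]) ≠ 0 := fun d =>
    ne_zero_of_dvd_ne_zero hh (mem_primePowDivisors hh d.2).1
  rw [Nat.card_pi, Fintype.prod_sigma, ← Finset.prod_pow_eq_pow_sum]
  refine Finset.prod_congr rfl fun d _ => ?_
  simp [natCard_quotient_span (hd0 d), ← pow_mul, mul_comm]

variable [Finite F]

theorem quarter_pow_le_unitDensity_cyclicSum {h : F[X]} (hh : h ≠ 0)
    (k : primePowDivisors h → ℕ) :
    (1 / 4 : ℝ) ^ (Finset.univ.filter fun d => k d ≠ 0).card ≤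
      unitDensity (Module.End F[X] (CyclicSum (primePowDivisors h) k)) := by
  have hd0 : ∀ d : primePowDivisors h, (d : F[X]) ≠ 0 := fun d =>
    ne_zero_of_dvd_ne_zero hh (mem_primePowDivisors hh d.2).1
  have := fun d => finite_quotient_span (hd0 d)
  rw [unitDensity_end_congr (LinearEquiv.piCurry F[X]
    fun (d : primePowDivisors h) (_ : Fin (k d)) => F[X] ⧸ Ideal.span {(d : F[X])})]
  refine le_trans ?_ (prod_unitDensity_end_le _)
  rw [← Finset.prod_const, Finset.prod_filter]
  refine Finset.prod_le_prod (fun d _ => by split_ifs <;> norm_num) fun d _ => ?_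
  split_ifs with hk
  · obtain ⟨-, p, e, hp, hd⟩ := mem_primePowDivisors hh d.2
    have : (Ideal.span {p}).IsMaximal := PrincipalIdealRing.isMaximal_of_irreducible hp
    refine quarter_le_unitDensity_end _ (Ideal.span {p}) ?_ (e + 1) ?_ _
    · rw [Ideal.span_singleton_le_span_singleton, hd]
      exact dvd_pow_self p e.succ_ne_zero
    · rw [Ideal.span_singleton_pow, hd]
  · rw [not_not] at hk
    have : IsEmpty (Fin (k d)) := by rw [hk]; infer_instance
    exact (unitDensity_of_subsingleton _).ge

theorem le_natCard_aut_cyclicSum {h g : F[X]} (hh : h ≠ 0) (hg : g ≠ 0) (hdeg : 0 < g.natDegree)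
    (k : primePowDivisors h → ℕ)
    (hk : ∀ v : CyclicSum (primePowDivisors h) k, g • v = 0) :
    (1 / 4 : ℝ) ^ (Finset.univ.filter fun d => k d ≠ 0).card *
        (Nat.card F : ℝ) ^
          (((∑ d, k d * (d : F[X]).natDegree : ℕ) : ℝ) ^ 2 / g.natDegree) ≤
      Nat.card (CyclicSum (primePowDivisors h) k ≃ₗ[F[X]] CyclicSum (primePowDivisors h) k) := by
  have hd0 : ∀ d : primePowDivisors h, (d : F[X]) ≠ 0 := fun d =>
    ne_zero_of_dvd_ne_zero hh (mem_primePowDivisors hh d.2).1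
  have := fun d => finite_quotient_span (hd0 d)
  have hdvd : ∀ x : (Σ d : primePowDivisors h, Fin (k d)), (x.1 : F[X]) ∣ g := by
    classical
    intro x
    have h2 : g • (Ideal.Quotient.mk (Ideal.span {(x.1 : F[X])}) 1) = 0 := by
      simpa using congrFun (hk (Pi.single x 1)) x
    rw [← Ideal.Quotient.eq_zero_iff_dvd, ← mul_one g, ← smul_eq_mul]
    exact h2
  have h1 := pow_le_natCard_end hg (fun x : (Σ d : primePowDivisors h, Fin (k d)) => (x.1 : F[X]))
    hdvd hdeg
  have hsum : ∑ x : (Σ d : primePowDivisors h, Fin (k d)), (x.1 : F[X]).natDegree =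
      ∑ d, k d * (d : F[X]).natDegree := by
    rw [Fintype.sum_sigma]
    simp
  rw [hsum] at h1
  have h2 := quarter_pow_le_unitDensity_cyclicSum hh k
  have h3 : (0 : ℝ) < Nat.card (Module.End F[X] (CyclicSum (primePowDivisors h) k)) := by
    exact_mod_cast Nat.card_pos
  rw [unitDensity, natCard_units_end, le_div_iff₀ h3] at h2
  exact le_trans (mul_le_mul_of_nonneg_left h1 (by positivity)) h2

end CyclicSum

section Counting

open Polynomial

theorem ncard_aeval_equiv_mul_le {F : Type*} [Field F] [Finite F] (n : ℕ) (N : Type*)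
    [AddCommGroup N] [Module F N] [Module F[X] N] [IsScalarTower F F[X] N] [Finite N] :
    {M : Matrix (Fin n) (Fin n) F |
        Nonempty (Module.AEval' (Matrix.toLin' M) ≃ₗ[F[X]] N)}.ncard *
      Nat.card (N ≃ₗ[F[X]] N) ≤ Nat.card (Matrix (Fin n) (Fin n) F)ˣ := by
  set S := {M : Matrix (Fin n) (Fin n) F |
    Nonempty (Module.AEval' (Matrix.toLin' M) ≃ₗ[F[X]] N)} with hS
  rcases S.eq_empty_or_nonempty with h0 | ⟨M₀, ⟨E₀⟩⟩
  · simp [h0]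
  have E : ∀ M : S, Module.AEval' (Matrix.toLin' M.1) ≃ₗ[F[X]] N := fun M => M.2.some
  let toF : ∀ M : Matrix (Fin n) (Fin n) F, (Module.AEval' (Matrix.toLin' M) ≃ₗ[F[X]] N) →
      ((Fin n → F) ≃ₗ[F] N) := fun M φ =>
    (Module.AEval'.of (Matrix.toLin' M)).trans (φ.restrictScalars F)
  have hX : ∀ M φ v, toF M φ (Matrix.toLin' M v) = (X : F[X]) • toF M φ v := by
    intro M φ v
    change φ (Module.AEval'.of _ _) = (X : F[X]) • φ (Module.AEval'.of _ _)
    rw [← map_smul, Module.AEval'.X_smul_of]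
    rfl
  have hcard : Nat.card ((Fin n → F) ≃ₗ[F] N) = Nat.card (Matrix (Fin n) (Fin n) F)ˣ := by
    let e := toF M₀ E₀
    rw [Nat.card_congr (Units.mapEquiv
      (LinearMap.toMatrixAlgEquiv' (R := F) (n := Fin n)).toMulEquiv).symm.toEquiv,
      Nat.card_congr (LinearMap.GeneralLinearGroup.generalLinearEquiv F (Fin n → F)).toEquiv]
    exact Nat.card_congr
      { toFun := fun φ => φ.trans e.symm
        invFun := fun φ => φ.trans e
        left_inv := fun φ => by ext; simp
        right_inv := fun φ => by ext; simp }
  rw [← Nat.card_coe_set_eq, ← Nat.card_prod, ← hcard]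
  refine Nat.card_le_card_of_injective (fun z => toF z.1 ((E z.1).trans z.2)) ?_
  rintro ⟨M, a⟩ ⟨M', a'⟩ h
  have hM : M = M' := by
    apply Subtype.ext
    apply Matrix.toLin'.injective
    refine LinearMap.ext fun v => ?_
    dsimp only at h
    apply (toF M ((E M).trans a)).injective
    rw [hX, h, hX]
  subst hM
  congr 1
  refine LinearEquiv.ext fun y => ?_
  obtain ⟨x, rfl⟩ := (E M).surjective y
  exact LinearEquiv.congr_fun h ((Module.AEval'.of (Matrix.toLin' M.1)).symm x)

theorem card_weighted_le {T : Type*} [Fintype T] [DecidableEq T] (w : T → ℕ) (hw : ∀ d, 0 < w d)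
    (n : ℕ) {t : ℝ} (ht0 : 0 < t) (ht1 : t < 1) :
    (((Fintype.piFinset fun _ : T => Finset.range (n + 1)).filter
        fun k => ∑ d, k d * w d = n).card : ℝ) * t ^ n ≤ ∏ d, (1 - t ^ w d)⁻¹ := by
  have hlt : ∀ d, t ^ w d < 1 := fun d => pow_lt_one₀ ht0.le ht1 (hw d).ne'
  calc _ = ∑ k ∈ (Fintype.piFinset fun _ : T => Finset.range (n + 1)).filter
        (fun k => ∑ d, k d * w d = n), ∏ d, (t ^ w d) ^ k d := by
        rw [← nsmul_eq_mul, ← Finset.sum_const]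
        refine Finset.sum_congr rfl fun k hk => ?_
        rw [← (Finset.mem_filter.1 hk).2, ← Finset.prod_pow_eq_pow_sum]
        exact Finset.prod_congr rfl fun d _ => by rw [← pow_mul, mul_comm]
    _ ≤ ∑ k ∈ Fintype.piFinset fun _ : T => Finset.range (n + 1), ∏ d, (t ^ w d) ^ k d :=
        Finset.sum_le_sum_of_subset_of_nonneg (Finset.filter_subset _ _)
          fun _ _ _ => Finset.prod_nonneg fun _ _ => by positivity
    _ = ∏ d, ∑ j ∈ Finset.range (n + 1), (t ^ w d) ^ j := (Finset.prod_univ_sum _ _).symm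
    _ ≤ _ := Finset.prod_le_prod (fun d _ => Finset.sum_nonneg fun _ _ => by positivity)
        fun d _ => by
          rw [geom_sum_eq (hlt d).ne, ← neg_div_neg_eq, neg_sub, neg_sub, ← one_div]
          have h1 := hlt d
          have h2 : 0 < (t ^ w d) ^ (n + 1) := by positivity
          exact div_le_div_of_nonneg_right (by linarith) (by linarith)

theorem prod_inv_one_sub_pow_le {T : Type*} [Fintype T] (w : T → ℕ) (hw : ∀ d, 0 < w d)
    {n Q W : ℕ} (hW : 0 < W) (hQ : (Finset.univ.filter fun d => w d < W).card ≤ Q)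
    (hn : Fintype.card T ≤ n) {t : ℝ} (ht0 : 0 < t) (ht1 : t < 1) :
    ∏ d, (1 - t ^ w d)⁻¹ ≤ ((1 - t)⁻¹) ^ Q * ((1 - t ^ W)⁻¹) ^ n := by
  classical
  have hlt : ∀ {m : ℕ}, 0 < m → 0 < 1 - t ^ m := fun hm =>
    sub_pos.2 (pow_lt_one₀ ht0.le ht1 hm.ne')
  have ht : 0 < 1 - t := sub_pos.2 ht1
  have hone : ∀ {m : ℕ}, 0 < m → 1 ≤ (1 - t ^ m)⁻¹ := fun hm =>
    (one_le_inv₀ (hlt hm)).2 (by have := pow_pos ht0; linarith [this ‹ℕ›])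
  have h1 : 1 ≤ (1 - t)⁻¹ := by simpa using hone one_pos
  rw [← Finset.prod_filter_mul_prod_filter_not Finset.univ fun d => w d < W]
  refine mul_le_mul ?_ ?_ (Finset.prod_nonneg fun d _ => zero_le_one.trans (hone (hw d)))
    (by positivity)
  · refine (Finset.prod_le_prod (g := fun _ => (1 - t)⁻¹)
      (fun d _ => zero_le_one.trans (hone (hw d))) fun d _ => ?_).trans
        ((Finset.prod_const _).trans_le (pow_le_pow_right₀ h1 hQ))
    refine inv_anti₀ ht (sub_le_sub_left ?_ 1)
    exact pow_le_of_le_one ht0.le ht1.le (hw d).ne'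
  · refine (Finset.prod_le_prod (g := fun _ => (1 - t ^ W)⁻¹)
      (fun d _ => zero_le_one.trans (hone (hw d))) fun d hd => ?_).trans
        ((Finset.prod_const _).trans_le
          (pow_le_pow_right₀ (hone hW) ((Finset.card_filter_le _ _).trans hn)))
    refine inv_anti₀ (hlt hW) (sub_le_sub_left ?_ 1)
    exact pow_le_pow_of_le_one ht0.le ht1.le (not_lt.1 (Finset.mem_filter.1 hd).2)

theorem card_support_le {T : Type*} [Fintype T] (w : T → ℕ) (k : T → ℕ) {n Q W : ℕ} (hW : 0 < W)
    (hQ : (Finset.univ.filter fun d => w d < W).card ≤ Q) (hk : ∑ d, k d * w d = n) :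
    (Finset.univ.filter fun d => k d ≠ 0).card ≤ Q + n / W := by
  classical
  have h1 : (Finset.univ.filter fun d => k d ≠ 0 ∧ ¬ w d < W).card ≤ n / W := by
    rw [Nat.le_div_iff_mul_le hW, ← smul_eq_mul, ← Finset.sum_const, ← hk]
    refine (Finset.sum_le_sum fun d hd => ?_).trans
      (Finset.sum_le_sum_of_subset (Finset.subset_univ _))
    obtain ⟨-, h2, h3⟩ := Finset.mem_filter.1 hd
    exact (not_lt.1 h3).trans (Nat.le_mul_of_pos_left _ (Nat.pos_of_ne_zero h2))
  refine le_trans ?_ (add_le_add hQ h1)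
  refine (Finset.card_le_card fun d hd => ?_).trans (Finset.card_union_le _ _)
  simp only [Finset.mem_union, Finset.mem_filter, Finset.mem_univ, true_and] at hd ⊢
  tauto

theorem card_natDegree_lt_le {F : Type*} [Field F] [Finite F] (T : Finset F[X]) (W : ℕ) :
    (Finset.univ.filter fun d : T => (d : F[X]).natDegree < W).card ≤ Nat.card F ^ W := by
  have hdeg : ∀ d : {d : T // (d : F[X]).natDegree < W}, (d.1 : F[X]) ∈ degreeLT F W := by
    rintro ⟨d, hd⟩
    rw [mem_degreeLT]
    exact degree_le_natDegree.trans_lt (by exact_mod_cast hd)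
  have : Finite (degreeLT F W) := Finite.of_equiv _ (degreeLTEquiv F W).symm.toEquiv
  have h1 : Nat.card (degreeLT F W) = Nat.card F ^ W := by
    rw [Nat.card_congr (degreeLTEquiv F W).toEquiv, Nat.card_fun, Nat.card_fin]
  rw [← h1, ← Fintype.card_subtype, ← Nat.card_eq_fintype_card]
  refine Nat.card_le_card_of_injective (fun d => (⟨_, hdeg d⟩ : degreeLT F W)) ?_
  intro d d' h
  have h' : (d.1 : F[X]) = d'.1 := congrArg (fun x : degreeLT F W => (x : F[X])) h
  exact Subtype.ext (Subtype.ext h')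

theorem exists_eventually_const_mul_pow_le {c : ℝ} (hc : 1 < c) :
    ∃ t : ℝ, 0 < t ∧ t < 1 ∧ ∃ W : ℕ, 0 < W ∧ ∀ C : ℝ, ∃ N : ℕ, ∀ n, N ≤ n →
      C * ((4 : ℝ) ^ (1 / (W : ℝ)) * (1 - t ^ W)⁻¹ * t⁻¹) ^ n ≤ c ^ n := by
  have hc0 : 0 < c := by linarith
  obtain ⟨t, ht0, ht1⟩ := exists_between (inv_lt_one_of_one_lt₀ hc)
  have htpos : 0 < t := (inv_pos.2 hc0).trans ht0
  have hlim : Filter.Tendsto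
      (fun W : ℕ => (4 : ℝ) ^ (1 / (W : ℝ)) * (1 - t ^ W)⁻¹ * t⁻¹) Filter.atTop
      (nhds ((4 : ℝ) ^ (0 : ℝ) * (1 - 0)⁻¹ * t⁻¹)) := by
    refine ((tendsto_const_nhds.rpow tendsto_one_div_atTop_nhds_zero_nat
      (Or.inl (by norm_num))).mul ?_).mul_const _
    exact ((tendsto_pow_atTop_nhds_zero_of_lt_one htpos.le ht1).const_sub 1).inv₀ (by norm_num)
  have hlt : (4 : ℝ) ^ (0 : ℝ) * (1 - 0)⁻¹ * t⁻¹ < c := by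
    simpa using inv_lt_of_inv_lt₀ hc0 ht0
  obtain ⟨W, hW, hW0⟩ := ((hlim.eventually_lt_const hlt).and (Filter.eventually_gt_atTop 0)).exists
  refine ⟨t, htpos, ht1, W, hW0, fun C => ?_⟩
  set ρ := (4 : ℝ) ^ (1 / (W : ℝ)) * (1 - t ^ W)⁻¹ * t⁻¹
  have hρ : 0 ≤ ρ := by
    have : 0 < 1 - t ^ W := sub_pos.2 (pow_lt_one₀ htpos.le ht1 hW0.ne')
    positivity
  have h0 : Filter.Tendsto (fun n : ℕ => C * (ρ / c) ^ n) Filter.atTop (nhds (C * 0)) :=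
    (tendsto_pow_atTop_nhds_zero_of_lt_one (by positivity) ((div_lt_one hc0).2 hW)).const_mul C
  rw [mul_zero] at h0
  obtain ⟨N, hN⟩ := Filter.eventually_atTop.1 (h0.eventually_le_const one_pos)
  refine ⟨N, fun n hn => ?_⟩
  have := hN n hn
  rwa [div_pow, ← mul_div_assoc, div_le_one (by positivity)] at this

end Counting

section MainCount

open Polynomial

variable {F : Type*} [Field F] [Finite F]

/-- A bound for the number of matrices with minimal polynomial of degree `m` and associated
`F[X]`-module isomorphic to a fixed direct sum of cyclic modules. -/
theorem ncard_aeval_equiv_cyclicSum_le {n m W : ℕ} (hW : 0 < W) (hm : 0 < m) {h : F[X]}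
    (hh : h ≠ 0) (k : primePowDivisors h → ℕ)
    (hk : ∑ d, k d * (d : F[X]).natDegree = n) :
    ({M : Matrix (Fin n) (Fin n) F | (minpoly F M).natDegree = m ∧
      Nonempty (Module.AEval' (Matrix.toLin' M) ≃ₗ[F[X]] CyclicSum (primePowDivisors h) k)}.ncard
        : ℝ) ≤ Nat.card (Matrix (Fin n) (Fin n) F)ˣ *
          ((4 : ℝ) ^ (Nat.card F ^ W + n / W) * (Nat.card F : ℝ) ^ (-((n : ℝ) ^ 2 / m))) := by
  have hq : (0 : ℝ) < Nat.card F := by exact_mod_cast Nat.card_pos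
  set S := {M : Matrix (Fin n) (Fin n) F | (minpoly F M).natDegree = m ∧
      Nonempty (Module.AEval' (Matrix.toLin' M) ≃ₗ[F[X]] CyclicSum (primePowDivisors h) k)}
  rcases S.eq_empty_or_nonempty with h0 | ⟨M, hMm, ⟨E⟩⟩
  · rw [h0, Set.ncard_empty, Nat.cast_zero]; positivity
  have hd0 : ∀ d : primePowDivisors h, (d : F[X]) ≠ 0 := fun d =>
    ne_zero_of_dvd_ne_zero hh (mem_primePowDivisors hh d.2).1
  have := fun d => finite_quotient_span (hd0 d)
  have hg : minpoly F M ≠ 0 := minpoly.ne_zero (Matrix.isIntegral M)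
  have hann : ∀ v : CyclicSum (primePowDivisors h) k, minpoly F M • v = 0 := by
    intro v
    rw [← E.apply_symm_apply v, ← map_smul]
    refine (congrArg E ?_).trans E.map_zero
    apply (Module.AEval'.of (Matrix.toLin' M)).symm.injective
    rw [Module.AEval.of_symm_smul, map_zero, ← Matrix.minpoly_toLin', minpoly.aeval, zero_smul]
  have h1 := le_natCard_aut_cyclicSum hh hg (by omega) k hann
  rw [hk, hMm] at h1
  set A := Nat.card (CyclicSum (primePowDivisors h) k ≃ₗ[F[X]] CyclicSum (primePowDivisors h) k)
  have h2 := card_support_le (fun d : primePowDivisors h => (d : F[X]).natDegree) k hW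
    (card_natDegree_lt_le _ W) hk
  have h3 : S.ncard * A ≤ Nat.card (Matrix (Fin n) (Fin n) F)ˣ :=
    (Nat.mul_le_mul_right A (Set.ncard_le_ncard fun M hM => hM.2)).trans
      (ncard_aeval_equiv_mul_le n (CyclicSum (primePowDivisors h) k))
  have h4 : (1 / 4 : ℝ) ^ (Nat.card F ^ W + n / W) * (Nat.card F : ℝ) ^ ((n : ℝ) ^ 2 / m) ≤ A :=
    le_trans (mul_le_mul_of_nonneg_right
      (pow_le_pow_of_le_one (by norm_num) (by norm_num) h2) (by positivity)) h1
  have h5 : (S.ncard : ℝ) * ((1 / 4 : ℝ) ^ (Nat.card F ^ W + n / W) *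
      (Nat.card F : ℝ) ^ ((n : ℝ) ^ 2 / m)) ≤ Nat.card (Matrix (Fin n) (Fin n) F)ˣ :=
    le_trans (mul_le_mul_of_nonneg_left h4 (by positivity)) (by exact_mod_cast h3)
  rw [← le_div_iff₀ (by positivity)] at h5
  refine h5.trans_eq ?_
  rw [Real.rpow_neg hq.le, one_div, inv_pow, div_eq_mul_inv, mul_inv, inv_inv]

/-- A bound for the number of matrices with characteristic polynomial `h` and minimal polynomial
of degree `m`. The parameters `W` and `t` are free: they control the subexponential loss. -/
theorem ncard_minpoly_natDegree_charpoly_le {n m W : ℕ} (hW : 0 < W) (hm : 0 < m) {h : F[X]}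
    (hh : h ≠ 0) (hn : h.natDegree = n) {t : ℝ} (ht0 : 0 < t) (ht1 : t < 1) :
    ({M : Matrix (Fin n) (Fin n) F | (minpoly F M).natDegree = m ∧ M.charpoly = h}.ncard : ℝ) ≤
      (4 * (1 - t)⁻¹) ^ (Nat.card F ^ W) *
        ((4 : ℝ) ^ (1 / (W : ℝ)) * (1 - t ^ W)⁻¹ * t⁻¹) ^ n *
          (Nat.card (Matrix (Fin n) (Fin n) F)ˣ *
            (Nat.card F : ℝ) ^ (-((n : ℝ) ^ 2 / m))) := by
  classical
  have hq : (0 : ℝ) < Nat.card F := by exact_mod_cast Nat.card_pos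
  let T := primePowDivisors h
  let w : T → ℕ := fun d => (d : F[X]).natDegree
  have hw : ∀ d, 0 < w d := fun d => natDegree_pos_of_mem_primePowDivisors hh d.2
  let K : Finset (T → ℕ) := (Fintype.piFinset fun _ : T => Finset.range (n + 1)).filter
    fun k => ∑ d, k d * w d = n
  let S : (T → ℕ) → Set (Matrix (Fin n) (Fin n) F) := fun k =>
    {M | (minpoly F M).natDegree = m ∧
      Nonempty (Module.AEval' (Matrix.toLin' M) ≃ₗ[F[X]] CyclicSum T k)}
  have hcover : {M : Matrix (Fin n) (Fin n) F | (minpoly F M).natDegree = m ∧ M.charpoly = h} ⊆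
      ⋃ k ∈ K, S k := by
    rintro M ⟨hMm, hMh⟩
    have hann : ∀ v : Module.AEval' (Matrix.toLin' M), h • v = 0 := by
      intro v
      apply (Module.AEval'.of (Matrix.toLin' M)).symm.injective
      obtain ⟨r, hr⟩ := Matrix.minpoly_dvd_charpoly M
      rw [Module.AEval.of_symm_smul, map_zero, ← hMh, hr, map_mul, ← Matrix.minpoly_toLin',
        minpoly.aeval, zero_mul, zero_smul]
    obtain ⟨k, ⟨E⟩⟩ := exists_equiv_cyclicSum hh (Module.AEval' (Matrix.toLin' M)) hann
    have hcard : Nat.card F ^ n = Nat.card F ^ ∑ d, k d * w d := by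
      rw [← natCard_cyclicSum hh k, ← Nat.card_congr E.toEquiv,
        ← Nat.card_congr (Module.AEval'.of (Matrix.toLin' M)).toEquiv,
        Nat.card_fun, Nat.card_fin]
    have hsum : ∑ d, k d * w d = n :=
      (Nat.pow_right_injective Finite.one_lt_card hcard).symm
    refine Set.mem_biUnion (Finset.mem_filter.2 ⟨Fintype.mem_piFinset.2 fun d => ?_, hsum⟩)
      ⟨hMm, ⟨E⟩⟩
    rw [Finset.mem_range, Nat.lt_succ_iff, ← hsum]
    exact (Nat.le_mul_of_pos_right _ (hw d)).trans
      (Finset.single_le_sum (f := fun d => k d * w d) (fun _ _ => Nat.zero_le _)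
        (Finset.mem_univ d))
  have hK : (K.card : ℝ) ≤ (1 - t)⁻¹ ^ (Nat.card F ^ W) * (1 - t ^ W)⁻¹ ^ n * t⁻¹ ^ n := by
    have h1 := (card_weighted_le w hw n ht0 ht1).trans
      (prod_inv_one_sub_pow_le (n := n) w hw hW (card_natDegree_lt_le _ W)
        (by rw [Fintype.card_coe]; exact (card_primePowDivisors_le hh).trans hn.le) ht0 ht1)
    rwa [← le_div_iff₀ (by positivity), div_eq_mul_inv, ← inv_pow] at h1
  have h4 : (4 : ℝ) ^ (Nat.card F ^ W + n / W) ≤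
      4 ^ (Nat.card F ^ W) * ((4 : ℝ) ^ (1 / (W : ℝ))) ^ n := by
    rw [pow_add]
    refine mul_le_mul_of_nonneg_left ?_ (by positivity)
    rw [← Real.rpow_natCast, ← Real.rpow_natCast, ← Real.rpow_mul (by norm_num)]
    refine Real.rpow_le_rpow_of_exponent_le (by norm_num) ?_
    rw [one_div, inv_mul_eq_div]
    exact Nat.cast_div_le
  set G : ℝ := ((Nat.card (Matrix (Fin n) (Fin n) F)ˣ : ℕ) : ℝ)
  set Y : ℝ := (Nat.card F : ℝ) ^ (-((n : ℝ) ^ 2 / m))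
  have hY : 0 ≤ Y := by positivity
  have hG : 0 ≤ G := by positivity
  calc _ ≤ ((⋃ k ∈ K, S k).ncard : ℝ) := by exact_mod_cast Set.ncard_le_ncard hcover
    _ ≤ ∑ k ∈ K, ((S k).ncard : ℝ) := by exact_mod_cast Finset.set_ncard_biUnion_le K S
    _ ≤ ∑ k ∈ K, G * ((4 : ℝ) ^ (Nat.card F ^ W + n / W) * Y) :=
        Finset.sum_le_sum fun k hk =>
          ncard_aeval_equiv_cyclicSum_le hW hm hh k (Finset.mem_filter.1 hk).2
    _ = K.card * (4 : ℝ) ^ (Nat.card F ^ W + n / W) * (G * Y) := by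
        rw [Finset.sum_const, nsmul_eq_mul]; ring
    _ ≤ ((1 - t)⁻¹ ^ (Nat.card F ^ W) * (1 - t ^ W)⁻¹ ^ n * t⁻¹ ^ n) *
          (4 ^ (Nat.card F ^ W) * ((4 : ℝ) ^ (1 / (W : ℝ))) ^ n) * (G * Y) := by
        gcongr
        exact (Nat.cast_nonneg _).trans hK
    _ = _ := by
        rw [mul_pow, mul_pow, mul_pow]; ring

end MainCount

/-- Over a finite field with `q` elements and odd characteristic, for every `ε > 0`, for
all sufficiently large `n`, all `δ < n` and all monic `h` of degree `n`, the number of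
invertible `n×n` matrices `M` with `deg (minpoly F M) = n − δ` and `charpoly M = h` is at
most `|GL_n(F)| · q^(ε·n − n²/(n−δ))`. -/
theorem stmt_15 {F : Type*} [Field F] [Fintype F] (p : ℕ) [Fact p.Prime] (hp : Odd p)
    [CharP F p] (q : ℕ) (hq : q = Fintype.card F) :
    ∀ ε : ℝ, 0 < ε → ∃ N : ℕ, ∀ n : ℕ, N ≤ n → ∀ δ : ℕ, δ < n →
      ∀ h : Polynomial F, h.Monic → h.natDegree = n →
      ({M : Matrix (Fin n) (Fin n) F | IsUnit M.det ∧
          (minpoly F M).natDegree = n - δ ∧ M.charpoly = h}.ncard : ℝ) ≤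
        (Nat.card (Matrix (Fin n) (Fin n) F)ˣ : ℝ) *
          (q : ℝ) ^ (ε * n - (n : ℝ) ^ 2 / ((n : ℝ) - (δ : ℝ))) := by
  intro ε hε
  subst hq
  have hq1 : (1 : ℝ) < Fintype.card F := by exact_mod_cast Fintype.one_lt_card
  obtain ⟨t, ht0, ht1, W, hW, hN⟩ :=
    exists_eventually_const_mul_pow_le (Real.one_lt_rpow hq1 hε)
  obtain ⟨N, hN⟩ := hN ((4 * (1 - t)⁻¹) ^ (Nat.card F ^ W))
  refine ⟨N, fun n hn δ hδ h hmonic hdeg => ?_⟩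
  have hmain := ncard_minpoly_natDegree_charpoly_le hW (Nat.sub_pos_of_lt hδ) hmonic.ne_zero hdeg
    ht0 ht1
  have hsub : {M : Matrix (Fin n) (Fin n) F | IsUnit M.det ∧
      (minpoly F M).natDegree = n - δ ∧ M.charpoly = h}.ncard ≤
      {M : Matrix (Fin n) (Fin n) F | (minpoly F M).natDegree = n - δ ∧ M.charpoly = h}.ncard :=
    Set.ncard_le_ncard fun M hM => hM.2
  refine (Nat.cast_le.2 hsub).trans (hmain.trans ?_)
  refine (mul_le_mul_of_nonneg_right (hN n hn) (by positivity)).trans_eq ?_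
  rw [Nat.card_eq_fintype_card (α := F), Nat.cast_sub hδ.le,
    ← Real.rpow_mul_natCast (by positivity), sub_eq_add_neg (ε * n), Real.rpow_add (by positivity)]
  ring
end

section
/- Let F be a finite field with q elements and odd characteristic, and let Sp_{2n}(F) denote the symplectic group of 2n×2n matrices M over F with M·J·Mᵀ = J, where J is the standard symplectic matrix [[0,1ₙ],[−1ₙ,0]]. For every ε > 0 there exists N such that for all n ≥ N, all integers δ with 0 ≤ δ < n, and all monic self-reciprocal polynomials f ∈ F[X] of degree 2n with f(0) ≠ 0: the number of M ∈ Sp_{2n}(F) with deg(minpoly F M) = n − δ and charpoly(M) = f is at most |Sp_{2n}(F)| · q^{ε·n − n²/(2(n−δ))}. Equivalently, for M uniform in Sp_{2n}(F), Pr[deg min(M) = n − δ and char(M) = f] ≪ q^{−n²/(2(n−δ)) + o(n)}. -/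
open Matrix

section SymplecticFamily

variable {K V : Type*} [Field K] [AddCommGroup V] [Module K V]

/-- The sequence `a, e 0, e 1, …`. -/
def consSeq {α : Type*} (a : α) (e : ℕ → α) : ℕ → α
  | 0 => a
  | i + 1 => e i

theorem consSeq_image_Iio_succ {α : Type*} (a : α) (e : ℕ → α) (k : ℕ) :
    consSeq a e '' Set.Iio (k + 1) = insert a (e '' Set.Iio k) := by
  ext x
  simp only [Set.mem_image, Set.mem_Iio, Set.mem_insert_iff]
  constructor
  · rintro ⟨_ | i, hi, rfl⟩
    · exact Or.inl rfl
    · exact Or.inr ⟨i, by omega, rfl⟩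
  · rintro (rfl | ⟨i, hi, rfl⟩)
    · exact ⟨0, by omega, rfl⟩
    · exact ⟨i + 1, by omega, rfl⟩

/-- The first `k` vectors of `e` and `f` form hyperbolic pairs for `ω`. -/
def IsSymplecticFamily (ω : V →ₗ[K] V →ₗ[K] K) (k : ℕ) (e f : ℕ → V) : Prop :=
  ∀ i < k, ∀ j < k, ω (e i) (e j) = 0 ∧ ω (f i) (f j) = 0 ∧
    ω (e i) (f j) = if i = j then 1 else 0

theorem IsSymplecticFamily.cons {ω : V →ₗ[K] V →ₗ[K] K} (hω : ω.IsAlt) {k : ℕ} {e f : ℕ → V}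
    (h : IsSymplecticFamily ω k e f) {a b : V} (hab : ω a b = 1)
    (he : ∀ i < k, ω a (e i) = 0 ∧ ω b (e i) = 0) (hf : ∀ i < k, ω a (f i) = 0 ∧ ω b (f i) = 0) :
    IsSymplecticFamily ω (k + 1) (consSeq a e) (consSeq b f) := by
  have hs : ∀ x y, ω x y = 0 → ω y x = 0 := fun x y h => hω.isRefl x y h
  rintro (_ | i) hi (_ | j) hj
  · exact ⟨hω a, hω b, by simpa [consSeq] using hab⟩
  · exact ⟨(he j (by omega)).1, (hf j (by omega)).2, by simpa [consSeq] using (hf j (by omega)).1⟩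
  · exact ⟨hs _ _ (he i (by omega)).1, hs _ _ (hf i (by omega)).2,
      by simpa [consSeq] using hs _ _ (he i (by omega)).2⟩
  · simpa [consSeq] using h i (by omega) j (by omega)

theorem mem_span_insert_union_insert {S T : Set V} {a b y : V} {c d : K}
    (h : y - c • a + d • b ∈ Submodule.span K (S ∪ T)) :
    y ∈ Submodule.span K (insert a S ∪ insert b T) := by
  have h2 := Submodule.span_mono (Set.union_subset_union (Set.subset_insert a S)
    (Set.subset_insert b T)) h
  have h3 := Submodule.subset_span (R := K) (show a ∈ insert a S ∪ insert b T by simp)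
  have h4 := Submodule.subset_span (R := K) (show b ∈ insert a S ∪ insert b T by simp)
  have h5 := Submodule.add_mem _ (Submodule.sub_mem _ h2 (Submodule.smul_mem _ d h4))
    (Submodule.smul_mem _ c h3)
  convert h5 using 1
  abel

/-- Any subspace `W` of a nondegenerate subspace `U` is spanned by initial segments of the two
halves of a symplectic basis of `U`. -/
theorem exists_symplecticFamily_span [FiniteDimensional K V] (ω : V →ₗ[K] V →ₗ[K] K)
    (hω : ω.IsAlt) (m : ℕ) : ∀ U W : Submodule K V, Module.finrank K U ≤ m → W ≤ U →
      (∀ x ∈ U, (∀ y ∈ U, ω x y = 0) → x = 0) →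
      ∃ (k A B : ℕ) (e f : ℕ → V), A ≤ k ∧ B ≤ A ∧ IsSymplecticFamily ω k e f ∧
        Submodule.span K (e '' Set.Iio k ∪ f '' Set.Iio k) = U ∧
        Submodule.span K (e '' Set.Iio A ∪ f '' Set.Iio B) = W := by
  induction m with
  | zero =>
    intro U W hU hW _
    obtain rfl : U = ⊥ := Submodule.finrank_eq_zero.mp (Nat.le_zero.mp hU)
    obtain rfl : W = ⊥ := le_bot_iff.mp hW
    exact ⟨0, 0, 0, 0, 0, le_rfl, le_rfl, fun i hi => absurd hi (Nat.not_lt_zero i),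
      by simp, by simp⟩
  | succ m ih =>
    intro U W hU hW hnd
    by_cases hU0 : U = ⊥
    · subst hU0
      exact ih ⊥ W (by simp) hW hnd
    have hneg : ∀ x y, ω x y = - ω y x := fun x y => by rw [hω.neg]
    -- a hyperbolic pair `a, b` is split off together with its orthogonal complement in `U`
    have key : ∀ a b : V, a ∈ U → b ∈ U → ω a b = 1 → ∃ U' : Submodule K V,
        (∀ y ∈ U, y - ω y b • a + ω y a • b ∈ U') ∧
        ∃ (k A B : ℕ) (e f : ℕ → V), A ≤ k ∧ B ≤ A ∧
        IsSymplecticFamily ω (k + 1) (consSeq a e) (consSeq b f) ∧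
        Submodule.span K (consSeq a e '' Set.Iio (k + 1) ∪ consSeq b f '' Set.Iio (k + 1)) = U ∧
        Submodule.span K (e '' Set.Iio A ∪ f '' Set.Iio B) = W ⊓ U' ∧
        (∀ i < k, ω (e i) (f i) = 1) := by
      intro a b ha hb hab
      have hba : ω b a = -1 := by rw [hneg, hab]
      let U' : Submodule K V := U ⊓ (LinearMap.ker (ω a) ⊓ LinearMap.ker (ω b))
      have hmem : ∀ x, x ∈ U' ↔ x ∈ U ∧ ω a x = 0 ∧ ω b x = 0 := fun x => by
        simp [U', LinearMap.mem_ker]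
      have hproj : ∀ y ∈ U, y - ω y b • a + ω y a • b ∈ U' := by
        intro y hy
        rw [hmem]
        refine ⟨U.add_mem (U.sub_mem hy (U.smul_mem _ ha)) (U.smul_mem _ hb), ?_, ?_⟩
        · simp [hω a, hab, hneg a y]
        · simp [hω b, hba, hneg b y]
      have hlt : U' < U := by
        refine lt_of_le_of_ne inf_le_left fun h => ?_
        have h' := ((hmem a).1 (h ▸ ha)).2.2
        rw [hba] at h'
        exact one_ne_zero (neg_eq_zero.mp h')
      obtain ⟨k, A, B, e, f, hA, hB, hef, hspan, hspanW⟩ := ih U' (W ⊓ U')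
        (by have := Submodule.finrank_lt_finrank_of_lt hlt; omega) inf_le_right (by
          intro x hx hx0
          refine hnd x ((hmem x).1 hx).1 fun y hy => ?_
          have h1 := hx0 _ (hproj y hy)
          have h2 : ω x a = 0 := by rw [hneg, ((hmem x).1 hx).2.1, neg_zero]
          have h3 : ω x b = 0 := by rw [hneg, ((hmem x).1 hx).2.2, neg_zero]
          simpa [h2, h3] using h1)
      have heU : ∀ i < k, e i ∈ U' := fun i hi =>
        hspan ▸ Submodule.subset_span (Or.inl ⟨i, hi, rfl⟩)
      have hfU : ∀ i < k, f i ∈ U' := fun i hi =>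
        hspan ▸ Submodule.subset_span (Or.inr ⟨i, hi, rfl⟩)
      refine ⟨U', hproj, k, A, B, e, f, hA, hB,
        hef.cons hω hab (fun i hi => ((hmem _).1 (heU i hi)).2)
          (fun i hi => ((hmem _).1 (hfU i hi)).2), ?_, hspanW, fun i hi => ?_⟩
      · rw [consSeq_image_Iio_succ, consSeq_image_Iio_succ]
        apply le_antisymm
        · rw [Submodule.span_le]
          rintro x ((rfl | ⟨i, hi, rfl⟩) | (rfl | ⟨i, hi, rfl⟩))
          exacts [ha, hlt.le (heU i hi), hb, hlt.le (hfU i hi)]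
        · intro y hy
          exact mem_span_insert_union_insert (hspan.symm ▸ hproj y hy)
      · simpa using (hef i hi i hi).2.2
    have hpair : ∀ a ∈ U, a ≠ 0 → ∃ b ∈ U, ω a b = 1 := by
      intro a ha ha0
      by_contra! h
      refine ha0 (hnd a ha fun y hy => ?_)
      by_contra hy0
      exact h ((ω a y)⁻¹ • y) (U.smul_mem _ hy) (by simp [hy0])
    by_cases hiso : ∀ x ∈ W, ∀ y ∈ W, ω x y = 0
    · by_cases hW0 : W = ⊥
      · obtain ⟨a, ha, ha0⟩ := Submodule.exists_mem_ne_zero_of_ne_bot hU0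
        obtain ⟨b, hb, hab⟩ := hpair a ha ha0
        obtain ⟨U', -, k, A, B, e, f, -, -, hef, hspan, -, -⟩ := key a b ha hb hab
        exact ⟨k + 1, 0, 0, _, _, Nat.zero_le _, Nat.zero_le _, hef, hspan, by simp [hW0]⟩
      · obtain ⟨a, haW, ha0⟩ := Submodule.exists_mem_ne_zero_of_ne_bot hW0
        obtain ⟨b, hb, hab⟩ := hpair a (hW haW) ha0
        obtain ⟨U', hproj, k, A, B, e, f, hA, hB, hef, hspan, hspanW, hone⟩ :=
          key a b (hW haW) hb hab
        have heW : ∀ i < A, e i ∈ W := fun i hi =>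
          (hspanW.le (Submodule.subset_span (Or.inl ⟨i, hi, rfl⟩))).1
        have hfW : ∀ i < B, f i ∈ W := fun i hi =>
          (hspanW.le (Submodule.subset_span (Or.inr ⟨i, hi, rfl⟩))).1
        have hB0 : B = 0 := by
          by_contra hB0
          have h0 : 0 < B := Nat.pos_of_ne_zero hB0
          have h1 := hone 0 (by omega)
          rw [hiso _ (heW 0 (by omega)) _ (hfW 0 h0)] at h1
          exact zero_ne_one h1
        subst hB0
        refine ⟨k + 1, A + 1, 0, _, _, by omega, by omega, hef, hspan, ?_⟩
        rw [consSeq_image_Iio_succ, ← Nat.bot_eq_zero, Set.Iio_bot, Set.image_empty,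
          Set.union_empty]
        apply le_antisymm
        · rw [Submodule.span_le]
          rintro x (rfl | ⟨i, hi, rfl⟩)
          exacts [haW, heW i hi]
        · intro y hy
          have h1 : y - ω y b • a ∈ W ⊓ U' := by
            refine ⟨W.sub_mem hy (W.smul_mem _ haW), ?_⟩
            simpa [hiso y hy a haW] using hproj y (hW hy)
          rw [← hspanW, ← Nat.bot_eq_zero, Set.Iio_bot, Set.image_empty, Set.union_empty] at h1
          have h2 := Submodule.span_mono (Set.subset_insert a _) h1
          have h3 := Submodule.subset_span (R := K) (Set.mem_insert a (e '' Set.Iio A))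
          simpa using Submodule.add_mem _ h2 (Submodule.smul_mem _ (ω y b) h3)
    · push Not at hiso
      obtain ⟨a, haW, y, hyW, hay⟩ := hiso
      obtain ⟨U', hproj, k, A, B, e, f, hA, hB, hef, hspan, hspanW, -⟩ :=
        key a ((ω a y)⁻¹ • y) (hW haW) (U.smul_mem _ (hW hyW)) (by simp [hay])
      have hbW : (ω a y)⁻¹ • y ∈ W := W.smul_mem _ hyW
      generalize (ω a y)⁻¹ • y = b at *
      refine ⟨k + 1, A + 1, B + 1, _, _, by omega, by omega, hef, hspan, ?_⟩
      rw [consSeq_image_Iio_succ, consSeq_image_Iio_succ]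
      apply le_antisymm
      · rw [Submodule.span_le]
        rintro x ((rfl | ⟨i, hi, rfl⟩) | (rfl | ⟨i, hi, rfl⟩))
        exacts [haW, (hspanW.le (Submodule.subset_span (Or.inl ⟨i, hi, rfl⟩))).1,
          hbW, (hspanW.le (Submodule.subset_span (Or.inr ⟨i, hi, rfl⟩))).1]
      · intro z hz
        have h1 : z - ω z b • a + ω z a • b ∈ W ⊓ U' :=
          ⟨W.add_mem (W.sub_mem hz (W.smul_mem _ haW)) (W.smul_mem _ hbW), hproj z (hW hz)⟩
        rw [← hspanW] at h1
        exact mem_span_insert_union_insert h1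

end SymplecticFamily

section SymplecticOrbits

variable (F : Type*) [Field F] (n : ℕ)

/-- The standard symplectic form on `F²ⁿ`. -/
noncomputable def stdSymplecticForm :
    (Fin n ⊕ Fin n → F) →ₗ[F] (Fin n ⊕ Fin n → F) →ₗ[F] F :=
  Matrix.toLinearMap₂' F (-Matrix.J (Fin n) F)

variable {F n}

theorem stdSymplecticForm_eq_dotProduct (x y : Fin n ⊕ Fin n → F) :
    stdSymplecticForm F n x y = x ⬝ᵥ (-Matrix.J (Fin n) F) *ᵥ y :=
  Matrix.toLinearMap₂'_apply' _ _ _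

theorem stdSymplecticForm_apply (x y : Fin n ⊕ Fin n → F) :
    stdSymplecticForm F n x y =
      ∑ i, x (Sum.inl i) * y (Sum.inr i) - ∑ i, x (Sum.inr i) * y (Sum.inl i) := by
  rw [stdSymplecticForm_eq_dotProduct, Matrix.J, Matrix.fromBlocks_neg, Matrix.fromBlocks_mulVec]
  simp [dotProduct, Fintype.sum_sum_type, Matrix.neg_mulVec, sub_eq_add_neg]

theorem stdSymplecticForm_isAlt : (stdSymplecticForm F n).IsAlt := fun x => by
  rw [stdSymplecticForm_apply, sub_eq_zero]
  exact Finset.sum_congr rfl fun i _ => mul_comm _ _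

theorem eq_zero_of_stdSymplecticForm_eq_zero {x : Fin n ⊕ Fin n → F}
    (h : ∀ y, stdSymplecticForm F n x y = 0) : x = 0 := by
  ext (i | i)
  · simpa [stdSymplecticForm_apply, Pi.single_apply] using h (Pi.single (Sum.inr i) 1)
  · simpa [stdSymplecticForm_apply, Pi.single_apply] using h (Pi.single (Sum.inl i) 1)

theorem IsSymplecticFamily.linearIndependent {K V : Type*} [Field K] [AddCommGroup V] [Module K V]
    {ω : V →ₗ[K] V →ₗ[K] K} {k : ℕ} {e f : ℕ → V}
    (h : IsSymplecticFamily ω k e f) :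
    LinearIndependent K (Sum.elim (fun i : Fin k => e i) fun i : Fin k => f i) := by
  rw [Fintype.linearIndependent_iff]
  intro g hg
  simp only [Fintype.sum_sum_type, Sum.elim_inl, Sum.elim_inr] at hg
  rintro (j | j)
  · have h1 := congrArg (fun x => ω x (f j)) hg
    simpa [(h _ (Fin.is_lt _) _ (Fin.is_lt _)).1, (h _ (Fin.is_lt _) _ (Fin.is_lt _)).2.1,
      (h _ (Fin.is_lt _) _ (Fin.is_lt _)).2.2, Fin.val_inj] using h1
  · have h1 := congrArg (fun x => ω (e j) x) hg
    simpa [(h _ (Fin.is_lt _) _ (Fin.is_lt _)).1, (h _ (Fin.is_lt _) _ (Fin.is_lt _)).2.1,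
      (h _ (Fin.is_lt _) _ (Fin.is_lt _)).2.2, Fin.val_inj] using h1

/-- The symplectic group acts on the subspaces of `F²ⁿ` by taking images. -/
@[reducible]
noncomputable def symplecticActionSubmodule :
    MulAction (Matrix.symplecticGroup (Fin n) F) (Submodule F (Fin n ⊕ Fin n → F)) where
  smul g W := W.map (Matrix.toLin' (g : Matrix (Fin n ⊕ Fin n) (Fin n ⊕ Fin n) F))
  one_smul W := by
    change W.map (Matrix.toLin' (1 : Matrix (Fin n ⊕ Fin n) (Fin n ⊕ Fin n) F)) = W
    rw [Matrix.toLin'_one, Submodule.map_id]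
  mul_smul g h W := by
    change W.map (Matrix.toLin' (g.1 * h.1)) =
      (W.map (Matrix.toLin' _)).map (Matrix.toLin' _)
    rw [Matrix.toLin'_mul, Submodule.map_comp]

/-- The span of the first `A` vectors `eᵢ` and the first `B` vectors `fᵢ` of the standard
symplectic basis. -/
def stdSubspace (F : Type*) [Field F] (n A B : ℕ) : Submodule F (Fin n ⊕ Fin n → F) :=
  Submodule.span F ((fun i : Fin n => Pi.single (Sum.inl i) 1) '' {i | (i : ℕ) < A} ∪
    (fun i : Fin n => Pi.single (Sum.inr i) 1) '' {i | (i : ℕ) < B})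

/-- Every subspace of `F²ⁿ` is in the orbit of one spanned by initial parts of the standard
symplectic basis. -/
theorem exists_map_stdSubspace_eq (W : Submodule F (Fin n ⊕ Fin n → F)) :
    ∃ g : Matrix.symplecticGroup (Fin n) F, ∃ A B : ℕ, A ≤ n ∧ B ≤ n ∧
      (stdSubspace F n A B).map
        (Matrix.toLin' (g : Matrix (Fin n ⊕ Fin n) (Fin n ⊕ Fin n) F)) = W := by
  obtain ⟨k, A, B, e, f, hA, hB, hef, hspan, hspanW⟩ :=
    exists_symplecticFamily_span (stdSymplecticForm F n) stdSymplecticForm_isAlt _ ⊤ W le_rfl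
      le_top fun x _ h => eq_zero_of_stdSymplecticForm_eq_zero fun y => h y trivial
  have hk : k = n := by
    have h1 := finrank_span_eq_card hef.linearIndependent
    have h2 : Set.range (Sum.elim (fun i : Fin k => e i) fun i : Fin k => f i) =
        e '' Set.Iio k ∪ f '' Set.Iio k := by
      rw [Set.Sum.elim_range]
      congr 1 <;> ext x <;> simp [Fin.exists_iff]
    rw [h2, hspan, finrank_top, Module.finrank_fintype_fun_eq_card] at h1
    simp only [Fintype.card_sum, Fintype.card_fin] at h1
    omega
  subst hk
  let b : Fin k ⊕ Fin k → Fin k ⊕ Fin k → F := Sum.elim (fun i => e i) fun i => f i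
  let g : Matrix (Fin k ⊕ Fin k) (Fin k ⊕ Fin k) F := (Matrix.of b)ᵀ
  have hJ : ∀ x y, stdSymplecticForm F k (b x) (b y) = (-Matrix.J (Fin k) F) x y := by
    have hneg := fun x y => (stdSymplecticForm_isAlt (F := F) (n := k)).neg x y
    rintro (i | i) (j | j)
    · simpa [b, Matrix.J] using (hef i i.2 j j.2).1
    · simpa [b, Matrix.J, Matrix.one_apply, Fin.val_inj] using (hef i i.2 j j.2).2.2
    · rw [← hneg]
      simpa [b, Matrix.J, Matrix.one_apply, Fin.val_inj, eq_comm] using (hef j j.2 i i.2).2.2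
    · simpa [b, Matrix.J] using (hef i i.2 j j.2).2.1
  have hg : gᵀ * Matrix.J (Fin k) F * g = Matrix.J (Fin k) F := by
    rw [← neg_inj]
    ext x y
    refine Eq.trans ?_ (hJ x y)
    rw [stdSymplecticForm_eq_dotProduct, ← Matrix.neg_mul, ← Matrix.mul_neg, Matrix.mul_assoc]
    rfl
  have hcol : ∀ x, Matrix.toLin' g (Pi.single x 1) = b x := fun x => by
    rw [Matrix.toLin'_apply, Matrix.mulVec_single_one]
    rfl
  refine ⟨⟨g, SymplecticGroup.mem_iff'.2 hg⟩, A, B, hA, hB.trans hA, ?_⟩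
  rw [stdSubspace, Submodule.map_span, ← hspanW, Set.image_union, Set.image_image, Set.image_image]
  simp only [hcol]
  congr 2
  · ext x
    constructor
    · rintro ⟨i, hi, rfl⟩
      exact ⟨i, hi, rfl⟩
    · rintro ⟨i, hi, rfl⟩
      exact ⟨⟨i, lt_of_lt_of_le hi hA⟩, hi, rfl⟩
  · ext x
    constructor
    · rintro ⟨i, hi, rfl⟩
      exact ⟨i, hi, rfl⟩
    · rintro ⟨i, hi, rfl⟩
      exact ⟨⟨i, lt_of_lt_of_le hi (hB.trans hA)⟩, hi, rfl⟩

end SymplecticOrbits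

section Counting

/-- By Burnside's lemma, the total number of subspaces invariant under the elements of the
symplectic group is at most `(n + 1)²` times the order of the group. -/
theorem sum_card_invariant_submodule_le {F : Type*} [Field F] [Finite F] (n : ℕ) :
    ∑ᶠ g : Matrix.symplecticGroup (Fin n) F,
      {W : Submodule F (Fin n ⊕ Fin n → F) | W.map (Matrix.toLin' g.1) = W}.ncard ≤
      (n + 1) ^ 2 * Nat.card (Matrix.symplecticGroup (Fin n) F) := by
  classical
  let := symplecticActionSubmodule (F := F) (n := n)
  let := Fintype.ofFinite F
  let := Fintype.ofFinite (Submodule F (Fin n ⊕ Fin n → F))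
  let := Fintype.ofFinite (Matrix.symplecticGroup (Fin n) F)
  let Q := Quotient (MulAction.orbitRel (Matrix.symplecticGroup (Fin n) F)
    (Submodule F (Fin n ⊕ Fin n → F)))
  let : Fintype Q := Fintype.ofFinite Q
  have hB := MulAction.sum_card_fixedBy_eq_card_orbits_mul_card_group
    (Matrix.symplecticGroup (Fin n) F) (Submodule F (Fin n ⊕ Fin n → F))
  have hQ : Fintype.card Q ≤ (n + 1) ^ 2 := by
    have hsurj : Function.Surjective fun x : Fin (n + 1) × Fin (n + 1) =>
        (Quotient.mk _ (stdSubspace F n x.1 x.2) : Q) := by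
      intro x
      obtain ⟨W, rfl⟩ := Quotient.exists_rep x
      obtain ⟨g, A, B, hA, hB, h⟩ := exists_map_stdSubspace_eq W
      refine ⟨(⟨A, by omega⟩, ⟨B, by omega⟩), (Quotient.sound ?_).symm⟩
      exact MulAction.orbitRel_apply.2 ⟨g, h⟩
    simpa [sq] using Fintype.card_le_of_surjective _ hsurj
  rw [finsum_eq_sum_of_fintype, Nat.card_eq_fintype_card]
  refine le_trans (le_of_eq ?_) (hB.le.trans (Nat.mul_le_mul_right _ hQ))
  refine Finset.sum_congr rfl fun g _ => ?_
  rw [← Nat.card_eq_fintype_card]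
  rfl

/-- The smallest `M`-invariant subspace containing the given vectors, when `minpoly F M` has
degree at most `d`. -/
def krylovSpan {F ι : Type*} [Field F] [Fintype ι] [DecidableEq ι] (M : Matrix ι ι F) (d : ℕ)
    {r : ℕ} (v : Fin r → ι → F) : Submodule F (ι → F) :=
  Submodule.span F (Set.range fun x : Fin r × Fin d => (M ^ (x.2 : ℕ)) *ᵥ v x.1)

section Krylov

variable {F ι : Type*} [Field F] [Fintype ι] [DecidableEq ι] (M : Matrix ι ι F) {r : ℕ}
  (v : Fin r → ι → F)

theorem finrank_krylovSpan_le (d : ℕ) : Module.finrank F (krylovSpan M d v) ≤ r * d := by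
  have h := finrank_range_le_card (R := F)
    fun x : Fin r × Fin d => (M ^ (x.2 : ℕ)) *ᵥ v x.1
  rwa [Fintype.card_prod, Fintype.card_fin, Fintype.card_fin] at h

theorem mem_krylovSpan {d : ℕ} (hd : 0 < d) (j : Fin r) : v j ∈ krylovSpan M d v :=
  Submodule.subset_span ⟨(j, ⟨0, hd⟩), by simp⟩

theorem pow_mulVec_mem_krylovSpan {d : ℕ} (hd : (minpoly F M).natDegree = d) (i : ℕ) (j : Fin r) :
    (M ^ i) *ᵥ v j ∈ krylovSpan M d v := by
  have hmonic := minpoly.monic (Algebra.IsIntegral.isIntegral (R := F) M)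
  have h : M ^ i ∈ Submodule.span F (Set.range fun i : Fin d => M ^ (i : ℕ)) := by
    refine PowerBasis.mem_span_pow'.2 ⟨Polynomial.X ^ i %ₘ minpoly F M, ?_, ?_⟩
    · refine (Polynomial.degree_modByMonic_lt _ hmonic).trans_le ?_
      rw [Polynomial.degree_eq_natDegree hmonic.ne_zero, hd]
    · rw [Polynomial.aeval_modByMonic_eq_self_of_root (minpoly.aeval F M)]
      simp
  generalize M ^ i = N at h
  induction h using Submodule.span_induction with
  | mem x hx =>
    obtain ⟨k, rfl⟩ := hx
    exact Submodule.subset_span ⟨(j, k), rfl⟩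
  | zero => simp
  | add x y _ _ hx hy => rw [Matrix.add_mulVec]; exact Submodule.add_mem _ hx hy
  | smul c x _ hx => rw [Matrix.smul_mulVec]; exact Submodule.smul_mem _ c hx

theorem map_krylovSpan (hM : IsUnit M.det) :
    (krylovSpan M (minpoly F M).natDegree v).map (Matrix.toLin' M) =
      krylovSpan M (minpoly F M).natDegree v := by
  refine Submodule.eq_of_le_of_finrank_eq ?_ ?_
  · rw [krylovSpan, Submodule.map_span, Submodule.span_le]
    rintro _ ⟨_, ⟨⟨j, k⟩, rfl⟩, rfl⟩
    simp only [Matrix.toLin'_apply, Matrix.mulVec_mulVec, ← pow_succ']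
    exact pow_mulVec_mem_krylovSpan M v rfl _ j
  · exact (Submodule.equivMapOfInjective (Matrix.toLin' M)
      (Matrix.mulVec_injective_of_isUnit ((Matrix.isUnit_iff_isUnit_det M).2 hM)) _).finrank_eq.symm

end Krylov

/-- A matrix whose minimal polynomial has small degree has many invariant subspaces. -/
theorem pow_le_card_invariant_submodule {F ι : Type*} [Field F] [Finite F] [Fintype ι]
    [DecidableEq ι] [Nonempty ι] (M : Matrix ι ι F) (hM : IsUnit M.det) (r : ℕ) :
    Nat.card F ^ (r * Fintype.card ι) ≤ Nat.card F ^ (r * (r * (minpoly F M).natDegree)) *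
      {W : Submodule F (ι → F) | W.map (Matrix.toLin' M) = W}.ncard := by
  classical
  let := Fintype.ofFinite F
  let := Fintype.ofFinite (Submodule F (ι → F))
  set d := (minpoly F M).natDegree with hd
  have hd0 : 0 < d := minpoly.natDegree_pos (Algebra.IsIntegral.isIntegral (R := F) M)
  have h := Finset.card_le_mul_card_image_of_maps_to
    (s := (Finset.univ : Finset (Fin r → ι → F)))
    (t := (Finset.univ.filter fun W : Submodule F (ι → F) =>
      W.map (Matrix.toLin' M) = W ∧ Module.finrank F W ≤ r * d))
    (f := krylovSpan M d) (fun v _ => by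
      simpa using ⟨map_krylovSpan M v hM, finrank_krylovSpan_le M v d⟩)
    (Nat.card F ^ (r * (r * d))) (fun W hW => by
      have hWd := (Finset.mem_filter.1 hW).2.2
      have hinj : (Finset.univ.filter fun v : Fin r → ι → F => krylovSpan M d v = W).card ≤
          Fintype.card (Fin r → W) := by
        rw [← Fintype.card_coe]
        refine Fintype.card_le_of_injective (fun v j => ⟨v.1 j,
          (Finset.mem_filter.1 v.2).2.le (mem_krylovSpan M v.1 hd0 j)⟩) fun v w hvw => ?_
        ext j : 2
        exact congrArg Subtype.val (congrFun hvw j)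
      refine hinj.trans ?_
      rw [Fintype.card_fun, Fintype.card_fin, Module.card_eq_pow_finrank (K := F), ← pow_mul,
        Nat.card_eq_fintype_card, mul_comm r (r * d)]
      exact Nat.pow_le_pow_right Fintype.card_pos (Nat.mul_le_mul_right _ hWd))
  rw [Finset.card_univ, Fintype.card_fun, Fintype.card_fun, Fintype.card_fin, ← pow_mul,
    mul_comm (Fintype.card ι), ← Nat.card_eq_fintype_card (α := F)] at h
  refine h.trans (Nat.mul_le_mul_left _ ?_)
  rw [Set.ncard_eq_toFinset_card']
  refine Finset.card_le_card fun W hW => ?_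
  simpa using (Finset.mem_filter.1 hW).2.1

/-- The number of symplectic matrices with minimal polynomial of degree `d`. -/
theorem card_symplectic_natDegree_minpoly_le {F : Type*} [Field F] [Finite F] {n : ℕ} (hn : 0 < n)
    (d r : ℕ) :
    {M : Matrix (Fin n ⊕ Fin n) (Fin n ⊕ Fin n) F |
        M ∈ Matrix.symplecticGroup (Fin n) F ∧ (minpoly F M).natDegree = d}.ncard *
        Nat.card F ^ (r * (2 * n)) ≤
      Nat.card F ^ (r * (r * d)) *
        ((n + 1) ^ 2 * Nat.card (Matrix.symplecticGroup (Fin n) F)) := by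
  classical
  let := Fintype.ofFinite F
  let := Fintype.ofFinite (Matrix.symplecticGroup (Fin n) F)
  have : Nonempty (Fin n) := ⟨⟨0, hn⟩⟩
  let S := Finset.univ.filter fun g : Matrix.symplecticGroup (Fin n) F =>
    (minpoly F g.1).natDegree = d
  have hS : {M : Matrix (Fin n ⊕ Fin n) (Fin n ⊕ Fin n) F |
      M ∈ Matrix.symplecticGroup (Fin n) F ∧ (minpoly F M).natDegree = d}.ncard = S.card := by
    rw [← Set.ncard_coe_finset, ← Set.ncard_image_of_injective _ Subtype.val_injective]
    congr 1
    ext M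
    simp [S, and_comm]
  refine le_trans ?_ (Nat.mul_le_mul_left _ (sum_card_invariant_submodule_le n))
  rw [hS, finsum_eq_sum_of_fintype, Finset.mul_sum, ← smul_eq_mul, ← Finset.sum_const]
  refine (Finset.sum_le_sum fun g hg => ?_).trans
    (Finset.sum_le_sum_of_subset (Finset.subset_univ S))
  have h := pow_le_card_invariant_submodule g.1 (SymplecticGroup.symplectic_det g.2) r
  rwa [(Finset.mem_filter.1 hg).2, Fintype.card_sum, Fintype.card_fin, ← two_mul] at h

end Counting

section Asymptotics

theorem exists_forall_sq_le_rpow {q ε : ℝ} (hq : 1 < q) (hε : 0 < ε) :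
    ∃ N : ℕ, ∀ n : ℕ, N ≤ n → ((n : ℝ) + 1) ^ 2 ≤ q ^ (ε * n) := by
  have h := tendsto_pow_const_div_const_pow_of_one_lt 2 (Real.one_lt_rpow hq hε)
  obtain ⟨N, hN⟩ := Filter.eventually_atTop.1
    (h.eventually (gt_mem_nhds (show (0 : ℝ) < 1 / 4 by norm_num)))
  refine ⟨max N 1, fun n hn => ?_⟩
  have h1 : (1 : ℝ) ≤ n := by exact_mod_cast le_of_max_le_right hn
  have h2 := hN n (le_of_max_le_left hn)
  rw [div_lt_iff₀ (by positivity)] at h2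
  rw [Real.rpow_mul (by linarith), Real.rpow_natCast]
  nlinarith

/-- The exponent obtained from `r = ⌊n / d⌋` vectors. -/
theorem sq_div_two_mul_le {n d : ℕ} (hd : 0 < d) (hdn : d ≤ n) :
    (n : ℝ) ^ 2 / (2 * d) ≤
      ((n / d : ℕ) : ℝ) * (2 * n) - ((n / d : ℕ) : ℝ) * (((n / d : ℕ) : ℝ) * d) := by
  have hdR : (0 : ℝ) < d := by exact_mod_cast hd
  have hn : (d : ℝ) * ((n / d : ℕ) : ℝ) + ((n % d : ℕ) : ℝ) = n := by
    exact_mod_cast Nat.div_add_mod n d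
  have hb : ((n % d : ℕ) : ℝ) ≤ d := by exact_mod_cast (Nat.mod_lt n hd).le
  have ha : (1 : ℝ) ≤ ((n / d : ℕ) : ℝ) := by exact_mod_cast Nat.div_pos hdn hd
  have hb0 : (0 : ℝ) ≤ ((n % d : ℕ) : ℝ) := Nat.cast_nonneg _
  generalize ((n / d : ℕ) : ℝ) = a at *
  generalize ((n % d : ℕ) : ℝ) = b at *
  rw [div_le_iff₀ (by positivity), ← hn]
  have hda : (d : ℝ) ≤ d * a := le_mul_of_one_le_right hdR.le ha
  nlinarith

end Asymptotics

/-- Over a finite field with `q` elements and odd characteristic, for every `ε > 0`, for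
all sufficiently large `n`, all `δ < n` and all monic self-reciprocal `f` of degree `2n`
with `f(0) ≠ 0`, the number of symplectic `2n×2n` matrices `M` (i.e. `M·J·Mᵀ = J` for the
standard symplectic form `J = [[0,1],[−1,0]]`) with `deg (minpoly F M) = n − δ` and
`charpoly M = f` is at most `|Sp_{2n}(F)| · q^(ε·n − n²/(2(n−δ)))`. -/
theorem stmt_16 {F : Type*} [Field F] [Fintype F] (p : ℕ) [Fact p.Prime] (hp : Odd p)
    [CharP F p] (q : ℕ) (hq : q = Fintype.card F) :
    ∀ ε : ℝ, 0 < ε → ∃ N : ℕ, ∀ n : ℕ, N ≤ n → ∀ δ : ℕ, δ < n →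
      ∀ f : Polynomial F, f.Monic → f.natDegree = 2 * n → f.coeff 0 ≠ 0 →
      f.reverse = Polynomial.C (f.coeff 0) * f →
      ({M : Matrix (Fin n ⊕ Fin n) (Fin n ⊕ Fin n) F |
          M * (Matrix.fromBlocks (0 : Matrix (Fin n) (Fin n) F) 1 (-1) 0) * Mᵀ =
            Matrix.fromBlocks (0 : Matrix (Fin n) (Fin n) F) 1 (-1) 0 ∧
          (minpoly F M).natDegree = n - δ ∧ M.charpoly = f}.ncard : ℝ) ≤
        ({M : Matrix (Fin n ⊕ Fin n) (Fin n ⊕ Fin n) F |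
          M * (Matrix.fromBlocks (0 : Matrix (Fin n) (Fin n) F) 1 (-1) 0) * Mᵀ =
            Matrix.fromBlocks (0 : Matrix (Fin n) (Fin n) F) 1 (-1) 0}.ncard : ℝ) *
          (q : ℝ) ^ (ε * n - (n : ℝ) ^ 2 / (2 * ((n : ℝ) - (δ : ℝ)))) := by
  intro ε hε
  have hq1 : 1 < q := hq ▸ Fintype.one_lt_card
  have hqR : (1 : ℝ) < q := by exact_mod_cast hq1
  have hq0 : (0 : ℝ) < q := by linarith
  obtain ⟨N, hN⟩ := exists_forall_sq_le_rpow hqR hε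
  refine ⟨N, fun n hn δ hδ f _ _ _ _ => ?_⟩
  have hJ : Matrix.fromBlocks (0 : Matrix (Fin n) (Fin n) F) 1 (-1) 0 = -Matrix.J (Fin n) F := by
    simp [Matrix.J, Matrix.fromBlocks_neg]
  have hmem : ∀ M : Matrix (Fin n ⊕ Fin n) (Fin n ⊕ Fin n) F,
      M * (Matrix.fromBlocks (0 : Matrix (Fin n) (Fin n) F) 1 (-1) 0) * Mᵀ =
        Matrix.fromBlocks (0 : Matrix (Fin n) (Fin n) F) 1 (-1) 0 ↔
      M ∈ Matrix.symplecticGroup (Fin n) F := fun M => by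
    rw [hJ, Matrix.mul_neg, Matrix.neg_mul, neg_inj, SymplecticGroup.mem_iff]
  simp only [hmem]
  have hG : {M : Matrix (Fin n ⊕ Fin n) (Fin n ⊕ Fin n) F |
      M ∈ Matrix.symplecticGroup (Fin n) F}.ncard = Nat.card (Matrix.symplecticGroup (Fin n) F) :=
    rfl
  have hsub : {M : Matrix (Fin n ⊕ Fin n) (Fin n ⊕ Fin n) F |
        M ∈ Matrix.symplecticGroup (Fin n) F ∧ (minpoly F M).natDegree = n - δ ∧
          M.charpoly = f}.ncard ≤
      {M : Matrix (Fin n ⊕ Fin n) (Fin n ⊕ Fin n) F |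
        M ∈ Matrix.symplecticGroup (Fin n) F ∧ (minpoly F M).natDegree = n - δ}.ncard :=
    Set.ncard_le_ncard (fun M hM => ⟨hM.1, hM.2.1⟩) (Set.toFinite _)
  rw [hG]
  refine (Nat.cast_le.2 hsub).trans ?_
  have hcount := card_symplectic_natDegree_minpoly_le (F := F) (by omega : 0 < n) (n - δ)
    (n / (n - δ))
  have hexp := sq_div_two_mul_le (by omega : 0 < n - δ) (Nat.sub_le n δ)
  rw [← Nat.cast_sub hδ.le]
  rw [Nat.card_eq_fintype_card (α := F), ← hq] at hcount
  generalize Set.ncard {M : Matrix (Fin n ⊕ Fin n) (Fin n ⊕ Fin n) F |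
    M ∈ Matrix.symplecticGroup (Fin n) F ∧ (minpoly F M).natDegree = n - δ} = s at *
  generalize Nat.card (Matrix.symplecticGroup (Fin n) F) = c at *
  generalize n - δ = d at *
  generalize n / d = r at *
  have hcountR : (s : ℝ) * (q : ℝ) ^ ((r : ℝ) * (2 * n)) ≤
      (q : ℝ) ^ ((r : ℝ) * (r * d)) * (((n : ℝ) + 1) ^ 2 * c) := by
    have h : (s : ℝ) * (q : ℝ) ^ (r * (2 * n)) ≤
        (q : ℝ) ^ (r * (r * d)) * (((n : ℝ) + 1) ^ 2 * c) := by exact_mod_cast hcount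
    rw [← Real.rpow_natCast, ← Real.rpow_natCast] at h
    push_cast at h
    exact h
  rw [← le_div_iff₀ (by positivity)] at hcountR
  calc (s : ℝ) ≤ _ := hcountR
    _ = c * (((n : ℝ) + 1) ^ 2 * (q : ℝ) ^ ((r : ℝ) * (r * d) - r * (2 * n))) := by
      rw [Real.rpow_sub hq0]
      ring
    _ ≤ c * ((q : ℝ) ^ (ε * n) * (q : ℝ) ^ (-((n : ℝ) ^ 2 / (2 * d)))) := by
      gcongr
      · exact hN n hn
      · exact hqR.le
      · linarith
    _ = _ := by rw [← Real.rpow_add hq0, sub_eq_add_neg]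
end
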